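/- Let n ≥ 2, λ ≥ 1, and let A be a C^∞ map from B(0,2) ⊂ ℝⁿ to n×n real matrices, uniformly elliptic with constant λ, with A(0) = I. Then there exist constants C₁ ≥ 1 and C₂ ≥ 0 (depending only on n and A) such that for every smooth, not identically zero solution u of div(A∇u) = 0 on B(0,2) and every 0 < r ≤ 1/4, one has C₁^{-1} β_u(0,r) − C₂ ≤ N_u(0,r) ≤ C₁ β_u(0,4r) + C₂. -/

import Mathlib

open MeasureTheory Metric

noncomputable section

/-- Partial derivative in the `i`-th coordinate direction. -/
def pd {n : ℕ} (i : Fin n) (u : EuclideanSpace ℝ (Fin n) → ℝ) :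
    EuclideanSpace ℝ (Fin n) → ℝ :=
  fun x => fderiv ℝ u x (EuclideanSpace.single i 1)

/-- `A` is uniformly elliptic with constant `lam` on the set `s`. -/
def UnifElliptic {n : ℕ} (A : EuclideanSpace ℝ (Fin n) → Matrix (Fin n) (Fin n) ℝ)
    (lam : ℝ) (s : Set (EuclideanSpace ℝ (Fin n))) : Prop :=
  ∀ x ∈ s, ∀ ξ : Fin n → ℝ,
    lam⁻¹ * (∑ i, ξ i ^ 2) ≤ ∑ i, ∑ j, A x i j * ξ i * ξ j ∧
    ∑ i, ∑ j, A x i j * ξ i * ξ j ≤ lam * (∑ i, ξ i ^ 2)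

/-- `u` solves `div(A ∇ u) = 0` on `s`, i.e. `Σ_{i,j} ∂_i (A_{ij} ∂_j u) = 0` on `s`. -/
def SolvesDiv {n : ℕ} (A : EuclideanSpace ℝ (Fin n) → Matrix (Fin n) (Fin n) ℝ)
    (u : EuclideanSpace ℝ (Fin n) → ℝ) (s : Set (EuclideanSpace ℝ (Fin n))) : Prop :=
  ∀ x ∈ s, ∑ i, ∑ j, pd i (fun y => A y i j * pd j u y) x = 0

/-- `sup_{B(c,r)} |u|` over the closed ball `B(c,r)`. -/
def supBall {n : ℕ} (u : EuclideanSpace ℝ (Fin n) → ℝ) (c : EuclideanSpace ℝ (Fin n))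
    (r : ℝ) : ℝ :=
  ⨆ x : closedBall c r, |u x|

/-- The doubling index `N_u(x,r) = log₂ (sup_{B(x,2r)}|u| / sup_{B(x,r)}|u|)`. -/
def dIndex {n : ℕ} (u : EuclideanSpace ℝ (Fin n) → ℝ) (x : EuclideanSpace ℝ (Fin n))
    (r : ℝ) : ℝ :=
  Real.logb 2 (supBall u x (2 * r) / supBall u x r)

/-- Almgren-type frequency function `β_u(0,r) = r·D(r)/h(r)` for `div(A ∇ u) = 0`
(assuming `A 0 = I`), where `D(r) = r^{1-n} ∫_{B(0,r)} ⟨A∇u,∇u⟩` and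
`h(r) = r^{1-n} ∫_{∂B(0,r)} μ u²` with `μ(x) = ⟨A(x)x,x⟩/|x|²`. -/
def freq {n : ℕ} (A : EuclideanSpace ℝ (Fin n) → Matrix (Fin n) (Fin n) ℝ)
    (u : EuclideanSpace ℝ (Fin n) → ℝ) (r : ℝ) : ℝ :=
  r * (r ^ (1 - (n : ℝ)) * ∫ x in closedBall (0 : EuclideanSpace ℝ (Fin n)) r,
        ∑ i, ∑ j, A x i j * pd j u x * pd i u x) /
    (r ^ (1 - (n : ℝ)) * ∫ x in sphere (0 : EuclideanSpace ℝ (Fin n)) r,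
        ((∑ i, ∑ j, A x i j * x j * x i) / ‖x‖ ^ 2) * u x ^ 2 ∂ μH[(n : ℝ) - 1])

/-- The Euclidean space of dimension `n`. -/
abbrev Eu (n : ℕ) := EuclideanSpace ℝ (Fin n)

/-- The surface measure on the unit sphere. -/
abbrev sphMeas (n : ℕ) : Measure (sphere (0 : Eu n) 1) := (volume : Measure (Eu n)).toSphere

/-- The integral of `θ ↦ F (r θ)` over the unit sphere. -/
def sph {n : ℕ} (F : Eu n → ℝ) (r : ℝ) : ℝ := ∫ θ, F (r • (θ : Eu n)) ∂(sphMeas n)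

lemma integral_eq_sph {n : ℕ} (hn : 1 ≤ n) (F : Eu n → ℝ) (hF : Integrable F) :
    ∫ x, F x = ∫ s in Set.Ioi (0 : ℝ), s ^ (n - 1) * sph F s := by
  have : Nonempty (Fin n) := ⟨⟨0, hn⟩⟩
  have mp := (volume : Measure (Eu n)).measurePreserving_homeomorphUnitSphereProd
  have emb := (homeomorphUnitSphereProd (Eu n)).measurableEmbedding
  have hdim : Module.finrank ℝ (Eu n) = n := by simp
  rw [hdim] at mp
  set G : sphere (0 : Eu n) 1 × Set.Ioi (0 : ℝ) → ℝ := fun p => F ((p.2 : ℝ) • (p.1 : Eu n)) with hG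
  have hGF : ∀ x : ({(0 : Eu n)}ᶜ : Set (Eu n)), G (homeomorphUnitSphereProd (Eu n) x) = F x := by
    intro x
    have hx : (x : Eu n) ≠ 0 := x.2
    have : ‖(x : Eu n)‖ ≠ 0 := norm_ne_zero_iff.2 hx
    simp [hG, smul_smul, this]
  have h_int : Integrable G ((sphMeas n).prod (Measure.volumeIoiPow (n - 1))) := by
    rw [← mp.integrable_comp_emb emb]
    have h1 : Integrable (fun x : ({(0 : Eu n)}ᶜ : Set (Eu n)) => F x)
        (Measure.comap (↑) (volume : Measure (Eu n))) := by
      have := (integrableOn_iff_comap_subtypeVal (μ := (volume : Measure (Eu n))) (f := F)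
        (s := ({(0 : Eu n)}ᶜ : Set (Eu n))) (measurableSet_singleton _).compl).1 hF.integrableOn
      exact this
    refine h1.congr (Filter.Eventually.of_forall fun x => (hGF x).symm)
  calc
    ∫ x, F x = ∫ x : ({(0 : Eu n)}ᶜ : Set (Eu n)), F x ∂((volume : Measure (Eu n)).comap (↑)) := by
      rw [integral_subtype_comap (measurableSet_singleton _).compl F, restrict_compl_singleton]
    _ = ∫ p, G p ∂((sphMeas n).prod (Measure.volumeIoiPow (n - 1))) := by
      rw [← mp.integral_comp emb]
      exact integral_congr_ae (Filter.Eventually.of_forall fun x => (hGF x).symm)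
    _ = ∫ s : Set.Ioi (0 : ℝ), sph F s ∂(Measure.volumeIoiPow (n - 1)) := by
      rw [integral_prod_symm G h_int]; rfl
    _ = _ := by
      simp only [Measure.volumeIoiPow, ENNReal.ofReal]
      rw [integral_withDensity_eq_integral_smul,
        integral_subtype_comap measurableSet_Ioi fun a ↦ Real.toNNReal (a ^ (n - 1)) • sph F a,
        setIntegral_congr_fun measurableSet_Ioi fun x hx ↦ ?_]
      · rw [NNReal.smul_def, Real.coe_toNNReal _ (pow_nonneg (le_of_lt hx) _), smul_eq_mul]
      · exact (measurable_subtype_coe.pow_const _).real_toNNReal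

lemma sph_congr {n : ℕ} {F G : Eu n → ℝ} {r : ℝ} (hr : 0 ≤ r)
    (h : ∀ x, ‖x‖ = r → F x = G x) : sph F r = sph G r := by
  refine integral_congr_ae (Filter.Eventually.of_forall fun θ => h _ ?_)
  rw [norm_smul, norm_eq_of_mem_sphere, mul_one, Real.norm_of_nonneg hr]

lemma sph_integrable {n : ℕ} {F : Eu n → ℝ} {r : ℝ} (hr : 0 < r)
    (hF : ContinuousOn F {0}ᶜ) : Integrable (fun θ : sphere (0 : Eu n) 1 => F (r • (θ : Eu n)))
      (sphMeas n) := by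
  have : Continuous (fun θ : sphere (0 : Eu n) 1 => F (r • (θ : Eu n))) := by
    refine hF.comp_continuous (by fun_prop) fun θ => ?_
    have : (θ : Eu n) ≠ 0 := ne_zero_of_mem_unit_sphere θ
    simp [hr.ne', this]
  exact this.integrable_of_hasCompactSupport (HasCompactSupport.of_compactSpace _)

lemma sph_mono {n : ℕ} {F G : Eu n → ℝ} {r : ℝ} (hr : 0 < r)
    (hF : ContinuousOn F {0}ᶜ) (hG : ContinuousOn G {0}ᶜ)
    (h : ∀ x, ‖x‖ = r → F x ≤ G x) : sph F r ≤ sph G r := by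
  refine integral_mono (sph_integrable hr hF) (sph_integrable hr hG) fun θ => h _ ?_
  rw [norm_smul, norm_eq_of_mem_sphere, mul_one, Real.norm_of_nonneg hr.le]

lemma sph_nonneg {n : ℕ} {F : Eu n → ℝ} {r : ℝ} (hr : 0 ≤ r)
    (h : ∀ x, ‖x‖ = r → 0 ≤ F x) : 0 ≤ sph F r := by
  refine integral_nonneg fun θ => h _ ?_
  rw [norm_smul, norm_eq_of_mem_sphere, mul_one, Real.norm_of_nonneg hr]

lemma sph_add {n : ℕ} {F G : Eu n → ℝ} {r : ℝ} (hr : 0 < r)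
    (hF : ContinuousOn F {0}ᶜ) (hG : ContinuousOn G {0}ᶜ) :
    sph (fun x => F x + G x) r = sph F r + sph G r :=
  integral_add (sph_integrable hr hF) (sph_integrable hr hG)

lemma sph_sub {n : ℕ} {F G : Eu n → ℝ} {r : ℝ} (hr : 0 < r)
    (hF : ContinuousOn F {0}ᶜ) (hG : ContinuousOn G {0}ᶜ) :
    sph (fun x => F x - G x) r = sph F r - sph G r :=
  integral_sub (sph_integrable hr hF) (sph_integrable hr hG)

lemma sph_const_mul {n : ℕ} (c : ℝ) (F : Eu n → ℝ) (r : ℝ) :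
    sph (fun x => c * F x) r = c * sph F r :=
  integral_const_mul _ _

/-- Cauchy-Schwarz inequality for spherical integrals. -/
lemma sph_mul_sq_le {n : ℕ} {F G K : Eu n → ℝ} {r : ℝ} (hr : 0 < r)
    (hF : ContinuousOn F {0}ᶜ) (hG : ContinuousOn G {0}ᶜ) (hK : ContinuousOn K {0}ᶜ)
    (hF0 : ∀ x, ‖x‖ = r → 0 ≤ F x) (hG0 : ∀ x, ‖x‖ = r → 0 ≤ G x)
    (h : ∀ x, ‖x‖ = r → K x ^ 2 ≤ F x * G x) :
    sph K r ^ 2 ≤ sph F r * sph G r := by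
  have key : ∀ t : ℝ, 0 ≤ sph F r * (t * t) + (2 * sph K r) * t + sph G r := by
    intro t
    have h0 : 0 ≤ sph (fun x => (t * t) * F x + ((2 * t) * K x + G x)) r := by
      refine sph_nonneg hr.le fun x hx => ?_
      have h1 := h x hx
      have h2 := hF0 x hx
      have h3 := hG0 x hx
      rcases eq_or_lt_of_le h2 with h4 | h4
      · rw [← h4] at h1 ⊢
        have : K x = 0 := by
          have : K x ^ 2 = 0 := le_antisymm (by simpa using h1) (sq_nonneg _)
          exact pow_eq_zero_iff (two_ne_zero) |>.1 this
        simp [this, h3]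
      · have : 0 ≤ F x * ((t * t) * F x + ((2 * t) * K x + G x)) := by
          nlinarith [sq_nonneg (t * F x + K x)]
        exact nonneg_of_mul_nonneg_right this h4
    rw [sph_add (F := fun x => t * t * F x) (G := fun x => 2 * t * K x + G x) hr
      (by fun_prop) (by fun_prop),
      sph_add (F := fun x => 2 * t * K x) hr (by fun_prop) hG, sph_const_mul, sph_const_mul] at h0
    linarith
  have := discrim_le_zero key
  rw [discrim] at this
  nlinarith

lemma fderiv_eq_sum_pd {n : ℕ} (F : Eu n → ℝ) (x v : Eu n) :
    fderiv ℝ F x v = ∑ i, v i * pd i F x := by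
  have h : v = ∑ i, v i • (EuclideanSpace.single i (1 : ℝ) : Eu n) := by
    ext j
    simp [Finset.sum_apply, Pi.single_apply]
  conv_lhs => rw [h]
  simp [map_sum, pd]

lemma continuousOn_pd {n : ℕ} {F : Eu n → ℝ} {U : Set (Eu n)} (hU : IsOpen U)
    (hF : ContDiffOn ℝ 1 F U) (i : Fin n) : ContinuousOn (pd i F) U :=
  (hF.continuousOn_fderiv_of_isOpen hU le_rfl).clm_apply continuousOn_const

lemma continuousOn_sph {n : ℕ} {F : Eu n → ℝ} (hF : ContinuousOn F {0}ᶜ) :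
    ContinuousOn (sph F) (Set.Ioi 0) := by
  refine continuousOn_integral_of_compact_support (k := Set.univ)
    (f := fun (r : ℝ) (θ : sphere (0 : Eu n) 1) => F (r • (θ : Eu n))) isCompact_univ ?_ (by simp)
  refine hF.comp (by fun_prop) ?_
  rintro ⟨r, θ⟩ ⟨hr, -⟩
  have : (θ : Eu n) ≠ 0 := ne_zero_of_mem_unit_sphere θ
  have hr' : r ≠ 0 := ne_of_gt hr
  simp [hr', this]

lemma hasDerivAt_sph {n : ℕ} {F : Eu n → ℝ} (hF : ContDiffOn ℝ 1 F {0}ᶜ) {r : ℝ} (hr : 0 < r) :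
    HasDerivAt (sph F) (sph (fun x => ∑ i, x i * pd i F x) r / r) r := by
  have hopen : IsOpen ({0}ᶜ : Set (Eu n)) := isOpen_compl_singleton
  set F' : ℝ → sphere (0 : Eu n) 1 → ℝ := fun s θ => fderiv ℝ F (s • (θ : Eu n)) θ with hF'
  have hne : ∀ s : ℝ, 0 < s → ∀ θ : sphere (0 : Eu n) 1, s • (θ : Eu n) ∈ ({0}ᶜ : Set (Eu n)) := by
    intro s hs θ
    have : (θ : Eu n) ≠ 0 := ne_zero_of_mem_unit_sphere θ
    simp [hs.ne', this]
  have hcont : ContinuousOn (Function.uncurry F') (Set.Ioi 0 ×ˢ Set.univ) := by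
    refine ContinuousOn.clm_apply ?_ (by fun_prop)
    refine (hF.continuousOn_fderiv_of_isOpen hopen le_rfl).comp (by fun_prop) ?_
    rintro ⟨s, θ⟩ ⟨hs, -⟩
    exact hne s hs θ
  obtain ⟨C, hC⟩ := ((isCompact_Icc (a := r / 2) (b := 2 * r)).prod
    (isCompact_univ (X := sphere (0 : Eu n) 1))).exists_bound_of_continuousOn
      (hcont.mono (by
        rintro ⟨s, θ⟩ ⟨hs, -⟩
        exact ⟨lt_of_lt_of_le (by positivity) hs.1, trivial⟩))
  have hder : ∀ θ : sphere (0 : Eu n) 1, ∀ s, 0 < s →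
      HasDerivAt (fun s : ℝ => F (s • (θ : Eu n))) (F' s θ) s := by
    intro θ s hs
    have h1 : HasFDerivAt F (fderiv ℝ F (s • (θ : Eu n))) (s • (θ : Eu n)) :=
      ((hF.differentiableOn one_ne_zero).differentiableAt (hopen.mem_nhds (hne s hs θ))).hasFDerivAt
    have h2 : HasDerivAt (fun s : ℝ => s • (θ : Eu n)) (θ : Eu n) s := by
      simpa using (hasDerivAt_id s).smul_const (θ : Eu n)
    exact h1.comp_hasDerivAt s h2
  have hcF : ∀ s : ℝ, 0 < s → Continuous (fun θ : sphere (0 : Eu n) 1 => F (s • (θ : Eu n))) :=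
    fun s hs => hF.continuousOn.comp_continuous (by fun_prop) (hne s hs)
  have hnhds : Set.Ioo (r / 2) (2 * r) ∈ nhds r := Ioo_mem_nhds (by linarith) (by linarith)
  have hcF' : Continuous (F' r) := by
    have := hcont.comp_continuous (f := fun θ : sphere (0 : Eu n) 1 => (r, θ)) (by fun_prop)
      (fun θ => ⟨hr, trivial⟩)
    exact this
  have key : HasDerivAt (sph F) (∫ θ, F' r θ ∂(sphMeas n)) r := (hasDerivAt_integral_of_dominated_loc_of_deriv_le (μ := sphMeas n)
    (F := fun s θ => F (s • (θ : Eu n))) (F' := F') (x₀ := r) (bound := fun _ => C) hnhds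
    (by
      filter_upwards [lt_mem_nhds hr] with s hs
      exact (hcF s hs).aestronglyMeasurable)
    (sph_integrable hr hF.continuousOn)
    hcF'.aestronglyMeasurable
    (Filter.Eventually.of_forall fun θ s hs => hC (s, θ) ⟨⟨hs.1.le, hs.2.le⟩, trivial⟩)
    (integrable_const C)
    (Filter.Eventually.of_forall fun θ s hs =>
      hder θ s (lt_trans (by positivity) hs.1))).2
  refine key.congr_deriv ?_
  symm
  change (∫ θ, _ ∂(sphMeas n)) / r = _
  rw [← integral_div]
  refine integral_congr_ae (Filter.Eventually.of_forall fun θ => ?_)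
  simp only [hF', fderiv_eq_sum_pd, PiLp.smul_apply, smul_eq_mul]
  rw [Finset.sum_div]
  refine Finset.sum_congr rfl fun i _ => ?_
  field_simp

lemma setIntegral_closedBall_eq {n : ℕ} (hn : 1 ≤ n) {F : Eu n → ℝ} {r : ℝ}
    (hF : IntegrableOn F (closedBall 0 r)) (hr : 0 ≤ r) :
    ∫ x in closedBall (0 : Eu n) r, F x = ∫ s in (0 : ℝ)..r, s ^ (n - 1) * sph F s := by
  rw [← integral_indicator measurableSet_closedBall, integral_eq_sph hn _
    ((integrable_indicator_iff measurableSet_closedBall).2 hF),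
    intervalIntegral.integral_of_le hr]
  have h : ∀ s ∈ Set.Ioi (0 : ℝ), s ^ (n - 1) * sph ((closedBall 0 r).indicator F) s =
      (Set.Iic r).indicator (fun s => s ^ (n - 1) * sph F s) s := by
    intro s hs
    by_cases h : s ≤ r
    · rw [Set.indicator_of_mem (Set.mem_Iic.2 h)]
      congr 1
      refine sph_congr (le_of_lt hs) fun x hx => ?_
      rw [Set.indicator_of_mem]
      simpa [hx] using h
    · rw [Set.indicator_of_notMem (by simpa using h)]
      rw [sph_congr (G := fun _ => 0) (le_of_lt hs) fun x hx => ?_]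
      · simp [sph]
      · rw [Set.indicator_of_notMem]
        simpa [hx] using h
  rw [setIntegral_congr_fun measurableSet_Ioi h, setIntegral_indicator measurableSet_Iic]
  rfl

/-- The derivative of an integral over balls. -/
lemma hasDerivAt_setIntegral_closedBall {n : ℕ} (hn : 1 ≤ n) {F : Eu n → ℝ} (hF : Continuous F)
    {r : ℝ} (hr : 0 < r) :
    HasDerivAt (fun r => ∫ x in closedBall (0 : Eu n) r, F x) (r ^ (n - 1) * sph F r) r := by
  have hc : ContinuousOn (fun s => s ^ (n - 1) * sph F s) (Set.Ioi 0) :=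
    (continuousOn_pow _).mul (continuousOn_sph hF.continuousOn)
  have hi : ∀ s, 0 < s → IntervalIntegrable (fun s => s ^ (n - 1) * sph F s) volume 0 s := by
    intro s hs
    have : Continuous (sph F) :=
      continuous_parametric_integral_of_continuous
        (μ := sphMeas n) (f := fun (s : ℝ) (θ : sphere (0 : Eu n) 1) => F (s • (θ : Eu n))) (s := Set.univ)
        (by fun_prop) isCompact_univ |>.congr fun s => by simp [sph]
    exact ((continuous_pow _).mul this).intervalIntegrable _ _
  have h1 := intervalIntegral.integral_hasDerivAt_right (hi r hr)
    (hc.stronglyMeasurableAtFilter isOpen_Ioi r hr) (hc.continuousAt (Ioi_mem_nhds hr))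
  refine h1.congr_of_eventuallyEq ?_
  filter_upwards [lt_mem_nhds hr] with s hs
  exact setIntegral_closedBall_eq hn (hF.continuousOn.integrableOn_compact
    (isCompact_closedBall _ _)) hs.le

lemma integral_pd_eq_zero {n : ℕ} {G : Eu n → ℝ} (hG : ContDiff ℝ 1 G)
    (hc : HasCompactSupport G) (i : Fin n) : ∫ x, pd i G x = 0 := by
  have h1 : Continuous (pd i G) := (hG.continuous_fderiv one_ne_zero).clm_apply continuous_const
  have h2 : HasCompactSupport (pd i G) := hc.fderiv_apply (𝕜 := ℝ) _
  have e0 : ∀ x : Eu n, fderiv ℝ (fun _ : Eu n => (1 : ℝ)) x (EuclideanSpace.single i 1) = 0 := by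
    simp
  have := integral_mul_fderiv_eq_neg_fderiv_mul_of_integrable (μ := (volume : Measure (Eu n)))
    (f := fun _ => (1 : ℝ)) (g := G) (v := EuclideanSpace.single i 1)
    (by simp only [e0, zero_mul]; exact integrable_zero _ _ _)
    (by simp only [one_mul]; exact h1.integrable_of_hasCompactSupport h2)
    (by simp only [one_mul]; exact hG.continuous.integrable_of_hasCompactSupport hc)
    (fun x _ => by fun_prop)
    (fun x _ => hG.differentiable one_ne_zero x)
  simp only [e0, zero_mul, one_mul, integral_zero, neg_zero] at this
  exact this

lemma hasFDerivAt_norm_single {n : ℕ} {x : Eu n} (hx : x ≠ 0) (i : Fin n) :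
    pd i (fun y : Eu n => ‖y‖) x = x i / ‖x‖ := by
  have h : HasFDerivAt (fun y : Eu n => ‖y‖ ^ 2) (2 • (innerSL ℝ x)) x := by
    simpa using (hasStrictFDerivAt_norm_sq x).hasFDerivAt
  have hd : DifferentiableAt ℝ (fun y : Eu n => ‖y‖) x :=
    (contDiffAt_norm ℝ hx (n := 1)).differentiableAt one_ne_zero
  have h2 := (hd.hasFDerivAt.pow 2).unique h
  have h3 := DFunLike.congr_fun h2 (EuclideanSpace.single i 1)
  have h0 : ‖x‖ ≠ 0 := norm_ne_zero_iff.2 hx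
  simp [EuclideanSpace.inner_single_right] at h3
  rw [pd, eq_div_iff h0]
  linarith

lemma test_identity {n : ℕ} (hn : 2 ≤ n) {V : Fin n → Eu n → ℝ}
    (hV : ∀ i, ContDiffOn ℝ 1 (V i) {0}ᶜ) {φ : ℝ → ℝ} (hφ : ContDiff ℝ 1 φ)
    (hc : HasCompactSupport φ) (hs : tsupport φ ⊆ Set.Ioi 0) :
    ∫ s, (φ s * (s ^ (n - 1) * sph (fun x => ∑ i, pd i (V i) x) s)
      + deriv φ s * (s ^ (n - 2) * sph (fun x => ∑ i, x i * V i x) s)) = 0 := by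
  have hopen : IsOpen ({0}ᶜ : Set (Eu n)) := isOpen_compl_singleton
  set W : Fin n → Eu n → ℝ := fun i x => φ ‖x‖ * V i x with hW
  have hWc : ∀ i, ContDiff ℝ 1 (W i) := by
    intro i
    rw [contDiff_iff_contDiffAt]
    intro x
    by_cases hx : x = 0
    · subst hx
      have h0 : (0 : ℝ) ∉ tsupport φ := fun h => lt_irrefl (0 : ℝ) (hs h)
      have h1 : ∀ᶠ x : Eu n in nhds 0, φ ‖x‖ = 0 := by
        have h2 := notMem_tsupport_iff_eventuallyEq.1 h0
        have h3 : Filter.Tendsto (fun x : Eu n => ‖x‖) (nhds 0) (nhds 0) := by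
          simpa using (continuous_norm (E := Eu n)).tendsto 0
        exact h3.eventually h2
      refine (contDiffAt_const (c := (0 : ℝ))).congr_of_eventuallyEq ?_
      filter_upwards [h1] with y hy
      simp [hW, hy]
    · exact (hφ.contDiffAt.comp x (contDiffAt_norm ℝ hx)).mul
        ((hV i).contDiffAt (hopen.mem_nhds hx))
  have hWs : ∀ i, HasCompactSupport (W i) := by
    intro i
    obtain ⟨R, hR⟩ := hc.isCompact.isBounded.subset_closedBall 0
    refine HasCompactSupport.intro (isCompact_closedBall (0 : Eu n) R) fun x hx => ?_
    have : ‖x‖ ∉ tsupport φ := fun h => hx (by simpa using hR h)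
    simp [hW, image_eq_zero_of_notMem_tsupport this]
  have hpd : ∀ i x, x ≠ 0 → pd i (W i) x =
      φ ‖x‖ * pd i (V i) x + deriv φ ‖x‖ / ‖x‖ * (x i * V i x) := by
    intro i x hx
    have h1 : HasFDerivAt (fun y : Eu n => ‖y‖) (fderiv ℝ (fun y : Eu n => ‖y‖) x) x :=
      ((contDiffAt_norm ℝ hx (n := 1)).differentiableAt one_ne_zero).hasFDerivAt
    have h2 : HasDerivAt φ (deriv φ ‖x‖) ‖x‖ := ((hφ.differentiable one_ne_zero) _).hasDerivAt
    have h3 := h2.comp_hasFDerivAt x h1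
    have h4 := (((hV i).contDiffAt (hopen.mem_nhds hx)).differentiableAt one_ne_zero).hasFDerivAt
    have h5 := (h3.mul h4).fderiv
    have h6 : pd i (W i) x = _ := DFunLike.congr_fun h5 (EuclideanSpace.single i 1)
    rw [h6]
    have h7 := hasFDerivAt_norm_single hx i
    rw [pd] at h7
    simp [h7, pd]
    ring
  have h_int : ∫ x, ∑ i, pd i (W i) x = 0 := by
    rw [integral_finsetSum]
    · exact Finset.sum_eq_zero fun i _ => integral_pd_eq_zero (hWc i) (hWs i) i
    · intro i _
      exact (((hWc i).continuous_fderiv one_ne_zero).clm_apply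
        continuous_const).integrable_of_hasCompactSupport ((hWs i).fderiv_apply (𝕜 := ℝ) _)
  rw [integral_eq_sph (by omega) _ (by
    refine integrable_finsetSum _ fun i _ => ?_
    exact (((hWc i).continuous_fderiv one_ne_zero).clm_apply
        continuous_const).integrable_of_hasCompactSupport ((hWs i).fderiv_apply (𝕜 := ℝ) _))]
    at h_int
  have hz : ∀ s : ℝ, s ∉ Set.Ioi (0 : ℝ) → φ s = 0 ∧ deriv φ s = 0 := by
    intro s h
    refine ⟨image_eq_zero_of_notMem_tsupport fun h' => h (hs h'), ?_⟩
    by_contra h'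
    exact h (hs (support_deriv_subset h'))
  rw [← setIntegral_eq_integral_of_forall_compl_eq_zero (s := Set.Ioi 0)]
  · refine Eq.trans ?_ h_int
    refine setIntegral_congr_fun measurableSet_Ioi fun s hs0 => ?_
    have hs0' : 0 < s := hs0
    simp only
    rw [sph_congr (F := fun x => ∑ i, pd i (W i) x) (G := fun x => φ s * (∑ i, pd i (V i) x)
      + deriv φ s / s * (∑ i, x i * V i x)) hs0'.le, sph_add, sph_const_mul, sph_const_mul]
    · have : s ^ (n - 1) = s ^ (n - 2) * s := by
        rw [← pow_succ]; congr 1; omega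
      rw [this]
      field_simp
    · exact hs0'
    · exact continuousOn_const.mul (continuousOn_finsetSum _ fun i _ => continuousOn_pd hopen (hV i) i)
    · exact continuousOn_const.mul (continuousOn_finsetSum _ fun i _ =>
        ContinuousOn.mul (by fun_prop) (hV i).continuousOn)
    · intro x hx
      have hx0 : x ≠ 0 := by
        rintro rfl
        simp at hx; linarith
      simp only [hpd _ x hx0, hx]
      rw [Finset.sum_add_distrib, Finset.mul_sum, Finset.mul_sum]
  · intro s h
    simp [(hz s h).1, (hz s h).2]

/-- Differential form of the divergence theorem on balls. -/
lemma hasDerivAt_flux {n : ℕ} (hn : 2 ≤ n) {V : Fin n → Eu n → ℝ}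
    (hV : ∀ i, ContDiffOn ℝ 1 (V i) {0}ᶜ) {r : ℝ} (hr : 0 < r) :
    HasDerivAt (fun s => s ^ (n - 2) * sph (fun x => ∑ i, x i * V i x) s)
      (r ^ (n - 1) * sph (fun x => ∑ i, pd i (V i) x) r) r := by
  have hopen : IsOpen ({0}ᶜ : Set (Eu n)) := isOpen_compl_singleton
  set F : Eu n → ℝ := fun x => ∑ i, x i * V i x with hF
  have hFc : ContDiffOn ℝ 1 F {0}ᶜ := by
    refine ContDiffOn.sum fun i _ => ContDiffOn.mul ?_ (hV i)
    exact ContDiff.contDiffOn (by fun_prop)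
  set Q : ℝ → ℝ := fun s => s ^ (n - 2) * sph F s with hQ
  set G : Eu n → ℝ := fun x => ∑ i, x i * pd i F x with hG
  have hGc : ContinuousOn G {0}ᶜ :=
    continuousOn_finsetSum _ fun i _ => ContinuousOn.mul (by fun_prop) (continuousOn_pd hopen hFc i)
  set Q' : ℝ → ℝ := fun s => ((n - 2 : ℕ) : ℝ) * s ^ (n - 2 - 1) * sph F s
    + s ^ (n - 2) * (sph G s / s) with hQ'
  have hQd : ∀ s, 0 < s → HasDerivAt Q (Q' s) s := fun s hs =>
    (hasDerivAt_pow (n - 2) s).mul (hasDerivAt_sph hFc hs)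
  set p : ℝ → ℝ := fun s => s ^ (n - 1) * sph (fun x => ∑ i, pd i (V i) x) s with hp
  have hpc : ContinuousOn p (Set.Ioi 0) := (continuousOn_pow _).mul
    (continuousOn_sph (continuousOn_finsetSum _ fun i _ => continuousOn_pd hopen (hV i) i))
  have hQc : ContinuousOn Q (Set.Ioi 0) := fun s hs => (hQd s hs).continuousAt.continuousWithinAt
  have hQ'c : ContinuousOn Q' (Set.Ioi 0) := by
    refine ContinuousOn.add (ContinuousOn.mul (by fun_prop) (continuousOn_sph hFc.continuousOn)) ?_
    exact (continuousOn_pow _).mul ((continuousOn_sph hGc).div continuousOn_id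
      fun s hs => ne_of_gt hs)
  have main : ∀ᵐ s : ℝ, s ∈ Set.Ioi (0 : ℝ) → p s - Q' s = 0 := by
    refine isOpen_Ioi.ae_eq_zero_of_integral_contDiff_smul_eq_zero
      ((hpc.sub hQ'c).locallyIntegrableOn measurableSet_Ioi) fun φ hφ hc hs => ?_
    have hφ1 : ContDiff ℝ 1 φ := hφ.of_le (by exact_mod_cast le_top)
    have h1 := test_identity hn hV hφ1 hc hs
    have hcont : ∀ {ψ g : ℝ → ℝ}, Continuous ψ → HasCompactSupport ψ → tsupport ψ ⊆ Set.Ioi 0 →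
        ContinuousOn g (Set.Ioi 0) → Integrable (fun s => ψ s * g s) := by
      intro ψ g h1 h2 h3 h4
      refine Continuous.integrable_of_hasCompactSupport ?_ h2.mul_right
      rw [continuous_iff_continuousAt]
      intro s
      by_cases hs : s ∈ tsupport ψ
      · exact h1.continuousAt.mul (h4.continuousAt (Ioi_mem_nhds (h3 hs)))
      · refine (continuousAt_const (y := (0 : ℝ))).congr ?_
        filter_upwards [notMem_tsupport_iff_eventuallyEq.1 hs] with y hy
        simp [hy]
    have hdc : Continuous (deriv φ) := hφ1.continuous_deriv le_rfl
    have hds : HasCompactSupport (deriv φ) := hc.deriv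
    have hdt : tsupport (deriv φ) ⊆ Set.Ioi 0 :=
      (closure_minimal support_deriv_subset (isClosed_tsupport _)).trans hs
    have i1 := hcont hφ.continuous hc hs hpc
    have i2 := hcont hdc hds hdt hQc
    have i3 := hcont hφ.continuous hc hs hQ'c
    have h2 : ∫ s, (deriv φ s * Q s + φ s * Q' s) = 0 := by
      refine integral_eq_zero_of_hasDerivAt_of_integrable (f := fun s => φ s * Q s) ?_
        (i2.add i3) (hcont hφ.continuous hc hs hQc)
      intro s
      by_cases h : s ∈ tsupport φ
      · exact ((hφ1.differentiable one_ne_zero) s).hasDerivAt.mul (hQd s (hs h))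
      · have e := notMem_tsupport_iff_eventuallyEq.1 h
        have e0 : φ s = 0 := image_eq_zero_of_notMem_tsupport h
        have e1 : deriv φ s = 0 := by
          by_contra h'
          exact h (support_deriv_subset h')
        rw [e0, e1]
        simp only [zero_mul, add_zero]
        refine (hasDerivAt_const s (0 : ℝ)).congr_of_eventuallyEq ?_
        filter_upwards [e] with y hy
        simp [hy]
    rw [integral_add i1 i2] at h1
    rw [integral_add i2 i3] at h2
    have h3 : ∫ s, φ s • (p s - Q' s) = ∫ s, (φ s * p s - φ s * Q' s) := by
      simp [mul_sub]
    rw [h3, integral_sub i1 i3]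
    linarith
  have h2 : Set.EqOn p Q' (Set.Ioi 0) := by
    refine Measure.eqOn_open_of_ae_eq (μ := volume) ?_ isOpen_Ioi hpc hQ'c
    rw [Filter.EventuallyEq, ae_restrict_iff' measurableSet_Ioi]
    filter_upwards [main] with s h hs
    exact sub_eq_zero.1 (h hs)
  rw [show r ^ (n - 1) * sph (fun x => ∑ i, pd i (V i) x) r = Q' r from h2 hr]
  exact hQd r hr

section Calculus

variable {n : ℕ} {f g : Eu n → ℝ} {x : Eu n} (i : Fin n)

lemma pd_add (hf : DifferentiableAt ℝ f x) (hg : DifferentiableAt ℝ g x) :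
    pd i (fun y => f y + g y) x = pd i f x + pd i g x := by
  have := fderiv_add hf hg
  exact DFunLike.congr_fun this (EuclideanSpace.single i 1)

lemma pd_sub (hf : DifferentiableAt ℝ f x) (hg : DifferentiableAt ℝ g x) :
    pd i (fun y => f y - g y) x = pd i f x - pd i g x := by
  have := fderiv_sub hf hg
  exact DFunLike.congr_fun this (EuclideanSpace.single i 1)

lemma pd_mul (hf : DifferentiableAt ℝ f x) (hg : DifferentiableAt ℝ g x) :
    pd i (fun y => f y * g y) x = pd i f x * g x + f x * pd i g x := by
  have := DFunLike.congr_fun (fderiv_fun_mul hf hg) (EuclideanSpace.single i 1)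
  rw [pd, this]
  simp [pd]
  ring

lemma pd_sum {ι : Type*} (s : Finset ι) {F : ι → Eu n → ℝ}
    (h : ∀ k ∈ s, DifferentiableAt ℝ (F k) x) :
    pd i (fun y => ∑ k ∈ s, F k y) x = ∑ k ∈ s, pd i (F k) x := by
  have := DFunLike.congr_fun (fderiv_fun_sum h) (EuclideanSpace.single i 1)
  rw [pd, this]
  simp [pd]

lemma pd_const (c : ℝ) : pd i (fun _ => c) x = 0 := by simp [pd]

lemma pd_const_mul (c : ℝ) (hf : DifferentiableAt ℝ f x) :
    pd i (fun y => c * f y) x = c * pd i f x := by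
  rw [pd_mul i (by fun_prop) hf, pd_const]; ring

lemma hasFDerivAt_coord (k : Fin n) :
    HasFDerivAt (fun y : Eu n => y k) (EuclideanSpace.proj (𝕜 := ℝ) k : Eu n →L[ℝ] ℝ) x :=
  (EuclideanSpace.proj (𝕜 := ℝ) k : Eu n →L[ℝ] ℝ).hasFDerivAt

lemma pd_coord (k : Fin n) : pd i (fun y : Eu n => y k) x = if k = i then 1 else 0 := by
  rw [pd, (hasFDerivAt_coord k).fderiv]
  simp

lemma pd_comp {φ : ℝ → ℝ} {φ' : ℝ} (hφ : HasDerivAt φ φ' (f x)) (hf : DifferentiableAt ℝ f x) :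
    pd i (fun y => φ (f y)) x = φ' * pd i f x := by
  have := (hφ.comp_hasFDerivAt x hf.hasFDerivAt).fderiv
  have h2 := DFunLike.congr_fun this (EuclideanSpace.single i 1)
  simpa [pd, Function.comp_def] using h2

lemma contDiff_pd {m : ℕ} (hf : ContDiff ℝ (m + 1 : ℕ) f) : ContDiff ℝ m (pd i f) :=
  (hf.fderiv_right (m := m) (by norm_cast)).clm_apply contDiff_const

lemma pd_comm (j : Fin n) (hf : ContDiff ℝ 2 f) : pd i (pd j f) x = pd j (pd i f) x := by
  have hs : IsSymmSndFDerivAt ℝ f x := hf.contDiffAt.isSymmSndFDerivAt (by simp)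
  have hd : DifferentiableAt ℝ (fderiv ℝ f) x :=
    (hf.fderiv_right (m := 1) (by norm_num)).differentiable one_ne_zero x
  have h : ∀ v w : Eu n, fderiv ℝ (fun y => fderiv ℝ f y w) x v = fderiv ℝ (fderiv ℝ f) x v w := by
    intro v w
    rw [fderiv_clm_apply hd (by fun_prop)]
    simp
  change fderiv ℝ (fun y => fderiv ℝ f y _) x _ = fderiv ℝ (fun y => fderiv ℝ f y _) x _
  rw [h, h, hs.eq]

end Calculus

/-- The divergence theorem on balls. -/
lemma flux_eq {n : ℕ} (hn : 2 ≤ n) {V : Fin n → Eu n → ℝ} (hV : ∀ i, ContDiff ℝ 1 (V i))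
    {r : ℝ} (hr : 0 < r) :
    r ^ (n - 2) * sph (fun x => ∑ i, x i * V i x) r =
      ∫ x in closedBall (0 : Eu n) r, ∑ i, pd i (V i) x := by
  have hc : Continuous (fun x => ∑ i, pd i (V i) x) :=
    continuous_finsetSum _ fun i _ => (contDiff_pd (m := 0) i (by simpa using hV i)).continuous
  have hsc : ∀ F : Eu n → ℝ, Continuous F → Continuous (sph F) := fun F hF =>
    continuous_parametric_integral_of_continuous
      (μ := sphMeas n) (f := fun (s : ℝ) (θ : sphere (0 : Eu n) 1) => F (s • (θ : Eu n)))
      (s := Set.univ) (by fun_prop) isCompact_univ |>.congr fun s => by simp [sph]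
  have hsd := hsc _ hc
  rw [setIntegral_closedBall_eq (by omega) (hc.continuousOn.integrableOn_compact
    (isCompact_closedBall _ _)) hr.le]
  have hfc : Continuous (fun s : ℝ => s ^ (n - 2) * sph (fun x : Eu n => ∑ i, x i * V i x) s) := by
    refine (continuous_pow _).mul (hsc _ ?_)
    exact continuous_finsetSum _ fun i _ => Continuous.mul (by fun_prop) (hV i).continuous
  have := intervalIntegral.integral_eq_sub_of_hasDeriv_right_of_le hr.le
    (f := fun s => s ^ (n - 2) * sph (fun x : Eu n => ∑ i, x i * V i x) s)
    (f' := fun s => s ^ (n - 1) * sph (fun x => ∑ i, pd i (V i) x) s)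
    hfc.continuousOn
    (fun s hs => (hasDerivAt_flux hn (fun i => (hV i).contDiffOn) hs.1).hasDerivWithinAt)
    (((continuous_pow _).mul hsd).intervalIntegrable _ _)
  rw [this]
  have h0 : sph (fun x : Eu n => ∑ i, x i * V i x) 0 = 0 := by simp [sph]
  simp [h0]

/-- Coefficients of the elliptic operator `div (S ∇ ·) + b · ∇` with `S` symmetric and `b`
divergence free. -/
structure Coef (n : ℕ) (lam M : ℝ) (S : Fin n → Fin n → Eu n → ℝ) (b : Fin n → Eu n → ℝ) :
    Prop where
  one_le : 1 ≤ lam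
  smooth : ∀ i j, ContDiff ℝ 1 (S i j)
  smooth_drift : ∀ i, ContDiff ℝ 1 (b i)
  symm : ∀ i j, S i j = S j i
  lower : ∀ (x : Eu n) (v : Fin n → ℝ), ∑ i, v i ^ 2 ≤ lam * ∑ i, v i * ∑ j, S i j x * v j
  upper : ∀ (x : Eu n) (v : Fin n → ℝ), ∑ i, v i * ∑ j, S i j x * v j ≤ lam * ∑ i, v i ^ 2
  bound : ∀ i j x, |S i j x| ≤ M
  bound_pd : ∀ k i j x, |pd k (S i j) x| ≤ M
  bound_drift : ∀ i x, |b i x| ≤ M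
  div_drift : ∀ x, ∑ i, pd i (b i) x = 0

/-- The conormal gradient `S ∇ u`. -/
def cograd {n : ℕ} (S : Fin n → Fin n → Eu n → ℝ) (u : Eu n → ℝ) (i : Fin n) (x : Eu n) : ℝ :=
  ∑ j, S i j x * pd j u x

/-- The energy density `⟨S ∇ u, ∇ u⟩`. -/
def energy {n : ℕ} (S : Fin n → Fin n → Eu n → ℝ) (u : Eu n → ℝ) (x : Eu n) : ℝ :=
  ∑ i, pd i u x * cograd S u i x

/-- The vector field `S x`. -/
def rad {n : ℕ} (S : Fin n → Fin n → Eu n → ℝ) (i : Fin n) (x : Eu n) : ℝ :=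
  ∑ j, S i j x * x j

/-- The quadratic form `⟨S x, x⟩`. -/
def quad {n : ℕ} (S : Fin n → Fin n → Eu n → ℝ) (x : Eu n) : ℝ :=
  ∑ i, x i * rad S i x

/-- The conormal derivative `⟨S ∇ u, x⟩`. -/
def conormal {n : ℕ} (S : Fin n → Fin n → Eu n → ℝ) (u : Eu n → ℝ) (x : Eu n) : ℝ :=
  ∑ i, x i * cograd S u i x

/-- The drift term `⟨b, ∇ u⟩`. -/
def drift {n : ℕ} (b : Fin n → Eu n → ℝ) (u : Eu n → ℝ) (x : Eu n) : ℝ :=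
  ∑ i, b i x * pd i u x

/-- `C²` solutions of `div (S ∇ u) + b · ∇ u = 0` on the ball of radius `R`. -/
structure Sol {n : ℕ} (S : Fin n → Fin n → Eu n → ℝ) (b : Fin n → Eu n → ℝ) (R : ℝ)
    (u : Eu n → ℝ) : Prop where
  smooth : ContDiff ℝ 2 u
  eqn : ∀ x, ‖x‖ < R → ∑ i, pd i (cograd S u i) x + drift b u x = 0

section Smoothness

variable {n : ℕ} {lam M R : ℝ} {S : Fin n → Fin n → Eu n → ℝ} {b : Fin n → Eu n → ℝ}
  {u : Eu n → ℝ}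

lemma contDiff_pd_one (hu : ContDiff ℝ 2 u) (i : Fin n) : ContDiff ℝ 1 (pd i u) := by
  have := contDiff_pd (m := 1) (f := u) i (by simpa [one_add_one_eq_two] using hu)
  simpa using this

lemma continuous_pd (hu : ContDiff ℝ 1 u) (i : Fin n) : Continuous (pd i u) :=
  (contDiff_pd (m := 0) i (by simpa using hu)).continuous

lemma Coef.contDiff_cograd (h : Coef n lam M S b) (hu : ContDiff ℝ 2 u) (i : Fin n) :
    ContDiff ℝ 1 (cograd S u i) :=
  ContDiff.sum fun j _ => (h.smooth i j).mul (contDiff_pd_one hu j)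

lemma contDiff_coord (i : Fin n) {m : WithTop ℕ∞} : ContDiff ℝ m (fun x : Eu n => x i) :=
  (EuclideanSpace.proj (𝕜 := ℝ) i : Eu n →L[ℝ] ℝ).contDiff

lemma Coef.contDiff_rad (h : Coef n lam M S b) (i : Fin n) : ContDiff ℝ 1 (rad S i) :=
  ContDiff.sum fun j _ => (h.smooth i j).mul (contDiff_coord j)

lemma Coef.contDiff_quad (h : Coef n lam M S b) : ContDiff ℝ 1 (quad S) :=
  ContDiff.sum fun i _ => (contDiff_coord i).mul (h.contDiff_rad i)

lemma Coef.contDiff_energy (h : Coef n lam M S b) (hu : ContDiff ℝ 2 u) :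
    ContDiff ℝ 1 (energy S u) :=
  ContDiff.sum fun i _ => (contDiff_pd_one hu i).mul (h.contDiff_cograd hu i)

lemma Coef.contDiff_conormal (h : Coef n lam M S b) (hu : ContDiff ℝ 2 u) :
    ContDiff ℝ 1 (conormal S u) :=
  ContDiff.sum fun i _ => (contDiff_coord i).mul (h.contDiff_cograd hu i)

lemma Coef.contDiff_drift (h : Coef n lam M S b) (hu : ContDiff ℝ 2 u) :
    ContDiff ℝ 1 (drift b u) :=
  ContDiff.sum fun i _ => (h.smooth_drift i).mul (contDiff_pd_one hu i)

end Smoothness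

lemma abs_sum_le_card {n : ℕ} {f : Fin n → ℝ} {K : ℝ} (h : ∀ i, |f i| ≤ K) :
    |∑ i, f i| ≤ n * K := by
  refine (Finset.abs_sum_le_sum_abs _ _).trans ?_
  simpa using Finset.sum_le_sum fun i (_ : i ∈ Finset.univ) => h i

lemma abs_coord_le {n : ℕ} (x : Eu n) (i : Fin n) : |x i| ≤ ‖x‖ := by
  simpa using PiLp.norm_apply_le x i

lemma norm_sq_eq_sum {n : ℕ} (x : Eu n) : ‖x‖ ^ 2 = ∑ i, x i ^ 2 := by
  rw [EuclideanSpace.norm_sq_eq]; simp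

lemma abs_sub_le_of_pd {n : ℕ} {f : Eu n → ℝ} {M : ℝ} (hf : ContDiff ℝ 1 f)
    (h : ∀ k x, |pd k f x| ≤ M) (x : Eu n) : |f x - f 0| ≤ n * M * ‖x‖ := by
  rcases Nat.eq_zero_or_pos n with rfl | hn
  · simp [Subsingleton.elim x 0]
  have hM : 0 ≤ M := (abs_nonneg _).trans (h ⟨0, hn⟩ 0)
  have hb : ∀ y ∈ (Set.univ : Set (Eu n)), ‖fderiv ℝ f y‖ ≤ n * M := by
    intro y _
    refine ContinuousLinearMap.opNorm_le_bound _ (by positivity) fun v => ?_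
    rw [fderiv_eq_sum_pd, Real.norm_eq_abs]
    have : ∀ i, |v i * pd i f y| ≤ M * ‖v‖ := fun i => by
      rw [abs_mul, mul_comm]
      exact mul_le_mul (h i y) (abs_coord_le v i) (abs_nonneg _) hM
    calc _ ≤ n * (M * ‖v‖) := abs_sum_le_card this
      _ = _ := by ring
  have := (convex_univ (𝕜 := ℝ) (E := Eu n)).norm_image_sub_le_of_norm_fderiv_le
    (fun y _ => hf.differentiable one_ne_zero y) hb (Set.mem_univ 0) (Set.mem_univ x)
  simpa using this

section Coef

variable {n : ℕ} {lam M R : ℝ} {S : Fin n → Fin n → Eu n → ℝ} {b : Fin n → Eu n → ℝ}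
  {u : Eu n → ℝ}

lemma Coef.M_nonneg (h : Coef n lam M S b) (hn : 1 ≤ n) : 0 ≤ M :=
  (abs_nonneg _).trans (h.bound_drift ⟨0, hn⟩ 0)

lemma Coef.lam_pos (h : Coef n lam M S b) : 0 < lam := one_pos.trans_le h.one_le

lemma Coef.sum_sq_le_energy (h : Coef n lam M S b) (u : Eu n → ℝ) (x : Eu n) :
    ∑ i, pd i u x ^ 2 ≤ lam * energy S u x := h.lower x fun i => pd i u x

lemma Coef.energy_le (h : Coef n lam M S b) (u : Eu n → ℝ) (x : Eu n) :
    energy S u x ≤ lam * ∑ i, pd i u x ^ 2 := h.upper x fun i => pd i u x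

lemma Coef.energy_nonneg (h : Coef n lam M S b) (u : Eu n → ℝ) (x : Eu n) :
    0 ≤ energy S u x := by
  have h1 := h.sum_sq_le_energy u x
  have h2 : 0 ≤ ∑ i, pd i u x ^ 2 := Finset.sum_nonneg fun _ _ => sq_nonneg _
  exact (mul_nonneg_iff_of_pos_left (h.lam_pos)).1 (h2.trans h1)

lemma Coef.norm_sq_le_quad (h : Coef n lam M S b) (x : Eu n) : ‖x‖ ^ 2 ≤ lam * quad S x := by
  rw [norm_sq_eq_sum]; exact h.lower x fun i => x i

lemma Coef.quad_le (h : Coef n lam M S b) (x : Eu n) : quad S x ≤ lam * ‖x‖ ^ 2 := by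
  rw [norm_sq_eq_sum]; exact h.upper x fun i => x i

lemma Coef.quad_pos (h : Coef n lam M S b) {x : Eu n} (hx : x ≠ 0) :
    0 < quad S x := by
  have h1 := h.norm_sq_le_quad x
  have h2 : 0 < ‖x‖ ^ 2 := by positivity
  exact (mul_pos_iff_of_pos_left (h.lam_pos)).1 (h2.trans_le h1)

lemma Coef.quad_nonneg (h : Coef n lam M S b) (x : Eu n) :
    0 ≤ quad S x := by
  have h1 := h.norm_sq_le_quad x
  have h2 : 0 ≤ ‖x‖ ^ 2 := by positivity
  exact (mul_nonneg_iff_of_pos_left (h.lam_pos)).1 (h2.trans h1)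

lemma Coef.abs_sub_le (h : Coef n lam M S b) (h0 : ∀ i j, S i j 0 = if i = j then 1 else 0)
    (i j : Fin n) (x : Eu n) : |S i j x - if i = j then 1 else 0| ≤ n * M * ‖x‖ := by
  rw [← h0]
  exact abs_sub_le_of_pd (h.smooth i j) (fun k y => h.bound_pd k i j y) x

lemma Coef.sum_pd_mul_rad (h : Coef n lam M S b) (u : Eu n → ℝ) (x : Eu n) :
    ∑ i, pd i u x * rad S i x = conormal S u x := by
  simp only [rad, conormal, cograd, Finset.mul_sum]
  rw [Finset.sum_comm]
  refine Finset.sum_congr rfl fun i _ => Finset.sum_congr rfl fun j _ => ?_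
  rw [h.symm i j]; ring

lemma Coef.pd_rad (h : Coef n lam M S b) (k i : Fin n) (x : Eu n) :
    pd k (rad S i) x = ∑ j, pd k (S i j) x * x j + S i k x := by
  have hd : ∀ j, DifferentiableAt ℝ (S i j) x := fun j => (h.smooth i j).differentiable one_ne_zero x
  have hc : ∀ j, DifferentiableAt ℝ (fun y : Eu n => y j) x := fun j => (hasFDerivAt_coord j).differentiableAt
  unfold rad
  rw [pd_sum k _ (F := fun j y => S i j y * y j) fun j _ => (hd j).mul (hc j)]
  simp only [pd_mul k (hd _) (hc _), pd_coord, Finset.sum_add_distrib]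
  simp

lemma Coef.abs_pd_rad_sub (h : Coef n lam M S b) (h0 : ∀ i j, S i j 0 = if i = j then 1 else 0)
    (k i : Fin n) (x : Eu n) :
    |pd k (rad S i) x - if i = k then 1 else 0| ≤ 2 * n * M * ‖x‖ := by
  rw [h.pd_rad, add_sub_assoc]
  have hM : 0 ≤ M := h.M_nonneg (Fin.pos i)
  refine (abs_add_le _ _).trans ?_
  have h1 : |∑ j, pd k (S i j) x * x j| ≤ n * (M * ‖x‖) := abs_sum_le_card fun j => by
    rw [abs_mul]
    exact mul_le_mul (h.bound_pd k i j x) (abs_coord_le x j) (abs_nonneg _) hM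
  linarith [h.abs_sub_le h0 i k x]

lemma Coef.abs_rad_sub (h : Coef n lam M S b) (h0 : ∀ i j, S i j 0 = if i = j then 1 else 0)
    (i : Fin n) (x : Eu n) : |rad S i x - x i| ≤ n * (n * M) * ‖x‖ ^ 2 := by
  have : rad S i x - x i = ∑ j, (S i j x - if i = j then 1 else 0) * x j := by
    simp [rad, sub_mul, Finset.sum_sub_distrib]
  have hM : 0 ≤ M := h.M_nonneg (Fin.pos i)
  rw [this]
  calc _ ≤ n * (n * M * ‖x‖ * ‖x‖) := abs_sum_le_card fun j => by
        rw [abs_mul]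
        exact mul_le_mul (h.abs_sub_le h0 i j x) (abs_coord_le x j) (abs_nonneg _) (by positivity)
    _ = _ := by ring

lemma Coef.abs_quad_sub (h : Coef n lam M S b) (h0 : ∀ i j, S i j 0 = if i = j then 1 else 0)
    (x : Eu n) : |quad S x - ‖x‖ ^ 2| ≤ n * (n * (n * M)) * ‖x‖ ^ 3 := by
  have : quad S x - ‖x‖ ^ 2 = ∑ i, x i * (rad S i x - x i) := by
    rw [norm_sq_eq_sum, quad, ← Finset.sum_sub_distrib]
    exact Finset.sum_congr rfl fun i _ => by ring
  rw [this]
  calc _ ≤ n * (‖x‖ * (n * (n * M) * ‖x‖ ^ 2)) := abs_sum_le_card fun i => by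
        rw [abs_mul]
        exact mul_le_mul (abs_coord_le x i) (h.abs_rad_sub h0 i x) (abs_nonneg _) (norm_nonneg _)
    _ = _ := by ring

lemma Coef.abs_div_rad (h : Coef n lam M S b) (h0 : ∀ i j, S i j 0 = if i = j then 1 else 0)
    (x : Eu n) : |‖x‖ ^ 2 * (∑ i, pd i (rad S i) x) - n * quad S x| ≤
      (n * (2 * n * M) + n * (n * (n * (n * M)))) * ‖x‖ ^ 3 := by
  have h1 : |∑ i, pd i (rad S i) x - n| ≤ n * (2 * n * M * ‖x‖) := by
    have : ∑ i, pd i (rad S i) x - n = ∑ i : Fin n, (pd i (rad S i) x - 1) := by simp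
    rw [this]
    exact abs_sum_le_card fun i => by simpa using h.abs_pd_rad_sub h0 i i x
  have h2 := h.abs_quad_sub h0 x
  have e : ‖x‖ ^ 2 * (∑ i, pd i (rad S i) x) - n * quad S x =
      ‖x‖ ^ 2 * (∑ i, pd i (rad S i) x - n) - n * (quad S x - ‖x‖ ^ 2) := by ring
  rw [e]
  refine (abs_sub _ _).trans ?_
  rw [abs_mul, abs_mul, abs_of_nonneg (sq_nonneg ‖x‖), Nat.abs_cast]
  have := mul_le_mul_of_nonneg_left h1 (sq_nonneg ‖x‖)
  have := mul_le_mul_of_nonneg_left h2 (Nat.cast_nonneg (α := ℝ) n)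
  nlinarith

/-- First variation of the weighted spherical `L²` norm. -/
lemma Coef.hasDerivAt_height (h : Coef n lam M S b) (hn : 2 ≤ n) (hu : ContDiff ℝ 2 u) {r : ℝ}
    (hr : 0 < r) :
    HasDerivAt (fun s => s ^ (n - 2) * sph (fun x => u x ^ 2 * quad S x) s)
      (r ^ (n - 1) * (2 * sph (fun x => u x * conormal S u x) r
        + sph (fun x => u x ^ 2 * ∑ i, pd i (rad S i) x) r)) r := by
  have hu1 : ContDiff ℝ 1 u := hu.of_le (by norm_num)
  have hV : ∀ i, ContDiff ℝ 1 (fun x => u x ^ 2 * rad S i x) := fun i =>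
    (hu1.pow 2).mul (h.contDiff_rad i)
  have key := hasDerivAt_flux hn (fun i => (hV i).contDiffOn) hr
  have e1 : (fun x : Eu n => ∑ i, x i * (u x ^ 2 * rad S i x)) = fun x => u x ^ 2 * quad S x := by
    funext x
    rw [quad, Finset.mul_sum]
    exact Finset.sum_congr rfl fun i _ => by ring
  have e2 : (fun x : Eu n => ∑ i, pd i (fun x => u x ^ 2 * rad S i x) x) =
      fun x => 2 * (u x * conormal S u x) + u x ^ 2 * ∑ i, pd i (rad S i) x := by
    funext x
    have hd : DifferentiableAt ℝ u x := hu1.differentiable one_ne_zero x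
    have : ∀ i, pd i (fun x => u x ^ 2 * rad S i x) x =
        2 * u x * (pd i u x * rad S i x) + u x ^ 2 * pd i (rad S i) x := by
      intro i
      rw [pd_mul i (f := fun x => u x ^ 2) (hd.pow 2) ((h.contDiff_rad i).differentiable one_ne_zero x)]
      have : pd i (fun x => u x ^ 2) x = 2 * u x * pd i u x := by
        simp only [pow_two]
        rw [pd_mul i hd hd]; ring
      rw [this]; ring
    simp only [this, Finset.sum_add_distrib, ← Finset.mul_sum, h.sum_pd_mul_rad]
    ring
  rw [e1, e2, sph_add hr, sph_const_mul] at key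
  · exact key
  · exact (continuous_const.mul (hu1.continuous.mul (h.contDiff_conormal hu).continuous)).continuousOn
  · exact ((hu1.continuous.pow 2).mul (continuous_finsetSum _ fun i _ =>
      continuous_pd (h.contDiff_rad i) i)).continuousOn

lemma Coef.abs_height_error (h : Coef n lam M S b)
    (h0 : ∀ i j, S i j 0 = if i = j then 1 else 0) (hn : 2 ≤ n) (hu : ContDiff ℝ 2 u) {r : ℝ}
    (hr : 0 < r) :
    |r ^ 2 * sph (fun x => u x ^ 2 * ∑ i, pd i (rad S i) x) r
        - n * sph (fun x => u x ^ 2 * quad S x) r| ≤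
      (n * (2 * n * M) + n * (n * (n * (n * M)))) * lam * r *
        sph (fun x => u x ^ 2 * quad S x) r := by
  have hu1 : ContDiff ℝ 1 u := hu.of_le (by norm_num)
  set K : ℝ := (n * (2 * n * M) + n * (n * (n * (n * M)))) with hK
  have hM := h.M_nonneg (by omega)
  have hK0 : 0 ≤ K := by positivity
  have c1 : Continuous (fun x => u x ^ 2 * ∑ i, pd i (rad S i) x) :=
    (hu1.continuous.pow 2).mul (continuous_finsetSum _ fun i _ => continuous_pd (h.contDiff_rad i) i)
  have c2 : Continuous (fun x => u x ^ 2 * quad S x) :=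
    (hu1.continuous.pow 2).mul h.contDiff_quad.continuous
  rw [← sph_const_mul, ← sph_const_mul, ← sph_const_mul, ← sph_sub hr
    (by exact (continuous_const.mul c1).continuousOn) (by exact (continuous_const.mul c2).continuousOn)]
  have pt : ∀ x : Eu n, ‖x‖ = r → |r ^ 2 * (u x ^ 2 * ∑ i, pd i (rad S i) x)
      - n * (u x ^ 2 * quad S x)| ≤ K * lam * r * (u x ^ 2 * quad S x) := by
    intro x hx
    have h1 := h.abs_div_rad h0 x
    have h2 := h.norm_sq_le_quad x
    rw [hx] at h1 h2
    have e : r ^ 2 * (u x ^ 2 * ∑ i, pd i (rad S i) x) - n * (u x ^ 2 * quad S x) =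
      u x ^ 2 * (r ^ 2 * (∑ i, pd i (rad S i) x) - n * quad S x) := by ring
    rw [e, abs_mul, abs_of_nonneg (sq_nonneg _)]
    calc _ ≤ u x ^ 2 * (K * r ^ 3) := mul_le_mul_of_nonneg_left h1 (sq_nonneg _)
      _ = u x ^ 2 * (K * r) * r ^ 2 := by ring
      _ ≤ u x ^ 2 * (K * r) * (lam * quad S x) := by gcongr
      _ = _ := by ring
  rw [abs_le]
  constructor
  · rw [← sub_nonneg, sub_neg_eq_add, ← sph_add hr]
    · exact sph_nonneg hr.le fun x hx => by linarith [(abs_le.1 (pt x hx)).1]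
    · exact ((continuous_const.mul c1).sub (continuous_const.mul c2)).continuousOn
    · exact (continuous_const.mul c2).continuousOn
  · refine sph_mono hr ?_ ?_ fun x hx => (abs_le.1 (pt x hx)).2
    · exact ((continuous_const.mul c1).sub (continuous_const.mul c2)).continuousOn
    · exact (continuous_const.mul c2).continuousOn

/-- The energy identity. -/
lemma Sol.energy_identity (h : Coef n lam M S b) (hn : 2 ≤ n) (hu : Sol S b R u) {r : ℝ}
    (hr : 0 < r) (hrR : r < R) :
    r ^ (n - 2) * sph (fun x => u x * conormal S u x) r =
      (∫ x in closedBall (0 : Eu n) r, energy S u x)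
        - ∫ x in closedBall (0 : Eu n) r, u x * drift b u x := by
  have hu2 := hu.smooth
  have hu1 : ContDiff ℝ 1 u := hu2.of_le (by norm_num)
  have hV : ∀ i, ContDiff ℝ 1 (fun x => u x * cograd S u i x) := fun i =>
    hu1.mul (h.contDiff_cograd hu2 i)
  have key := flux_eq hn hV hr
  have e1 : (fun x : Eu n => ∑ i, x i * (u x * cograd S u i x)) = fun x => u x * conormal S u x := by
    funext x
    rw [conormal, Finset.mul_sum]
    exact Finset.sum_congr rfl fun i _ => by ring
  rw [e1] at key
  rw [key, ← integral_sub]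
  · refine setIntegral_congr_fun measurableSet_closedBall fun x hx => ?_
    have hx' : ‖x‖ < R := lt_of_le_of_lt (by simpa using hx) hrR
    have hd : DifferentiableAt ℝ u x := hu1.differentiable one_ne_zero x
    have : ∀ i, pd i (fun x => u x * cograd S u i x) x =
        pd i u x * cograd S u i x + u x * pd i (cograd S u i) x := fun i =>
      pd_mul i hd ((h.contDiff_cograd hu2 i).differentiable one_ne_zero x)
    have he := hu.eqn x hx'
    simp only [this, Finset.sum_add_distrib, ← Finset.mul_sum]
    rw [show ∑ i, pd i (cograd S u i) x = - drift b u x by linarith, energy]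
    ring
  · exact (h.contDiff_energy hu2).continuous.continuousOn.integrableOn_compact
      (isCompact_closedBall _ _)
  · exact (hu1.continuous.mul (h.contDiff_drift hu2).continuous).continuousOn.integrableOn_compact
      (isCompact_closedBall _ _)

end Coef

lemma pd_norm_sq {n : ℕ} (i : Fin n) (x : Eu n) : pd i (fun y : Eu n => ‖y‖ ^ 2) x = 2 * x i := by
  have h : HasFDerivAt (fun y : Eu n => ‖y‖ ^ 2) (2 • (innerSL ℝ x)) x := by
    simpa using (hasStrictFDerivAt_norm_sq x).hasFDerivAt
  rw [pd, h.fderiv]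
  simp [EuclideanSpace.inner_single_right]

/-- The symmetric function algebra behind the Rellich identity. -/
lemma rellich_algebra {n : ℕ} (S D : Fin n → Fin n → ℝ) (dS : Fin n → Fin n → Fin n → ℝ)
    (p ρ G : Fin n → ℝ) (dρ : Fin n → Fin n → ℝ) (hS : ∀ i j, S i j = S j i)
    (hD : ∀ i j, D i j = D j i) (hG : ∀ i, G i = ∑ j, S i j * p j) :
    ∑ k, ((∑ i, (D k i * G i + p i * ∑ j, (dS k i j * p j + S i j * D k j))) * ρ k
      - 2 * ((∑ i, (D k i * ρ i + p i * dρ k i)) * G k)) =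
    ∑ k, ρ k * (∑ i, ∑ j, dS k i j * (p i * p j)) - 2 * ∑ k, ∑ i, dρ k i * (p i * G k) := by
  have h1 : ∀ k, ∑ i, p i * ∑ j, S i j * D k j = ∑ i, D k i * G i := by
    intro k
    simp only [hG, Finset.mul_sum]
    rw [Finset.sum_comm]
    refine Finset.sum_congr rfl fun i _ => Finset.sum_congr rfl fun j _ => ?_
    rw [hS i j]; ring
  have h2 : ∑ k, (∑ i, D k i * ρ i) * G k = ∑ k, (∑ i, D k i * G i) * ρ k := by
    simp only [Finset.sum_mul]
    rw [Finset.sum_comm]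
    refine Finset.sum_congr rfl fun i _ => Finset.sum_congr rfl fun j _ => ?_
    rw [hD i j]; ring
  have h3 : ∀ k, ∑ i, (D k i * G i + p i * ∑ j, (dS k i j * p j + S i j * D k j)) =
      2 * (∑ i, D k i * G i) + ∑ i, ∑ j, dS k i j * (p i * p j) := by
    intro k
    simp only [Finset.sum_add_distrib, mul_add, h1]
    have : ∑ i, p i * ∑ j, dS k i j * p j = ∑ i, ∑ j, dS k i j * (p i * p j) := by
      simp only [Finset.mul_sum]
      exact Finset.sum_congr rfl fun i _ => Finset.sum_congr rfl fun j _ => by ring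
    rw [this]; ring
  have h4 : ∑ k, (∑ i, p i * dρ k i) * G k = ∑ k, ∑ i, dρ k i * (p i * G k) := by
    simp only [Finset.sum_mul]
    exact Finset.sum_congr rfl fun i _ => Finset.sum_congr rfl fun j _ => by ring
  simp only [h3]
  rw [Finset.sum_sub_distrib, ← h4, ← Finset.mul_sum]
  simp only [Finset.sum_add_distrib, add_mul, h2]
  have h5 : ∑ k, 2 * (∑ i, D k i * G i) * ρ k = 2 * ∑ k, (∑ i, D k i * G i) * ρ k := by
    rw [Finset.mul_sum]; exact Finset.sum_congr rfl fun i _ => by ring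
  rw [h5]
  have h6 : ∑ k, (∑ i, ∑ j, dS k i j * (p i * p j)) * ρ k =
    ∑ k, ρ k * (∑ i, ∑ j, dS k i j * (p i * p j)) := Finset.sum_congr rfl fun i _ => by ring
  rw [h6]; ring

/-- The Rellich vector field `⟨S∇u,∇u⟩ S x - 2 ⟨S∇u,x⟩ S∇u`. -/
def rellich {n : ℕ} (S : Fin n → Fin n → Eu n → ℝ) (u : Eu n → ℝ) (k : Fin n) (x : Eu n) : ℝ :=
  energy S u x * rad S k x - 2 * (conormal S u x * cograd S u k x)

section Rellich

variable {n : ℕ} {lam M R : ℝ} {S : Fin n → Fin n → Eu n → ℝ} {b : Fin n → Eu n → ℝ}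
  {u : Eu n → ℝ}

lemma Coef.pd_cograd (h : Coef n lam M S b) (hu : ContDiff ℝ 2 u) (k i : Fin n) (x : Eu n) :
    pd k (cograd S u i) x = ∑ j, (pd k (S i j) x * pd j u x + S i j x * pd k (pd j u) x) := by
  have hd : ∀ j, DifferentiableAt ℝ (S i j) x := fun j => (h.smooth i j).differentiable one_ne_zero x
  have hc : ∀ j, DifferentiableAt ℝ (pd j u) x := fun j =>
    (contDiff_pd_one hu j).differentiable one_ne_zero x
  unfold cograd
  rw [pd_sum k _ (F := fun j y => S i j y * pd j u y) fun j _ => (hd j).mul (hc j)]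
  simp only [pd_mul k (hd _) (hc _)]

lemma Coef.contDiff_rellich (h : Coef n lam M S b) (hu : ContDiff ℝ 2 u) (k : Fin n) :
    ContDiff ℝ 1 (rellich S u k) :=
  ((h.contDiff_energy hu).mul (h.contDiff_rad k)).sub
    (contDiff_const.mul ((h.contDiff_conormal hu).mul (h.contDiff_cograd hu k)))

lemma Sol.div_rellich (h : Coef n lam M S b) (hu : Sol S b R u) {x : Eu n} (hx : ‖x‖ < R) :
    ∑ k, pd k (rellich S u k) x =
      ∑ k, rad S k x * (∑ i, ∑ j, pd k (S i j) x * (pd i u x * pd j u x))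
      - 2 * ∑ k, ∑ i, pd k (rad S i) x * (pd i u x * cograd S u k x)
      + energy S u x * ∑ k, pd k (rad S k) x + 2 * (conormal S u x * drift b u x) := by
  have hu2 := hu.smooth
  have dp : ∀ j, DifferentiableAt ℝ (pd j u) x := fun j =>
    (contDiff_pd_one hu2 j).differentiable one_ne_zero x
  have dG : ∀ j, DifferentiableAt ℝ (cograd S u j) x := fun j =>
    (h.contDiff_cograd hu2 j).differentiable one_ne_zero x
  have dr : ∀ j, DifferentiableAt ℝ (rad S j) x := fun j =>
    (h.contDiff_rad j).differentiable one_ne_zero x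
  have de : DifferentiableAt ℝ (energy S u) x := (h.contDiff_energy hu2).differentiable one_ne_zero x
  have dn : DifferentiableAt ℝ (conormal S u) x :=
    (h.contDiff_conormal hu2).differentiable one_ne_zero x
  have pe : ∀ k, pd k (energy S u) x = ∑ i, (pd k (pd i u) x * cograd S u i x
      + pd i u x * ∑ j, (pd k (S i j) x * pd j u x + S i j x * pd k (pd j u) x)) := by
    intro k
    unfold energy
    rw [pd_sum k _ (F := fun j y => pd j u y * cograd S u j y) fun j _ => (dp j).mul (dG j)]
    simp only [pd_mul k (dp _) (dG _), h.pd_cograd hu2]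
  have pn : ∀ k, pd k (conormal S u) x = ∑ i, (pd k (pd i u) x * rad S i x
      + pd i u x * pd k (rad S i) x) := by
    intro k
    rw [show conormal S u = fun y => ∑ i, pd i u y * rad S i y from
      funext fun y => (h.sum_pd_mul_rad u y).symm]
    rw [pd_sum k _ (F := fun j y => pd j u y * rad S j y) fun j _ => (dp j).mul (dr j)]
    simp only [pd_mul k (dp _) (dr _)]
  have pw : ∀ k, pd k (rellich S u k) x = (pd k (energy S u) x * rad S k x
      - 2 * (pd k (conormal S u) x * cograd S u k x)) + energy S u x * pd k (rad S k) x
      - 2 * (conormal S u x * pd k (cograd S u k) x) := by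
    intro k
    unfold rellich
    rw [pd_sub k (f := fun y => energy S u y * rad S k y)
      (g := fun y => 2 * (conormal S u y * cograd S u k y)) (de.mul (dr k))
      ((differentiableAt_const _).mul (dn.mul (dG k))),
      pd_mul k de (dr k), pd_const_mul k 2 (f := fun y => conormal S u y * cograd S u k y)
      (dn.mul (dG k)), pd_mul k dn (dG k)]
    ring
  have alg := rellich_algebra (fun i j => S i j x) (fun k i => pd k (pd i u) x)
    (fun k i j => pd k (S i j) x) (fun i => pd i u x) (fun k => rad S k x)
    (fun k => cograd S u k x) (fun k i => pd k (rad S i) x) (fun i j => by rw [h.symm i j])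
    (fun i j => pd_comm i j hu2) (fun i => rfl)
  simp only [pw, Finset.sum_sub_distrib, Finset.sum_add_distrib, ← Finset.mul_sum]
  simp only [Finset.sum_sub_distrib, ← Finset.mul_sum] at alg
  simp only [pe, pn]
  rw [alg, show ∑ i, pd i (cograd S u i) x = - drift b u x by linarith [hu.eqn x hx]]
  ring

end Rellich

lemma abs_mul_le_mul {a b A B : ℝ} (ha : |a| ≤ A) (hb : |b| ≤ B) : |a * b| ≤ A * B := by
  rw [abs_mul]
  exact mul_le_mul ha hb (abs_nonneg _) ((abs_nonneg _).trans ha)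

/-- The inverse weight `|x|² / ⟨S x, x⟩`. -/
def weight {n : ℕ} (S : Fin n → Fin n → Eu n → ℝ) (x : Eu n) : ℝ := ‖x‖ ^ 2 * (quad S x)⁻¹

/-- The Euclidean norm of the gradient. -/
def gradNorm {n : ℕ} (u : Eu n → ℝ) (x : Eu n) : ℝ := √(∑ i, pd i u x ^ 2)

section Rellich

variable {n : ℕ} {lam M R : ℝ} {S : Fin n → Fin n → Eu n → ℝ} {b : Fin n → Eu n → ℝ}
  {u : Eu n → ℝ}

lemma gradNorm_sq (u : Eu n → ℝ) (x : Eu n) : gradNorm u x ^ 2 = ∑ i, pd i u x ^ 2 :=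
  Real.sq_sqrt (Finset.sum_nonneg fun _ _ => sq_nonneg _)

lemma abs_pd_le_gradNorm (u : Eu n → ℝ) (i : Fin n) (x : Eu n) : |pd i u x| ≤ gradNorm u x := by
  refine Real.abs_le_sqrt ?_
  exact Finset.single_le_sum (f := fun k => pd k u x ^ 2) (fun _ _ => sq_nonneg _)
    (Finset.mem_univ i)

lemma Coef.abs_cograd (h : Coef n lam M S b) (i : Fin n) (x : Eu n) :
    |cograd S u i x| ≤ n * (M * gradNorm u x) :=
  abs_sum_le_card fun j => abs_mul_le_mul (h.bound i j x) (abs_pd_le_gradNorm u j x)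

lemma Coef.abs_drift (h : Coef n lam M S b) (x : Eu n) :
    |drift b u x| ≤ n * (M * gradNorm u x) :=
  abs_sum_le_card fun j => abs_mul_le_mul (h.bound_drift j x) (abs_pd_le_gradNorm u j x)

lemma Coef.abs_conormal (h : Coef n lam M S b) (x : Eu n) :
    |conormal S u x| ≤ n * (‖x‖ * (n * (M * gradNorm u x))) :=
  abs_sum_le_card fun j => abs_mul_le_mul (abs_coord_le x j) (h.abs_cograd j x)

lemma Coef.abs_rad (h : Coef n lam M S b) (i : Fin n) (x : Eu n) :
    |rad S i x| ≤ n * (M * ‖x‖) :=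
  abs_sum_le_card fun j => abs_mul_le_mul (h.bound i j x) (abs_coord_le x j)

lemma Coef.abs_energy (h : Coef n lam M S b) (x : Eu n) :
    |energy S u x| ≤ lam * gradNorm u x ^ 2 := by
  rw [abs_of_nonneg (h.energy_nonneg u x), gradNorm_sq]
  exact h.energy_le u x

lemma Coef.abs_rellich (h : Coef n lam M S b) (k : Fin n) (x : Eu n) :
    |rellich S u k x| ≤ lam * gradNorm u x ^ 2 * (n * (M * ‖x‖))
      + 2 * (n * (‖x‖ * (n * (M * gradNorm u x))) * (n * (M * gradNorm u x))) := by
  refine (abs_sub _ _).trans (add_le_add (abs_mul_le_mul (h.abs_energy x) (h.abs_rad k x)) ?_)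
  rw [abs_mul, abs_two]
  exact mul_le_mul_of_nonneg_left (abs_mul_le_mul (h.abs_conormal x) (h.abs_cograd k x)) two_pos.le

lemma Coef.weight_nonneg (h : Coef n lam M S b) (x : Eu n) : 0 ≤ weight S x :=
  mul_nonneg (sq_nonneg _) (inv_nonneg.2 (h.quad_nonneg x))

lemma Coef.weight_le (h : Coef n lam M S b) (x : Eu n) : weight S x ≤ lam := by
  rcases eq_or_ne x 0 with rfl | hx
  · simp [weight, h.lam_pos.le]
  · rw [weight, ← div_eq_mul_inv, div_le_iff₀ (h.quad_pos hx)]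
    exact h.norm_sq_le_quad x

lemma Coef.inv_quad_le (h : Coef n lam M S b) {x : Eu n} (hx : x ≠ 0) :
    (quad S x)⁻¹ ≤ lam * (‖x‖ ^ 2)⁻¹ := by
  have : 0 < ‖x‖ ^ 2 := by positivity
  rw [← div_eq_mul_inv, le_div_iff₀ this, mul_comm, ← div_eq_mul_inv, div_le_iff₀ (h.quad_pos hx)]
  exact h.norm_sq_le_quad x

lemma Coef.contDiffOn_weight (h : Coef n lam M S b) : ContDiffOn ℝ 1 (weight S) {0}ᶜ :=
  (contDiff_norm_sq ℝ).contDiffOn.mul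
    (h.contDiff_quad.contDiffOn.inv fun _ hx => (h.quad_pos hx).ne')

lemma Coef.abs_weight_sub (h : Coef n lam M S b) (h0 : ∀ i j, S i j 0 = if i = j then 1 else 0)
    {x : Eu n} (hx : x ≠ 0) :
    |weight S x - 1| ≤ n * (n * (n * M)) * lam * ‖x‖ := by
  have hq := h.quad_pos hx
  have e : weight S x - 1 = -(quad S x - ‖x‖ ^ 2) * (quad S x)⁻¹ := by
    rw [weight]; field_simp; ring
  have hx' : ‖x‖ ≠ 0 := norm_ne_zero_iff.2 hx
  rw [e]
  calc _ ≤ (n * (n * (n * M)) * ‖x‖ ^ 3) * (lam * (‖x‖ ^ 2)⁻¹) := abs_mul_le_mul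
        (by rw [abs_neg]; exact h.abs_quad_sub h0 x)
        (by rw [abs_of_pos (inv_pos.2 hq)]; exact h.inv_quad_le hx)
    _ = _ := by field_simp

lemma Coef.abs_pd_quad_sub (h : Coef n lam M S b) (h0 : ∀ i j, S i j 0 = if i = j then 1 else 0)
    (k : Fin n) (x : Eu n) :
    |pd k (quad S) x - 2 * x k| ≤ (n * (n * M) + n * (2 * n * M)) * ‖x‖ ^ 2 := by
  have dr : ∀ j, DifferentiableAt ℝ (rad S j) x := fun j =>
    (h.contDiff_rad j).differentiable one_ne_zero x
  have hc : ∀ j, DifferentiableAt ℝ (fun y : Eu n => y j) x := fun j => (hasFDerivAt_coord j).differentiableAt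
  have e : pd k (quad S) x = rad S k x + ∑ i, x i * pd k (rad S i) x := by
    unfold quad
    rw [pd_sum k _ (F := fun j y => y j * rad S j y) fun j _ => (hc j).mul (dr j)]
    simp only [pd_mul k (hc _) (dr _), pd_coord, Finset.sum_add_distrib]
    simp
  have e2 : pd k (quad S) x - 2 * x k = (rad S k x - x k)
      + ∑ i, x i * (pd k (rad S i) x - if i = k then 1 else 0) := by
    rw [e]; simp [mul_sub, Finset.sum_sub_distrib]; ring
  rw [e2]
  refine (abs_add_le _ _).trans ?_
  have h2 : |∑ i, x i * (pd k (rad S i) x - if i = k then 1 else 0)| ≤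
    n * (‖x‖ * (2 * n * M * ‖x‖)) :=
    abs_sum_le_card fun i => abs_mul_le_mul (abs_coord_le x i) (h.abs_pd_rad_sub h0 k i x)
  linarith [h.abs_rad_sub h0 k x]

lemma Coef.abs_pd_weight (h : Coef n lam M S b) (h0 : ∀ i j, S i j 0 = if i = j then 1 else 0)
    (k : Fin n) {x : Eu n} (hx : x ≠ 0) :
    |pd k (weight S) x| ≤ (2 * (n * (n * (n * M))) + (n * (n * M) + n * (2 * n * M))) * lam ^ 2 := by
  have hq := h.quad_pos hx
  have hx' : ‖x‖ ≠ 0 := norm_ne_zero_iff.2 hx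
  have dq : DifferentiableAt ℝ (quad S) x := h.contDiff_quad.differentiable one_ne_zero x
  have dn : DifferentiableAt ℝ (fun y : Eu n => ‖y‖ ^ 2) x :=
    (contDiff_norm_sq ℝ (n := 1)).differentiable one_ne_zero x
  have e : pd k (weight S) x = (2 * x k * (quad S x - ‖x‖ ^ 2)
      - ‖x‖ ^ 2 * (pd k (quad S) x - 2 * x k)) * ((quad S x)⁻¹ * (quad S x)⁻¹) := by
    unfold weight
    rw [pd_mul k (g := fun y => (quad S y)⁻¹) dn (dq.inv hq.ne'), pd_comp k (φ := fun t => t⁻¹) (hasDerivAt_inv hq.ne') dq,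
      pd_norm_sq]
    field_simp
    ring
  have hi : |(quad S x)⁻¹| ≤ lam * (‖x‖ ^ 2)⁻¹ := by
    rw [abs_of_pos (inv_pos.2 hq)]; exact h.inv_quad_le hx
  rw [e]
  have h1 : |2 * x k * (quad S x - ‖x‖ ^ 2) - ‖x‖ ^ 2 * (pd k (quad S) x - 2 * x k)| ≤
      2 * ‖x‖ * (n * (n * (n * M)) * ‖x‖ ^ 3)
        + ‖x‖ ^ 2 * ((n * (n * M) + n * (2 * n * M)) * ‖x‖ ^ 2) := by
    refine (abs_sub _ _).trans (add_le_add (abs_mul_le_mul ?_ (h.abs_quad_sub h0 x))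
      (abs_mul_le_mul ?_ (h.abs_pd_quad_sub h0 k x)))
    · rw [abs_mul, abs_two]; linarith [abs_coord_le x k]
    · rw [abs_of_nonneg (sq_nonneg _)]
  calc _ ≤ _ := abs_mul_le_mul h1 (abs_mul_le_mul hi hi)
    _ = _ := by field_simp

lemma Sol.abs_div_rellich (h : Coef n lam M S b) (h0 : ∀ i j, S i j 0 = if i = j then 1 else 0)
    (hu : Sol S b R u) {x : Eu n} (hx : ‖x‖ < R) :
    |∑ k, pd k (rellich S u k) x - (n - 2) * energy S u x| ≤
      (n * (n * M * (n * (n * M))) + 2 * (n * (n * (2 * n * M * (n * M)))) + lam * (n * (2 * n * M))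
        + 2 * (n * n * M * (n * M))) * ‖x‖ * gradNorm u x ^ 2 := by
  set g := gradNorm u x with hg
  have hp : ∀ i, |pd i u x| ≤ g := fun i => abs_pd_le_gradNorm u i x
  rw [hu.div_rellich h hx]
  have t1 : |∑ k, rad S k x * (∑ i, ∑ j, pd k (S i j) x * (pd i u x * pd j u x))| ≤
      n * (n * (M * ‖x‖) * (n * (n * (M * (g * g))))) := abs_sum_le_card fun k =>
    abs_mul_le_mul (h.abs_rad k x) (abs_sum_le_card fun i => abs_sum_le_card fun j =>
      abs_mul_le_mul (h.bound_pd k i j x) (abs_mul_le_mul (hp i) (hp j)))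
  have e2 : ∑ k, ∑ i, pd k (rad S i) x * (pd i u x * cograd S u k x) = energy S u x +
      ∑ k, ∑ i, (pd k (rad S i) x - if i = k then 1 else 0) * (pd i u x * cograd S u k x) := by
    simp [sub_mul, Finset.sum_sub_distrib, energy]
  have t2 : |∑ k, ∑ i, (pd k (rad S i) x - if i = k then 1 else 0) * (pd i u x * cograd S u k x)| ≤
      n * (n * (2 * n * M * ‖x‖ * (g * (n * (M * g))))) := abs_sum_le_card fun k =>
    abs_sum_le_card fun i => abs_mul_le_mul (h.abs_pd_rad_sub h0 k i x)
      (abs_mul_le_mul (hp i) (h.abs_cograd k x))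
  have t3 : |energy S u x * (∑ k, (pd k (rad S k) x - 1))| ≤
      lam * g ^ 2 * (n * (2 * n * M * ‖x‖)) := abs_mul_le_mul (h.abs_energy x)
    (abs_sum_le_card fun k => by simpa using h.abs_pd_rad_sub h0 k k x)
  have e3 : ∑ k, pd k (rad S k) x = n + ∑ k, (pd k (rad S k) x - 1) := by simp
  have t4 : |conormal S u x * drift b u x| ≤ n * (‖x‖ * (n * (M * g))) * (n * (M * g)) :=
    abs_mul_le_mul (h.abs_conormal x) (h.abs_drift x)
  rw [e2, e3]
  rw [abs_le] at *
  constructor <;> linarith [t1.1, t1.2, t2.1, t2.2, t3.1, t3.2, t4.1, t4.2]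

/-- The normalized Rellich field has divergence `(n - 2) ⟨S∇u,∇u⟩` up to a small error. -/
lemma exists_rellich_bound (n : ℕ) (lam M : ℝ) : ∃ K : ℝ, 0 ≤ K ∧
    ∀ (S : Fin n → Fin n → Eu n → ℝ) (b : Fin n → Eu n → ℝ) (u : Eu n → ℝ) (R : ℝ),
      Coef n lam M S b → (∀ i j, S i j 0 = if i = j then 1 else 0) → Sol S b R u →
      ∀ x : Eu n, x ≠ 0 → ‖x‖ < R →
      |∑ k, pd k (fun y => weight S y * rellich S u k y) x - (n - 2) * energy S u x| ≤
        K * ‖x‖ * energy S u x := by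
  set K₁ : ℝ := n * (n * M * (n * (n * M))) + 2 * (n * (n * (2 * n * M * (n * M))))
    + lam * (n * (2 * n * M)) + 2 * (n * n * M * (n * M)) with hK₁
  set K₂ : ℝ := n * (n * (n * M)) * lam with hK₂
  set K₃ : ℝ := (2 * (n * (n * (n * M))) + (n * (n * M) + n * (2 * n * M))) * lam ^ 2 with hK₃
  set K₄ : ℝ := lam * (n * M) + 2 * (n * n * M * (n * M)) with hK₄
  set K : ℝ := lam * K₁ + K₂ * (|(n : ℝ) - 2| * lam) + n * (K₃ * K₄) with hK
  refine ⟨|K| * |lam|, by positivity, ?_⟩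
  intro S b u R h h0 hu x hx hxR
  have hu2 := hu.smooth
  set g := gradNorm u x with hg
  have dw : DifferentiableAt ℝ (weight S) x :=
    (h.contDiffOn_weight.contDiffAt (isOpen_compl_singleton.mem_nhds hx)).differentiableAt one_ne_zero
  have dW : ∀ k, DifferentiableAt ℝ (rellich S u k) x := fun k =>
    (h.contDiff_rellich hu2 k).differentiable one_ne_zero x
  have e : ∑ k, pd k (fun y => weight S y * rellich S u k y) x - (n - 2) * energy S u x =
      weight S x * (∑ k, pd k (rellich S u k) x - (n - 2) * energy S u x)
      + (weight S x - 1) * ((n - 2) * energy S u x)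
      + ∑ k, pd k (weight S) x * rellich S u k x := by
    simp only [pd_mul _ dw (dW _), Finset.sum_add_distrib, ← Finset.mul_sum]
    ring
  have hw : |weight S x| ≤ lam := by rw [abs_of_nonneg (h.weight_nonneg x)]; exact h.weight_le x
  have t1 := abs_mul_le_mul hw (hu.abs_div_rellich h h0 hxR)
  have t2 := abs_mul_le_mul (h.abs_weight_sub h0 hx)
    (abs_mul_le_mul (le_refl |(n : ℝ) - 2|) (h.abs_energy (u := u) x))
  have t3 : |∑ k, pd k (weight S) x * rellich S u k x| ≤ n * (K₃ * (lam * g ^ 2 * (n * (M * ‖x‖))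
      + 2 * (n * (‖x‖ * (n * (M * g))) * (n * (M * g))))) := abs_sum_le_card fun k =>
    abs_mul_le_mul (h.abs_pd_weight h0 k hx) (h.abs_rellich k x)
  have hs : g ^ 2 ≤ lam * energy S u x := by rw [gradNorm_sq]; exact h.sum_sq_le_energy u x
  rw [e]
  calc _ ≤ K * (‖x‖ * g ^ 2) := by
        refine (abs_add_le _ _).trans ?_
        refine (add_le_add (abs_add_le _ _) le_rfl).trans ?_
        refine (add_le_add (add_le_add t1 t2) t3).trans (le_of_eq ?_)
        rw [hK, hK₁, hK₂, hK₄]; ring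
    _ ≤ |K| * (‖x‖ * (lam * energy S u x)) := by
        refine mul_le_mul (le_abs_self _) ?_ (by positivity) (abs_nonneg _)
        exact mul_le_mul_of_nonneg_left hs (norm_nonneg _)
    _ = _ := by rw [abs_of_pos h.lam_pos]; ring

end Rellich

lemma continuous_sph {n : ℕ} {F : Eu n → ℝ} (hF : Continuous F) : Continuous (sph F) :=
  continuous_parametric_integral_of_continuous
    (μ := sphMeas n) (f := fun (s : ℝ) (θ : sphere (0 : Eu n) 1) => F (s • (θ : Eu n)))
    (s := Set.univ) (by fun_prop) isCompact_univ |>.congr fun s => by simp [sph]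

lemma tendsto_setIntegral_closedBall {n : ℕ} (hn : 1 ≤ n) {F : Eu n → ℝ} (hF : Continuous F) :
    Filter.Tendsto (fun s => ∫ x in closedBall (0 : Eu n) s, F x) (nhdsWithin 0 (Set.Ioi 0))
      (nhds 0) := by
  have hc : Continuous (fun s : ℝ => s ^ (n - 1) * sph F s) := (continuous_pow _).mul (continuous_sph hF)
  have h1 : Continuous (fun s : ℝ => ∫ t in (0 : ℝ)..s, t ^ (n - 1) * sph F t) :=
    intervalIntegral.continuous_primitive (fun a b => hc.intervalIntegrable a b) 0
  have h2 := (h1.tendsto 0).mono_left (nhdsWithin_le_nhds (s := Set.Ioi 0))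
  simp only [intervalIntegral.integral_same] at h2
  refine h2.congr' ?_
  filter_upwards [self_mem_nhdsWithin] with s hs
  exact (setIntegral_closedBall_eq hn (hF.continuousOn.integrableOn_compact
    (isCompact_closedBall _ _)) (le_of_lt hs)).symm

/-- A function on `(0, r]` with nonnegative derivative and limit `0` at `0` is nonnegative. -/
lemma nonneg_of_deriv_nonneg_of_tendsto {f f' : ℝ → ℝ} {r : ℝ} (hr : 0 < r)
    (hd : ∀ s, 0 < s → s ≤ r → HasDerivAt f (f' s) s) (h0 : ∀ s, 0 < s → s ≤ r → 0 ≤ f' s)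
    (hl : Filter.Tendsto f (nhdsWithin 0 (Set.Ioi 0)) (nhds 0)) : 0 ≤ f r := by
  refine le_of_tendsto hl ?_
  filter_upwards [Ioo_mem_nhdsGT hr] with s hs
  have : MonotoneOn f (Set.Icc s r) := by
    refine monotoneOn_of_deriv_nonneg (convex_Icc s r)
      (fun t ht => (hd t (hs.1.trans_le ht.1) ht.2).continuousAt.continuousWithinAt)
      (fun t ht => ?_) (fun t ht => ?_)
    · rw [interior_Icc] at ht
      exact (hd t (hs.1.trans ht.1) ht.2.le).differentiableAt.differentiableWithinAt
    · rw [interior_Icc] at ht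
      rw [(hd t (hs.1.trans ht.1) ht.2.le).deriv]
      exact h0 t (hs.1.trans ht.1) ht.2.le
  exact this ⟨le_rfl, hs.2.le⟩ ⟨hs.2.le, le_rfl⟩ hs.2.le

/-- The Rellich identity in integrated form. -/
lemma exists_rellich_integrated (n : ℕ) (hn : 2 ≤ n) (lam M : ℝ) : ∃ K : ℝ, 0 ≤ K ∧
    ∀ (S : Fin n → Fin n → Eu n → ℝ) (b : Fin n → Eu n → ℝ) (u : Eu n → ℝ) (R : ℝ),
      Coef n lam M S b → (∀ i j, S i j 0 = if i = j then 1 else 0) → Sol S b R u →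
      ∀ r : ℝ, 0 < r → r < R →
      |r ^ n * sph (energy S u) r
          - 2 * (r ^ n * sph (fun x => conormal S u x ^ 2 * (quad S x)⁻¹) r)
          - (n - 2) * ∫ x in closedBall (0 : Eu n) r, energy S u x| ≤
        K * r * ∫ x in closedBall (0 : Eu n) r, energy S u x := by
  obtain ⟨K, hK, key⟩ := exists_rellich_bound n lam M
  refine ⟨K, hK, ?_⟩
  intro S b u R h h0 hu r hr hrR
  have hu2 := hu.smooth
  set V : Fin n → Eu n → ℝ := fun k y => weight S y * rellich S u k y with hV
  have hVc : ∀ k, ContDiffOn ℝ 1 (V k) {0}ᶜ := fun k =>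
    h.contDiffOn_weight.mul (h.contDiff_rellich hu2 k).contDiffOn
  have hec : Continuous (energy S u) := (h.contDiff_energy hu2).continuous
  set E : ℝ → ℝ := fun s => ∫ x in closedBall (0 : Eu n) s, energy S u x with hE
  set Q : ℝ → ℝ := fun s => s ^ (n - 2) * sph (fun x => ∑ k, x k * V k x) s with hQ
  have hdE : ∀ s, 0 < s → HasDerivAt E (s ^ (n - 1) * sph (energy S u) s) s := fun s hs =>
    hasDerivAt_setIntegral_closedBall (by omega) hec hs
  have hdQ : ∀ s, 0 < s → HasDerivAt Q (s ^ (n - 1) * sph (fun x => ∑ k, pd k (V k) x) s) s :=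
    fun s hs => hasDerivAt_flux hn hVc hs
  have hdc : ContinuousOn (fun x => ∑ k, pd k (V k) x) {0}ᶜ :=
    continuousOn_finsetSum _ fun k _ => continuousOn_pd isOpen_compl_singleton (hVc k) k
  have hbd : ∀ s, 0 < s → s ≤ r →
      |sph (fun x => ∑ k, pd k (V k) x) s - (n - 2) * sph (energy S u) s| ≤
        K * r * sph (energy S u) s := by
    intro s hs hsr
    have pt : ∀ x : Eu n, ‖x‖ = s → |∑ k, pd k (V k) x - (n - 2) * energy S u x| ≤
        K * r * energy S u x := by
      intro x hx
      have hx0 : x ≠ 0 := by rw [← norm_pos_iff, hx]; exact hs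
      refine (key S b u R h h0 hu x hx0 (by rw [hx]; linarith)).trans ?_
      have := h.energy_nonneg u x
      rw [hx]
      gcongr
    have c1 : ContinuousOn (fun x => ((n : ℝ) - 2) * energy S u x) {0}ᶜ :=
      (continuous_const.mul hec).continuousOn
    rw [← sph_const_mul, ← sph_const_mul, ← sph_sub hs hdc c1, abs_le]
    constructor
    · rw [← sub_nonneg, sub_neg_eq_add, ← sph_add hs (by exact hdc.sub c1)
        (by exact (continuous_const.mul hec).continuousOn)]
      exact sph_nonneg hs.le fun x hx => by linarith [(abs_le.1 (pt x hx)).1]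
    · exact sph_mono hs (by exact hdc.sub c1) (by exact (continuous_const.mul hec).continuousOn)
        fun x hx => (abs_le.1 (pt x hx)).2
  have hE0 : Filter.Tendsto E (nhdsWithin 0 (Set.Ioi 0)) (nhds 0) :=
    tendsto_setIntegral_closedBall (by omega) hec
  have hQ0 : Filter.Tendsto Q (nhdsWithin 0 (Set.Ioi 0)) (nhds 0) := by
    set G : Eu n → ℝ := fun x => lam * |∑ k, x k * rellich S u k x| with hG
    have hGc : Continuous G := continuous_const.mul (continuous_finsetSum _ fun k _ =>
      Continuous.mul (by fun_prop) (h.contDiff_rellich hu2 k).continuous).abs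
    have h1 : Filter.Tendsto (fun s => s ^ (n - 2) * sph G s) (nhdsWithin 0 (Set.Ioi 0)) (nhds 0) := by
      have h2 : Filter.Tendsto (fun s => s ^ (n - 2) * sph G s) (nhdsWithin 0 (Set.Ioi 0))
          (nhds ((0 : ℝ) ^ (n - 2) * sph G 0)) :=
        (((continuous_pow (n - 2)).mul (continuous_sph hGc)).tendsto 0).mono_left
          (nhdsWithin_le_nhds (s := Set.Ioi 0))
      have e : sph G 0 = 0 := by simp [sph, hG]
      rwa [e, mul_zero] at h2
    refine squeeze_zero_norm' ?_ h1
    filter_upwards [self_mem_nhdsWithin] with s hs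
    have hs' : 0 < s := hs
    have cV : ContinuousOn (fun x => ∑ k, x k * V k x) {0}ᶜ :=
      continuousOn_finsetSum _ fun k _ => ContinuousOn.mul (by fun_prop) (hVc k).continuousOn
    have pt : ∀ x : Eu n, |∑ k, x k * V k x| ≤ G x := by
      intro x
      have : ∑ k, x k * V k x = weight S x * ∑ k, x k * rellich S u k x := by
        rw [Finset.mul_sum]; exact Finset.sum_congr rfl fun k _ => by simp only [hV]; ring
      rw [this]
      exact abs_mul_le_mul (by rw [abs_of_nonneg (h.weight_nonneg x)]; exact h.weight_le x) le_rfl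
    rw [Real.norm_eq_abs, abs_mul, abs_of_nonneg (by positivity)]
    refine mul_le_mul_of_nonneg_left ?_ (by positivity)
    rw [abs_le]
    constructor
    · rw [← sub_nonneg, sub_neg_eq_add, ← sph_add hs' cV hGc.continuousOn]
      exact sph_nonneg hs'.le fun x hx => by linarith [(abs_le.1 (pt x)).1]
    · exact sph_mono hs' cV hGc.continuousOn fun x hx => (abs_le.1 (pt x)).2
  have hQr : Q r = r ^ n * sph (energy S u) r
      - 2 * (r ^ n * sph (fun x => conormal S u x ^ 2 * (quad S x)⁻¹) r) := by
    have c2 : ContinuousOn (fun x => conormal S u x ^ 2 * (quad S x)⁻¹) {0}ᶜ :=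
      ((h.contDiff_conormal hu2).continuous.pow 2).continuousOn.mul
        (h.contDiff_quad.continuous.continuousOn.inv₀ fun x hx => (h.quad_pos hx).ne')
    have : sph (fun x => ∑ k, x k * V k x) r = sph (fun x => r ^ 2 * (energy S u x
        - 2 * (conormal S u x ^ 2 * (quad S x)⁻¹))) r := by
      refine sph_congr hr.le fun x hx => ?_
      have hx0 : x ≠ 0 := by rw [← norm_pos_iff, hx]; exact hr
      have hq := (h.quad_pos hx0).ne'
      have e : ∑ k, x k * V k x = weight S x *
          (energy S u x * quad S x - 2 * (conormal S u x * conormal S u x)) := by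
        conv_rhs => rw [quad, conormal]
        simp only [hV, rellich, Finset.mul_sum, ← Finset.sum_sub_distrib]
        refine Finset.sum_congr rfl fun k _ => ?_
        simp only [conormal]
        ring
      rw [e, weight, hx]
      field_simp
    rw [hQ]
    simp only
    rw [this, sph_const_mul, sph_sub hr hec.continuousOn (by exact continuousOn_const.mul c2),
      sph_const_mul]
    have e : r ^ n = r ^ (n - 2) * r ^ 2 := by rw [← pow_add]; congr 1; omega
    rw [e]; ring
  have hEr : 0 ≤ r := hr.le
  have main : ∀ σ : ℝ, |σ| = 1 → 0 ≤ K * r * E r + σ * (Q r - (n - 2) * E r) := by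
    intro σ hσ
    refine nonneg_of_deriv_nonneg_of_tendsto (f := fun s => K * r * E s + σ * (Q s - (n - 2) * E s))
      (f' := fun s => K * r * (s ^ (n - 1) * sph (energy S u) s)
        + σ * (s ^ (n - 1) * sph (fun x => ∑ k, pd k (V k) x) s
          - (n - 2) * (s ^ (n - 1) * sph (energy S u) s))) hr ?_ ?_ ?_
    · intro s hs _
      exact ((hdE s hs).const_mul _).add (((hdQ s hs).sub ((hdE s hs).const_mul _)).const_mul _)
    · intro s hs hsr
      have h1 := hbd s hs hsr
      have h2 : |σ * (sph (fun x => ∑ k, pd k (V k) x) s - (n - 2) * sph (energy S u) s)| ≤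
          K * r * sph (energy S u) s := by rw [abs_mul, hσ, one_mul]; exact h1
      have h3 := (abs_le.1 h2).1
      have h4 : 0 ≤ s ^ (n - 1) := by positivity
      nlinarith
    · have := (hE0.const_mul (K * r)).add ((hQ0.sub (hE0.const_mul ((n : ℝ) - 2))).const_mul σ)
      simpa using this
  rw [← hQr, abs_le]
  have m1 := main 1 (by simp)
  have m2 := main (-1) (by simp)
  constructor
  · change -(K * r * E r) ≤ Q r - (n - 2) * E r
    linarith
  · change Q r - (n - 2) * E r ≤ K * r * E r
    linarith

section Barrier

variable {n : ℕ} {lam M R : ℝ} {S : Fin n → Fin n → Eu n → ℝ} {b : Fin n → Eu n → ℝ}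
  {u : Eu n → ℝ}

lemma pd_exp_norm_sq (α : ℝ) (i : Fin n) (x : Eu n) :
    pd i (fun y : Eu n => Real.exp (α * ‖y‖ ^ 2)) x = 2 * α * x i * Real.exp (α * ‖x‖ ^ 2) := by
  have dn : DifferentiableAt ℝ (fun y : Eu n => ‖y‖ ^ 2) x :=
    (contDiff_norm_sq ℝ (n := 1)).differentiable one_ne_zero x
  rw [pd_comp i (φ := Real.exp) (f := fun y : Eu n => α * ‖y‖ ^ 2) (Real.hasDerivAt_exp _)
    (dn.const_mul α), pd_const_mul i α dn, pd_norm_sq]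
  ring

/-- The field `g ∇_S(u²) - u² S∇g + g u² b` with `g = c - exp (α |x|²)`. -/
def barrierField (S : Fin n → Fin n → Eu n → ℝ) (b : Fin n → Eu n → ℝ) (u : Eu n → ℝ) (c α : ℝ)
    (i : Fin n) (x : Eu n) : ℝ :=
  2 * ((c - Real.exp (α * ‖x‖ ^ 2)) * (u x * cograd S u i x))
    + 2 * α * (Real.exp (α * ‖x‖ ^ 2) * (u x ^ 2 * rad S i x))
    + (c - Real.exp (α * ‖x‖ ^ 2)) * (u x ^ 2 * b i x)

lemma contDiff_exp_norm_sq (α : ℝ) {m : WithTop ℕ∞} :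
    ContDiff ℝ m (fun y : Eu n => Real.exp (α * ‖y‖ ^ 2)) :=
  Real.contDiff_exp.comp (contDiff_const.mul (contDiff_norm_sq ℝ))

lemma Coef.contDiff_barrierField (h : Coef n lam M S b) (hu : ContDiff ℝ 2 u) (c α : ℝ)
    (i : Fin n) : ContDiff ℝ 1 (barrierField S b u c α i) := by
  have hu1 : ContDiff ℝ 1 u := hu.of_le (by norm_num)
  exact ((contDiff_const.mul ((contDiff_const.sub (contDiff_exp_norm_sq α)).mul
    (hu1.mul (h.contDiff_cograd hu i)))).add (contDiff_const.mul ((contDiff_exp_norm_sq α).mul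
    ((hu1.pow 2).mul (h.contDiff_rad i))))).add
    ((contDiff_const.sub (contDiff_exp_norm_sq α)).mul ((hu1.pow 2).mul (h.smooth_drift i)))

lemma Sol.div_barrierField (h : Coef n lam M S b) (hu : Sol S b R u) (c α : ℝ) {x : Eu n}
    (hx : ‖x‖ < R) :
    ∑ i, pd i (barrierField S b u c α i) x =
      2 * ((c - Real.exp (α * ‖x‖ ^ 2)) * energy S u x)
      + 2 * α * Real.exp (α * ‖x‖ ^ 2) * u x ^ 2 *
        (2 * α * quad S x + ∑ i, pd i (rad S i) x - ∑ i, x i * b i x) := by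
  have hu2 := hu.smooth
  have hu1 : ContDiff ℝ 1 u := hu2.of_le (by norm_num)
  have du : DifferentiableAt ℝ u x := hu1.differentiable one_ne_zero x
  have dG : ∀ j, DifferentiableAt ℝ (cograd S u j) x := fun j =>
    (h.contDiff_cograd hu2 j).differentiable one_ne_zero x
  have dr : ∀ j, DifferentiableAt ℝ (rad S j) x := fun j =>
    (h.contDiff_rad j).differentiable one_ne_zero x
  have db : ∀ j, DifferentiableAt ℝ (b j) x := fun j =>
    (h.smooth_drift j).differentiable one_ne_zero x
  have dE : DifferentiableAt ℝ (fun y : Eu n => Real.exp (α * ‖y‖ ^ 2)) x :=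
    (contDiff_exp_norm_sq α (m := 1)).differentiable one_ne_zero x
  have dg : DifferentiableAt ℝ (fun y : Eu n => c - Real.exp (α * ‖y‖ ^ 2)) x := dE.const_sub c
  have du2 : DifferentiableAt ℝ (fun y => u y ^ 2) x := du.pow 2
  have pg : ∀ i, pd i (fun y : Eu n => c - Real.exp (α * ‖y‖ ^ 2)) x =
      - (2 * α * x i * Real.exp (α * ‖x‖ ^ 2)) := by
    intro i
    rw [pd_sub i (f := fun _ => c) (by fun_prop) dE, pd_const, pd_exp_norm_sq]; ring
  have pu2 : ∀ i, pd i (fun x => u x ^ 2) x = 2 * u x * pd i u x := by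
    intro i
    simp only [pow_two]
    rw [pd_mul i du du]; ring
  set φ := Real.exp (α * ‖x‖ ^ 2) with hφ
  have main : ∀ i, pd i (barrierField S b u c α i) x =
      2 * (c - φ) * (pd i u x * cograd S u i x) + 2 * (c - φ) * u x * pd i (cograd S u i) x
      + 2 * (c - φ) * u x * (b i x * pd i u x) + (c - φ) * u x ^ 2 * pd i (b i) x
      + 4 * α * φ * u x * (pd i u x * rad S i x) - 4 * α * φ * u x * (x i * cograd S u i x)
      + 2 * α * φ * u x ^ 2 * (2 * α * (x i * rad S i x)) + 2 * α * φ * u x ^ 2 * pd i (rad S i) x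
      - 2 * α * φ * u x ^ 2 * (x i * b i x) := by
    intro i
    have d1 := du.mul (dG i)
    have d2 := du2.mul (dr i)
    have d3 := du2.mul (db i)
    have d4 := (dg.mul d1).const_mul 2
    have d5 := (dE.mul d2).const_mul (2 * α)
    unfold barrierField
    rw [pd_add i (f := fun x => 2 * ((c - Real.exp (α * ‖x‖ ^ 2)) * (u x * cograd S u i x))
        + 2 * α * (Real.exp (α * ‖x‖ ^ 2) * (u x ^ 2 * rad S i x)))
        (g := fun x => (c - Real.exp (α * ‖x‖ ^ 2)) * (u x ^ 2 * b i x)) (d4.add d5) (dg.mul d3),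
      pd_add i (f := fun x => 2 * ((c - Real.exp (α * ‖x‖ ^ 2)) * (u x * cograd S u i x)))
        (g := fun x => 2 * α * (Real.exp (α * ‖x‖ ^ 2) * (u x ^ 2 * rad S i x))) d4 d5,
      pd_const_mul i 2 (f := fun x => (c - Real.exp (α * ‖x‖ ^ 2)) * (u x * cograd S u i x))
        (dg.mul d1),
      pd_const_mul i (2 * α) (f := fun x => Real.exp (α * ‖x‖ ^ 2) * (u x ^ 2 * rad S i x))
        (dE.mul d2),
      pd_mul i dg (g := fun x => u x * cograd S u i x) d1,
      pd_mul i dE (g := fun x => u x ^ 2 * rad S i x) d2,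
      pd_mul i dg (g := fun x => u x ^ 2 * b i x) d3, pd_mul i du (dG i), pd_mul i du2 (dr i),
      pd_mul i du2 (db i), pg, pd_exp_norm_sq, pu2]
    ring
  have he := hu.eqn x hx
  simp only [main, Finset.sum_add_distrib, Finset.sum_sub_distrib, ← Finset.mul_sum,
    h.sum_pd_mul_rad, h.div_drift]
  rw [show ∑ i, pd i (cograd S u i) x = - drift b u x by linarith, energy, quad, conormal, drift]
  ring

lemma Coef.one_le_lam_mul_diag (h : Coef n lam M S b) (i : Fin n) (x : Eu n) :
    1 ≤ lam * S i i x := by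
  have := h.lower x (Pi.single i 1)
  simpa [Pi.single_apply] using this

/-- Solutions are controlled in `L²` of a ball by their boundary values. -/
lemma exists_integral_sq_le (n : ℕ) (hn : 2 ≤ n) (lam M : ℝ) : ∃ K : ℝ, 0 ≤ K ∧
    ∀ (S : Fin n → Fin n → Eu n → ℝ) (b : Fin n → Eu n → ℝ) (u : Eu n → ℝ) (R : ℝ),
      Coef n lam M S b → Sol S b R u → ∀ r : ℝ, 0 < r → r ≤ 1 → r < R →
      ∫ x in closedBall (0 : Eu n) r, u x ^ 2 ≤
        K * (r ^ (n - 2) * sph (fun x => u x ^ 2 * quad S x) r) := by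
  set m : ℝ := n * (n * M) + n * M with hm
  set α : ℝ := m ^ 2 * lam ^ 2 + 1 with hα
  have hα1 : 1 ≤ α := by rw [hα]; nlinarith [sq_nonneg (m * lam)]
  have hα0 : 0 < α := by linarith
  refine ⟨|lam| * (2 * α * Real.exp α), by positivity, ?_⟩
  intro S b u R h hu r hr hr1 hrR
  have hu2 := hu.smooth
  have hu1 : ContDiff ℝ 1 u := hu2.of_le (by norm_num)
  have hl := h.lam_pos
  set c := Real.exp (α * r ^ 2) with hc
  have key := flux_eq hn (h.contDiff_barrierField hu2 c α) hr
  have e1 : sph (fun x => ∑ i, x i * barrierField S b u c α i x) r =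
      2 * α * c * sph (fun x => u x ^ 2 * quad S x) r := by
    rw [← sph_const_mul]
    refine sph_congr hr.le fun x hx => ?_
    rw [quad, Finset.mul_sum, Finset.mul_sum]
    refine Finset.sum_congr rfl fun i _ => ?_
    rw [barrierField, hx, ← hc]; ring
  have hpt : ∀ x ∈ closedBall (0 : Eu n) r, lam⁻¹ * u x ^ 2 ≤
      ∑ i, pd i (barrierField S b u c α i) x := by
    intro x hx
    have hxr : ‖x‖ ≤ r := by simpa using hx
    rw [hu.div_barrierField h c α (hxr.trans_lt hrR)]
    have hg : 0 ≤ c - Real.exp (α * ‖x‖ ^ 2) := by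
      rw [sub_nonneg, hc]
      gcongr
    have he := h.energy_nonneg u x
    have hφ : 1 ≤ Real.exp (α * ‖x‖ ^ 2) := Real.one_le_exp (by positivity)
    have hq : lam⁻¹ * ‖x‖ ^ 2 ≤ quad S x := by
      rw [inv_mul_le_iff₀ hl]; exact h.norm_sq_le_quad x
    have hM := h.M_nonneg (by omega)
    have hd : n * lam⁻¹ - n * (n * (M * ‖x‖)) ≤ ∑ i, pd i (rad S i) x := by
      simp only [h.pd_rad, Finset.sum_add_distrib]
      have h1 : |∑ i, ∑ j, pd i (S i j) x * x j| ≤ n * (n * (M * ‖x‖)) := abs_sum_le_card fun i =>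
        abs_sum_le_card fun j => abs_mul_le_mul (h.bound_pd i i j x) (abs_coord_le x j)
      have h2 : n * lam⁻¹ ≤ ∑ i, S i i x := by
        have : ∑ i : Fin n, lam⁻¹ ≤ ∑ i, S i i x := Finset.sum_le_sum fun i _ => by
          have := h.one_le_lam_mul_diag i x
          rwa [inv_le_iff_one_le_mul₀' hl]
        simpa using this
      linarith [(abs_le.1 h1).1]
    have hb : |∑ i, x i * b i x| ≤ n * (‖x‖ * M) := abs_sum_le_card fun i =>
      abs_mul_le_mul (abs_coord_le x i) (h.bound_drift i x)
    have hbr : lam⁻¹ / 2 ≤ 2 * α * quad S x + ∑ i, pd i (rad S i) x - ∑ i, x i * b i x := by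
      have h1 : 2 * α * (lam⁻¹ * ‖x‖ ^ 2) ≤ 2 * α * quad S x := by gcongr
      have h2 : m * ‖x‖ ≤ 2 * α * (lam⁻¹ * ‖x‖ ^ 2) + lam⁻¹ / 2 := by
        have h3 : 0 ≤ lam⁻¹ * ((2 * (m * lam) * ‖x‖ - 1) ^ 2 + 4 * ‖x‖ ^ 2) := by positivity
        have h4 : lam⁻¹ * ((2 * (m * lam) * ‖x‖ - 1) ^ 2 + 4 * ‖x‖ ^ 2) =
          2 * (2 * α * (lam⁻¹ * ‖x‖ ^ 2) + lam⁻¹ / 2 - 2 * (m * ‖x‖)) := by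
          rw [hα]; field_simp; ring
        have h5 : 0 ≤ m * ‖x‖ := by positivity
        linarith
      have h6 : lam⁻¹ ≤ n * lam⁻¹ := by
        have : (1 : ℝ) ≤ n := by exact_mod_cast (by omega : 1 ≤ n)
        have := inv_pos.2 hl
        nlinarith
      have h7 : m * ‖x‖ = n * (n * (M * ‖x‖)) + n * (‖x‖ * M) := by rw [hm]; ring
      linarith [(abs_le.1 hb).2]
    have h8 : 2 * u x ^ 2 ≤ 2 * α * Real.exp (α * ‖x‖ ^ 2) * u x ^ 2 := by
      have : 1 * 1 ≤ α * Real.exp (α * ‖x‖ ^ 2) := mul_le_mul hα1 hφ zero_le_one hα0.le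
      nlinarith [sq_nonneg (u x)]
    have h9 := mul_le_mul h8 hbr (by positivity) (by positivity)
    have h10 := mul_nonneg hg he
    linarith
  have i1 : IntegrableOn (fun x => lam⁻¹ * u x ^ 2) (closedBall (0 : Eu n) r) :=
    (continuous_const.mul (hu1.continuous.pow 2)).continuousOn.integrableOn_compact
      (isCompact_closedBall _ _)
  have i2 : IntegrableOn (fun x => ∑ i, pd i (barrierField S b u c α i) x)
      (closedBall (0 : Eu n) r) :=
    (continuous_finsetSum _ fun i _ =>
      continuous_pd (h.contDiff_barrierField hu2 c α i) i).continuousOn.integrableOn_compact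
      (isCompact_closedBall _ _)
  have h1 := setIntegral_mono_on i1 i2 measurableSet_closedBall hpt
  rw [← key, e1, integral_const_mul, inv_mul_le_iff₀ hl] at h1
  have hk : 0 ≤ sph (fun x => u x ^ 2 * quad S x) r :=
    sph_nonneg hr.le fun x _ => mul_nonneg (sq_nonneg _) (h.quad_nonneg x)
  have hcα : c ≤ Real.exp α := by
    rw [hc]
    refine Real.exp_le_exp.2 ?_
    have : r ^ 2 ≤ 1 := by nlinarith
    nlinarith
  rw [abs_of_pos hl]
  calc _ ≤ _ := h1
    _ = lam * (2 * α * c) * (r ^ (n - 2) * sph (fun x => u x ^ 2 * quad S x) r) := by ring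
    _ ≤ _ := by gcongr

end Barrier

section Growth

lemma abs_le_of_sq_le {r c m K β A q Y t : ℝ} (hr : 0 ≤ r) (hr1 : r ≤ 1) (hc : 0 ≤ c)
    (hm : 0 ≤ m) (hK : 0 ≤ K) (hβ : 0 ≤ β) (hq : 0 ≤ q) (hA : 0 ≤ A) (ht : t ^ 2 ≤ c * r ^ 2 * Y)
    (hY : Y ≤ 2 * q + 2 * A ^ 2 + (m + K) * β) :
    |t| ≤ 2 * q + r * ((1 + c) * (2 + m + K) * (1 + A + β)) := by
  set B := 1 + A + β with hB
  set G := 2 + m + K with hG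
  have hB1 : 1 ≤ B := by linarith
  have hG1 : 2 ≤ G := by linarith
  have b1 : c ≤ (1 + c) * G * B := by
    have : c * 1 * 1 ≤ (1 + c) * G * B := by
      gcongr <;> linarith
    linarith
  have d0 : A ^ 2 + β ≤ B ^ 2 := by
    rw [hB]
    have := mul_nonneg hA hβ
    nlinarith [sq_nonneg β]
  have d1 : 2 * A ^ 2 + (m + K) * β ≤ G * B ^ 2 := by
    have h1 : G * (A ^ 2 + β) ≤ G * B ^ 2 := by gcongr
    have h2 := mul_nonneg (add_nonneg hm hK) (sq_nonneg A)
    rw [hG] at h1 ⊢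
    linarith
  have b2 : c * (2 * A ^ 2 + (m + K) * β) ≤ ((1 + c) * G * B) ^ 2 := by
    have d2 : c ≤ (1 + c) ^ 2 := by nlinarith
    have d3 : G ≤ G ^ 2 := by nlinarith
    calc _ ≤ (1 + c) ^ 2 * (G * B ^ 2) := by gcongr
      _ ≤ (1 + c) ^ 2 * (G ^ 2 * B ^ 2) := by gcongr
      _ = _ := by ring
  have hL : 0 ≤ (1 + c) * G * B := by positivity
  generalize (1 + c) * G * B = L at *
  refine abs_le_of_sq_le_sq (ht.trans ?_) (by positivity)
  have b3 : c * r ^ 2 * Y ≤ c * r ^ 2 * (2 * q + 2 * A ^ 2 + (m + K) * β) := by gcongr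
  have b4 : r ^ 2 * (c * (2 * A ^ 2 + (m + K) * β)) ≤ r ^ 2 * L ^ 2 := by gcongr
  have b6 : r * (c * r) ≤ r * L := by
    have : c * r ≤ L := by nlinarith
    gcongr
  have b5 : q * (r * (c * r)) ≤ q * (r * L) := by gcongr
  have b7 : 0 ≤ q * (r * L) := by positivity
  have e1 : c * r ^ 2 * (2 * q + 2 * A ^ 2 + (m + K) * β) =
    2 * (q * (r * (c * r))) + r ^ 2 * (c * (2 * A ^ 2 + (m + K) * β)) := by ring
  have e2 : (2 * q + r * L) ^ 2 = 4 * q ^ 2 + 4 * (q * (r * L)) + r ^ 2 * L ^ 2 := by ring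
  have := sq_nonneg q
  linarith

/-- The algebraic core of the monotonicity of the frequency. -/
lemma frequency_algebra {r c m K β N δ Y π t w : ℝ} (hr : 0 < r) (hr1 : r ≤ 1) (hc : 0 ≤ c)
    (hm : 0 ≤ m) (hK : 0 ≤ K) (hβ : 0 ≤ β) (hN : N = β - δ) (hδ : δ ^ 2 ≤ c * r ^ 2 * β)
    (hπ : N ^ 2 ≤ π) (hY : |Y - 2 * π - m * β| ≤ K * r * β)
    (ht : t ^ 2 ≤ c * r ^ 2 * Y) (hw : |w - (m + 2)| ≤ K * r) :
    0 ≤ N + c * r ∧ β ≤ 2 * N + c ∧ N ≤ 2 * β + c ∧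
      -(3 * ((1 + c) * (2 + m + K) + m * (1 + c) + 2 * K) * r * (N + (c + 1))) ≤
        2 * N + Y - t - N * (2 * N + w) := by
  have hr2 : r ^ 2 ≤ 1 := by nlinarith
  have hδ0 : |δ| ≤ β + c * r ^ 2 / 4 := by
    refine abs_le_of_sq_le_sq ?_ (by positivity)
    nlinarith [sq_nonneg (β - c * r ^ 2 / 4)]
  have hδ1 : |δ| ≤ β / 2 + c / 2 := by
    refine abs_le_of_sq_le_sq ?_ (by positivity)
    have : c * r ^ 2 * β ≤ c * 1 * β := by gcongr
    nlinarith [sq_nonneg (β / 2 - c / 2)]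
  have hδ2 : |δ| ≤ r * ((1 + c) * (1 + β)) := by
    refine abs_le_of_sq_le_sq (hδ.trans ?_) (by positivity)
    have : c * β ≤ ((1 + c) * (1 + β)) ^ 2 := by
      have h1 : c * β ≤ (1 + c) * (1 + β) := by nlinarith
      have h2 : 1 ≤ (1 + c) * (1 + β) := by nlinarith [mul_nonneg hc hβ]
      nlinarith
    nlinarith [sq_nonneg r]
  have a1 := abs_le.1 hδ1
  have a0 := abs_le.1 hδ0
  have a2 := abs_le.1 hδ2
  have hcr : c * r ^ 2 ≤ c * r := by
    have : r ^ 2 ≤ r := by nlinarith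
    gcongr
  have hcr' : 0 ≤ c * r := by positivity
  have hNabs : |N| ≤ N + c := by
    rw [abs_le]; constructor <;> linarith
  set A := |N| with hA
  have hA0 : 0 ≤ A := abs_nonneg N
  have hA2 : A ^ 2 = N ^ 2 := sq_abs N
  set q := π - N ^ 2 with hq
  have hq0 : 0 ≤ q := sub_nonneg.2 hπ
  set L := (1 + c) * (2 + m + K) * (1 + A + β) with hL
  have hY1 : Y ≤ 2 * q + 2 * A ^ 2 + (m + K) * β := by
    have : K * r * β ≤ K * 1 * β := by gcongr
    have := (abs_le.1 hY).2
    rw [hA2]; linarith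
  have hY2 : 2 * q + 2 * N ^ 2 + m * β - K * r * β ≤ Y := by
    have := (abs_le.1 hY).1
    linarith
  have ht1 : |t| ≤ 2 * q + r * L := abs_le_of_sq_le hr.le hr1 hc hm hK hβ hq0 hA0 ht hY1
  refine ⟨by linarith, by linarith, by linarith, ?_⟩
  have hNw : |N * (w - (m + 2))| ≤ A * (K * r) := abs_mul_le_mul le_rfl hw
  have e1 := (abs_le.1 hNw).2
  have e2 := (abs_le.1 ht1).2
  have e3 : -(m * (r * ((1 + c) * (1 + β)))) ≤ m * δ := by
    rw [← mul_neg]; exact mul_le_mul_of_nonneg_left a2.1 hm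
  have e4 : 2 * N + Y - t - N * (2 * N + w) ≥
      m * δ - K * r * β - A * (K * r) - r * L := by
    have i1 : N * (2 * N + w) = 2 * N ^ 2 + N * (w - (m + 2)) + m * N + 2 * N := by ring
    have i2 : m * N = m * β - m * δ := by rw [hN]; ring
    linarith
  have e5 : 1 + A + β ≤ 3 * (N + (c + 1)) := by linarith
  have e6 : m * (r * ((1 + c) * (1 + β))) + K * r * β + A * (K * r) + r * L ≤
      ((1 + c) * (2 + m + K) + m * (1 + c) + 2 * K) * r * (1 + A + β) := by
    rw [hL]
    have i1 : 0 ≤ m * (r * (1 + c)) * A := by positivity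
    have i2 : 0 ≤ K * r * (2 + A + β) := by positivity
    nlinarith
  have e7 : ((1 + c) * (2 + m + K) + m * (1 + c) + 2 * K) * r * (1 + A + β) ≤
      ((1 + c) * (2 + m + K) + m * (1 + c) + 2 * K) * r * (3 * (N + (c + 1))) := by
    gcongr
  linarith

end Growth

section Frequency

variable {n : ℕ} {lam M R : ℝ} {S : Fin n → Fin n → Eu n → ℝ} {b : Fin n → Eu n → ℝ}
  {u : Eu n → ℝ}

/-- The height `r ^ (n - 2) ∫ u² ⟨S x, x⟩`, equal to `r ^ n` times the normalized height. -/
def height (S : Fin n → Fin n → Eu n → ℝ) (u : Eu n → ℝ) (r : ℝ) : ℝ :=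
  r ^ (n - 2) * sph (fun x => u x ^ 2 * quad S x) r

/-- The total energy in the ball of radius `r`. -/
def dirichlet (S : Fin n → Fin n → Eu n → ℝ) (u : Eu n → ℝ) (r : ℝ) : ℝ :=
  ∫ x in closedBall (0 : Eu n) r, energy S u x

/-- The work of the drift in the ball of radius `r`. -/
def work (b : Fin n → Eu n → ℝ) (u : Eu n → ℝ) (r : ℝ) : ℝ :=
  ∫ x in closedBall (0 : Eu n) r, u x * drift b u x

/-- The drift-corrected frequency. -/
def freqN (S : Fin n → Fin n → Eu n → ℝ) (b : Fin n → Eu n → ℝ) (u : Eu n → ℝ) (r : ℝ) : ℝ :=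
  r ^ 2 * (dirichlet S u r - work b u r) / height S u r

lemma Coef.height_nonneg (h : Coef n lam M S b) (u : Eu n → ℝ) {r : ℝ} (hr : 0 ≤ r) :
    0 ≤ height S u r :=
  mul_nonneg (by positivity) (sph_nonneg hr fun x _ => mul_nonneg (sq_nonneg _) (h.quad_nonneg x))

lemma Coef.dirichlet_nonneg (h : Coef n lam M S b) (u : Eu n → ℝ) (r : ℝ) :
    0 ≤ dirichlet S u r :=
  integral_nonneg fun x => h.energy_nonneg u x

lemma Coef.drift_sq_le (h : Coef n lam M S b) (u : Eu n → ℝ) (x : Eu n) :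
    drift b u x ^ 2 ≤ (n * M) ^ 2 * lam * energy S u x := by
  have h1 := h.abs_drift (u := u) x
  have h2 : drift b u x ^ 2 ≤ (n * (M * gradNorm u x)) ^ 2 := sq_le_sq' (by linarith [(abs_le.1 h1).1])
    (abs_le.1 h1).2
  have h3 := h.sum_sq_le_energy u x
  rw [← gradNorm_sq] at h3
  calc _ ≤ (n * M) ^ 2 * gradNorm u x ^ 2 := by linarith
    _ ≤ (n * M) ^ 2 * (lam * energy S u x) := by gcongr
    _ = _ := by ring

/-- Cauchy-Schwarz inequality for integrals over closed balls. -/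
lemma setIntegral_mul_sq_le {f g e : Eu n → ℝ} {C r : ℝ} (hf : Continuous f) (hg : Continuous g)
    (he : Continuous e) (h : ∀ x, g x ^ 2 ≤ C * e x) :
    (∫ x in closedBall (0 : Eu n) r, f x * g x) ^ 2 ≤
      C * (∫ x in closedBall (0 : Eu n) r, f x ^ 2) * ∫ x in closedBall (0 : Eu n) r, e x := by
  have int : ∀ {φ : Eu n → ℝ}, Continuous φ → IntegrableOn φ (closedBall (0 : Eu n) r) := fun hφ =>
    hφ.continuousOn.integrableOn_compact (isCompact_closedBall _ _)
  have key : ∀ t : ℝ, 0 ≤ (∫ x in closedBall (0 : Eu n) r, f x ^ 2) * (t * t)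
      + (2 * ∫ x in closedBall (0 : Eu n) r, f x * g x) * t
      + C * ∫ x in closedBall (0 : Eu n) r, e x := by
    intro t
    have i1 : IntegrableOn (fun x => f x ^ 2 * (t * t)) (closedBall (0 : Eu n) r) := int (by fun_prop)
    have i2 : IntegrableOn (fun x => 2 * (f x * g x) * t) (closedBall (0 : Eu n) r) :=
      int (by fun_prop)
    have i3 : IntegrableOn (fun x => C * e x) (closedBall (0 : Eu n) r) := int (by fun_prop)
    have : ∫ x in closedBall (0 : Eu n) r, (f x ^ 2 * (t * t) + 2 * (f x * g x) * t + C * e x) =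
        (∫ x in closedBall (0 : Eu n) r, f x ^ 2) * (t * t)
      + (2 * ∫ x in closedBall (0 : Eu n) r, f x * g x) * t
      + C * ∫ x in closedBall (0 : Eu n) r, e x := by
      have i12 : IntegrableOn (fun x => f x ^ 2 * (t * t) + 2 * (f x * g x) * t)
          (closedBall (0 : Eu n) r) := i1.add i2
      rw [integral_add i12 i3, integral_add i1 i2, integral_mul_const, integral_mul_const,
        integral_const_mul, integral_const_mul]
    rw [← this]
    refine integral_nonneg fun x => ?_
    have := h x
    have := sq_nonneg (f x * t + g x)
    simp only [Pi.zero_apply]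
    nlinarith
  have := discrim_le_zero key
  rw [discrim] at this
  nlinarith

lemma Coef.continuous_energy (h : Coef n lam M S b) (hu : ContDiff ℝ 2 u) :
    Continuous (energy S u) := (h.contDiff_energy hu).continuous

lemma Coef.continuous_drift (h : Coef n lam M S b) (hu : ContDiff ℝ 2 u) :
    Continuous (drift b u) := (h.contDiff_drift hu).continuous

lemma Coef.hasDerivAt_dirichlet_sub_work (h : Coef n lam M S b) (hn : 2 ≤ n) (hu : ContDiff ℝ 2 u)
    {r : ℝ} (hr : 0 < r) : HasDerivAt (fun s => dirichlet S u s - work b u s)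
      (r ^ (n - 1) * (sph (energy S u) r - sph (fun x => u x * drift b u x) r)) r := by
  have h1 := hasDerivAt_setIntegral_closedBall (by omega : 1 ≤ n) (h.continuous_energy hu) hr
  have h2 := hasDerivAt_setIntegral_closedBall (by omega : 1 ≤ n)
    (hu.continuous.mul (h.continuous_drift hu)) hr
  have h3 := h1.sub h2
  rw [← mul_sub] at h3
  exact h3

/-- The differential inequality for the frequency. -/
lemma exists_frequency (n : ℕ) (hn : 2 ≤ n) (lam M : ℝ) : ∃ C : ℝ, 1 ≤ C ∧
    ∀ (S : Fin n → Fin n → Eu n → ℝ) (b : Fin n → Eu n → ℝ) (u : Eu n → ℝ) (R : ℝ),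
      Coef n lam M S b → (∀ i j, S i j 0 = if i = j then 1 else 0) → Sol S b R u →
      ∀ r : ℝ, 0 < r → r ≤ 1 → r < R → 0 < height S u r →
      0 ≤ freqN S b u r + C * r ∧
      r ^ 2 * dirichlet S u r / height S u r ≤ 2 * freqN S b u r + C ∧
      freqN S b u r ≤ 2 * (r ^ 2 * dirichlet S u r / height S u r) + C ∧
      (∃ N', HasDerivAt (freqN S b u) N' r ∧ -(C * (freqN S b u r + C)) ≤ N') ∧
      ∃ g', HasDerivAt (fun s => Real.log (height S u s) - n * Real.log s) g' r ∧
        |r * g' - 2 * freqN S b u r| ≤ C * r := by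
  obtain ⟨K₁, hK₁, rel⟩ := exists_rellich_integrated n hn lam M
  obtain ⟨K₂, hK₂, poi⟩ := exists_integral_sq_le n hn lam M
  set K₃ : ℝ := |(n * (2 * n * M) + n * (n * (n * (n * M)))) * lam| with hK₃
  set K := K₁ + K₃ with hK
  set c : ℝ := (n * M) ^ 2 * |lam| * (K₂ + |lam|) with hc
  obtain ⟨m, rfl⟩ : ∃ m, n = m + 2 := ⟨n - 2, by omega⟩
  have hc0 : 0 ≤ c := by positivity
  have hK0 : 0 ≤ K := by positivity
  set C₃ : ℝ := 3 * ((1 + c) * (2 + m + K) + m * (1 + c) + 2 * K) with hC₃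
  have hC₃0 : 0 ≤ C₃ := by positivity
  refine ⟨1 + c + K + C₃, by linarith, ?_⟩
  intro S b u R h h0 hu r hr hr1 hrR hH
  have hu2 := hu.smooth
  have hl := h.lam_pos
  have i0 := hu.energy_identity h hn hr hrR
  have i1 := rel S b u R h h0 hu r hr hrR
  have i2 := poi S b u R h hu r hr hr1 hrR
  have i3 := h.abs_height_error h0 hn hu2 hr
  have i4 := h.hasDerivAt_height hn hu2 hr
  have i5 := h.hasDerivAt_dirichlet_sub_work hn hu2 hr
  have i6 := setIntegral_mul_sq_le (r := r) hu2.continuous (h.continuous_drift hu2)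
    (h.continuous_energy hu2) (h.drift_sq_le u)
  have i7 : sph (fun x => u x * drift b u x) r ^ 2 ≤ sph (fun x => u x ^ 2 * quad S x) r *
      (c / r ^ 2 * sph (energy S u) r) := by
    rw [← sph_const_mul]
    refine sph_mul_sq_le hr (hu2.continuous.pow 2 |>.mul h.contDiff_quad.continuous).continuousOn
      (continuous_const.mul (h.continuous_energy hu2)).continuousOn
      (hu2.continuous.mul (h.continuous_drift hu2)).continuousOn
      (fun x _ => mul_nonneg (sq_nonneg _) (h.quad_nonneg x))
      (fun x _ => mul_nonneg (by positivity) (h.energy_nonneg u x)) fun x hx => ?_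
    have a1 := h.drift_sq_le u x
    have a2 := h.norm_sq_le_quad x
    have a3 := h.energy_nonneg u x
    rw [hx] at a2
    have a4 : (((m + 2 : ℕ) : ℝ) * M) ^ 2 * lam * lam ≤ c := by
      have : (((m + 2 : ℕ) : ℝ) * M) ^ 2 * |lam| * |lam| ≤ c := by
        rw [hc]; gcongr; linarith
      rwa [abs_of_pos hl] at this
    have a5 : drift b u x ^ 2 ≤ quad S x * (c / r ^ 2 * energy S u x) := by
      rw [show quad S x * (c / r ^ 2 * energy S u x) = quad S x * c * energy S u x / r ^ 2 by ring,
        le_div_iff₀ (by positivity)]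
      calc _ ≤ (((m + 2 : ℕ) : ℝ) * M) ^ 2 * lam * energy S u x * (lam * quad S x) := by gcongr
        _ = (((m + 2 : ℕ) : ℝ) * M) ^ 2 * lam * lam * (quad S x * energy S u x) := by ring
        _ ≤ c * (quad S x * energy S u x) := by
          have := h.quad_nonneg x
          gcongr
        _ = _ := by ring
    calc _ = u x ^ 2 * drift b u x ^ 2 := by ring
      _ ≤ u x ^ 2 * (quad S x * (c / r ^ 2 * energy S u x)) := by gcongr
      _ = _ := by ring
  have i8 : sph (fun x => u x * conormal S u x) r ^ 2 ≤ sph (fun x => u x ^ 2 * quad S x) r *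
      sph (fun x => conormal S u x ^ 2 * (quad S x)⁻¹) r := by
    have q0 : ∀ x ∈ ({0} : Set (Eu (m + 2)))ᶜ, quad S x ≠ 0 := fun x hx => (h.quad_pos hx).ne'
    refine sph_mul_sq_le hr (hu2.continuous.pow 2 |>.mul h.contDiff_quad.continuous).continuousOn
      (((h.contDiff_conormal hu2).continuous.pow 2).continuousOn.mul
        (h.contDiff_quad.continuous.continuousOn.inv₀ q0))
      (hu2.continuous.mul (h.contDiff_conormal hu2).continuous).continuousOn
      (fun x _ => mul_nonneg (sq_nonneg _) (h.quad_nonneg x))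
      (fun x _ => mul_nonneg (sq_nonneg _) (inv_nonneg.2 (h.quad_nonneg x))) fun x hx => ?_
    have hx0 : x ≠ 0 := by rintro rfl; simp at hx; linarith
    have := (h.quad_pos hx0).ne'
    refine le_of_eq ?_
    field_simp
  have i9 : 0 ≤ sph (energy S u) r := sph_nonneg hr.le fun x _ => h.energy_nonneg u x
  have hE := h.dirichlet_nonneg u r
  have hk : 0 < sph (fun x => u x ^ 2 * quad S x) r := by
    by_contra hk
    exact hH.not_ge (mul_nonpos_of_nonneg_of_nonpos (by positivity) (not_lt.1 hk))
  simp only [show m + 2 - 2 = m by omega, show m + 2 - 1 = m + 1 by omega] at i0 i2 i4 i5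
  change _ ≤ _ * _ * dirichlet S u r at i6
  change work b u r ^ 2 ≤ _ at i6
  change HasDerivAt (height S u) _ r at i4
  change _ = dirichlet S u r - work b u r at i0
  change |_ - _ * dirichlet S u r| ≤ _ * dirichlet S u r at i1
  have hHk : height S u r = r ^ m * sph (fun x => u x ^ 2 * quad S x) r := rfl
  set k := sph (fun x => u x ^ 2 * quad S x) r with hkd
  set J := sph (fun x => u x * conormal S u x) r
  set p := sph (fun x => conormal S u x ^ 2 * (quad S x)⁻¹) r
  set sE := sph (energy S u) r
  set T := sph (fun x => u x * drift b u x) r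
  set W := sph (fun x => u x ^ 2 * ∑ i, pd i (rad S i) x) r
  set E := dirichlet S u r with hEd
  set d := work b u r with hdd
  set H := height S u r with hHd
  set I := ∫ x in closedBall (0 : Eu (m + 2)) r, u x ^ 2
  have hρ : 0 < r ^ m := by positivity
  have hNdef : freqN S b u r = r ^ 2 * (E - d) / H := rfl
  set N := freqN S b u r with hNd
  have hw : |r ^ 2 * W / k - (m + 2)| ≤ K * r := by
    have : r ^ 2 * W / k - (m + 2) = (r ^ 2 * W - ((m + 2 : ℕ) : ℝ) * k) / k := by
      push_cast; field_simp
    rw [this, abs_div, abs_of_pos hk, div_le_iff₀ hk]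
    refine i3.trans ?_
    have a5 := le_abs_self ((((m + 2 : ℕ) : ℝ) * (2 * (m + 2 : ℕ) * M)
      + (m + 2 : ℕ) * ((m + 2 : ℕ) * ((m + 2 : ℕ) * ((m + 2 : ℕ) * M)))) * lam)
    rw [← hK₃] at a5
    gcongr
    linarith
  have alg := frequency_algebra (r := r) (c := c) (m := m) (K := K) (β := r ^ 2 * E / H) (N := N)
    (δ := r ^ 2 * d / H) (Y := r ^ 2 * (r ^ (m + 2) * sE) / H) (π := r ^ 2 * (r ^ (m + 2) * p) / H)
    (t := r ^ 2 * (r ^ (m + 2) * T) / H) (w := r ^ 2 * W / k) hr hr1 hc0 (by positivity) hK0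
    (by positivity) (by rw [hNdef]; ring) ?_ ?_ ?_ ?_ hw
  · obtain ⟨a1, a2, a3, a4⟩ := alg
    have hEDJ : r ^ (m + 1) * (2 * J + W) = (2 * (r * (E - d)) + r ^ (m + 1) * W) := by
      rw [← i0]; ring
    have hc1 : c * r ≤ c * 1 := by gcongr
    have hCr : c * r ≤ (1 + c + K + C₃) * r := by gcongr; linarith
    have hNC : 0 ≤ N + c := by linarith
    have hNd' : HasDerivAt (freqN S b u) (((2 * r * (E - d) + r ^ 2 * (r ^ (m + 1) * (sE - T))) * H
        - r ^ 2 * (E - d) * (2 * (r * (E - d)) + r ^ (m + 1) * W)) / H ^ 2) r := by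
      rw [hEDJ] at i4
      have h2 : HasDerivAt (fun s : ℝ => s ^ 2) (2 * r) r := by simpa using hasDerivAt_pow 2 r
      exact (h2.mul i5).div i4 hH.ne'
    have hg' : HasDerivAt (fun s => Real.log (height S u s) - (m + 2 : ℕ) * Real.log s)
        ((2 * (r * (E - d)) + r ^ (m + 1) * W) / H - (m + 2 : ℕ) * r⁻¹) r := by
      rw [hEDJ] at i4
      exact (i4.log hH.ne').sub ((Real.hasDerivAt_log hr.ne').const_mul _)
    refine ⟨by linarith, by linarith, by linarith, ⟨_, hNd', ?_⟩, _, hg', ?_⟩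
    · rw [← mul_le_mul_iff_right₀ hr]
      refine le_trans ?_ (a4.trans (le_of_eq ?_))
      · have : r * (C₃ * (N + (c + 1))) ≤
            r * ((1 + c + K + C₃) * (N + (1 + c + K + C₃))) :=
          mul_le_mul_of_nonneg_left
            (mul_le_mul (by linarith) (by linarith) (by linarith) (by linarith)) hr.le
        linarith
      · rw [hNdef, hHk]
        field_simp
        ring
    · refine le_trans (le_of_eq ?_) (hw.trans ?_)
      · congr 1
        rw [hNdef, hHk]
        push_cast
        field_simp
        ring
      · gcongr; linarith
  · have e1 : d ^ 2 ≤ c * H * E := by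
      have : (((m + 2 : ℕ) : ℝ) * M) ^ 2 * lam * K₂ ≤ c := by
        rw [hc, ← abs_of_pos hl, abs_abs]; gcongr; linarith [abs_nonneg lam]
      calc d ^ 2 ≤ _ := i6
        _ ≤ (((m + 2 : ℕ) : ℝ) * M) ^ 2 * lam * (K₂ * H) * E := by
          rw [hHk]; gcongr
        _ = (((m + 2 : ℕ) : ℝ) * M) ^ 2 * lam * K₂ * H * E := by ring
        _ ≤ _ := by gcongr
    calc _ = r ^ 4 * d ^ 2 / H ^ 2 := by ring
      _ ≤ r ^ 4 * (c * H * E) / H ^ 2 := by gcongr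
      _ = _ := by field_simp
  · rw [hNdef, ← i0]
    calc _ = r ^ 4 * (r ^ m) ^ 2 * J ^ 2 / H ^ 2 := by ring
      _ ≤ r ^ 4 * (r ^ m) ^ 2 * (k * p) / H ^ 2 := by gcongr
      _ = _ := by rw [hHk]; field_simp; ring
  · push_cast at i1
    have e1 : r ^ 2 * (r ^ (m + 2) * sE) / H - 2 * (r ^ 2 * (r ^ (m + 2) * p) / H)
        - m * (r ^ 2 * E / H) =
        r ^ 2 / H * (r ^ (m + 2) * sE - 2 * (r ^ (m + 2) * p) - (m + 2 - 2) * E) := by ring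
    rw [e1, abs_mul, abs_of_pos (by positivity : 0 < r ^ 2 / H)]
    calc _ ≤ r ^ 2 / H * (K₁ * r * E) := by gcongr
      _ ≤ r ^ 2 / H * (K * r * E) := by
        have : 0 ≤ K₃ := abs_nonneg _
        gcongr; linarith
      _ = _ := by ring
  · calc _ = r ^ 4 * (r ^ (m + 2)) ^ 2 * T ^ 2 / H ^ 2 := by ring
      _ ≤ r ^ 4 * (r ^ (m + 2)) ^ 2 * (k * (c / r ^ 2 * sE)) / H ^ 2 := by gcongr
      _ = _ := by rw [hHk]; field_simp; ring

end Frequency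

section Doubling

lemma le_of_hasDerivAt_nonneg {f : ℝ → ℝ} {s t : ℝ} (hst : s ≤ t)
    (h : ∀ x ∈ Set.Icc s t, ∃ f', HasDerivAt f f' x ∧ 0 ≤ f') : f s ≤ f t := by
  have : MonotoneOn f (Set.Icc s t) := by
    refine monotoneOn_of_deriv_nonneg (convex_Icc s t) (fun x hx => ?_) (fun x hx => ?_)
      (fun x hx => ?_)
    · obtain ⟨f', hf, -⟩ := h x hx
      exact hf.continuousAt.continuousWithinAt
    · obtain ⟨f', hf, -⟩ := h x (interior_subset hx)
      exact hf.differentiableAt.differentiableWithinAt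
    · obtain ⟨f', hf, h0⟩ := h x (interior_subset hx)
      rwa [hf.deriv]
  exact this (Set.left_mem_Icc.2 hst) (Set.right_mem_Icc.2 hst) hst

/-- The logarithm of the normalized height. -/
def logHeight {n : ℕ} (S : Fin n → Fin n → Eu n → ℝ) (u : Eu n → ℝ) (r : ℝ) : ℝ :=
  Real.log (height S u r) - n * Real.log r

lemma Sol.height_pos {n : ℕ} {lam M R r : ℝ} {S : Fin n → Fin n → Eu n → ℝ}
    {b : Fin n → Eu n → ℝ} {u : Eu n → ℝ} (h : Coef n lam M S b) (hn : 2 ≤ n) (hu : Sol S b R u)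
    (hr : 0 < r) (hr1 : r ≤ 1) (hrR : r < R) (hne : ∃ x ∈ closedBall (0 : Eu n) r, u x ≠ 0) :
    0 < height S u r := by
  refine (h.height_nonneg u hr.le).lt_of_ne' fun h0 => ?_
  obtain ⟨K, hK, key⟩ := exists_integral_sq_le n hn lam M
  have h1 : ∫ x in closedBall (0 : Eu n) r, u x ^ 2 ≤ K * height S u r := key S b u R h hu r hr hr1 hrR
  rw [h0, mul_zero] at h1
  have hc := hu.smooth.continuous
  have h2 : ∫ x in closedBall (0 : Eu n) r, u x ^ 2 = 0 :=
    le_antisymm h1 (integral_nonneg fun x => sq_nonneg _)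
  rw [integral_eq_zero_iff_of_nonneg (fun x => sq_nonneg _)
    ((hc.pow 2).continuousOn.integrableOn_compact (isCompact_closedBall _ _))] at h2
  have h3 := Measure.eqOn_of_ae_eq h2 (hc.pow 2).continuousOn continuousOn_const
    (by rw [interior_closedBall _ hr.ne', closure_ball _ hr.ne'])
  obtain ⟨x, hx, hux⟩ := hne
  exact hux (pow_eq_zero_iff two_ne_zero |>.1 (h3 hx))

/-- Growth of the height in terms of the frequency. -/
lemma exists_growth (n : ℕ) (hn : 2 ≤ n) (lam M : ℝ) : ∃ C : ℝ, 1 ≤ C ∧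
    ∀ (S : Fin n → Fin n → Eu n → ℝ) (b : Fin n → Eu n → ℝ) (u : Eu n → ℝ) (R : ℝ),
      Coef n lam M S b → (∀ i j, S i j 0 = if i = j then 1 else 0) → Sol S b R u →
      ∀ s t : ℝ, 0 < s → s ≤ t → t ≤ 1 → t < R → (∀ x ∈ Set.Icc s t, 0 < height S u x) →
      0 ≤ freqN S b u s + C ∧
      s ^ 2 * dirichlet S u s / height S u s ≤ 2 * freqN S b u s + C ∧
      freqN S b u s ≤ 2 * (s ^ 2 * dirichlet S u s / height S u s) + C ∧
      freqN S b u s + C ≤ Real.exp C * (freqN S b u t + C) ∧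
      logHeight S u t - logHeight S u s ≤
        2 * (Real.exp C * (freqN S b u t + C)) * (Real.log t - Real.log s) + C ∧
      2 * (Real.exp (-C) * (freqN S b u s + C) - C) * (Real.log t - Real.log s) - C ≤
        logHeight S u t - logHeight S u s ∧
      logHeight S u s ≤ logHeight S u t + 3 * C := by
  obtain ⟨C, hC, key⟩ := exists_frequency n hn lam M
  refine ⟨C, hC, ?_⟩
  intro S b u R h h0 hu s t hs hst ht1 htR hpos
  have key' := fun x (hx : x ∈ Set.Icc s t) => key S b u R h h0 hu x (hs.trans_le hx.1)
    (hx.2.trans ht1) (hx.2.trans_lt htR) (hpos x hx)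
  have hnonneg : ∀ x ∈ Set.Icc s t, 0 ≤ freqN S b u x + C := fun x hx => by
    have := (key' x hx).1
    have : C * x ≤ C * 1 := by
      have := hx.2.trans ht1
      gcongr
    linarith
  have mono : ∀ x ∈ Set.Icc s t, ∀ y ∈ Set.Icc s t, x ≤ y →
      freqN S b u x + C ≤ Real.exp C * (freqN S b u y + C) := by
    intro x hx y hy hxy
    have h1 : Real.exp (C * x) * (freqN S b u x + C) ≤ Real.exp (C * y) * (freqN S b u y + C) := by
      refine le_of_hasDerivAt_nonneg (f := fun z => Real.exp (C * z) * (freqN S b u z + C)) hxy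
        fun z hz => ?_
      obtain ⟨N', hN', hle⟩ := (key' z ⟨hx.1.trans hz.1, hz.2.trans hy.2⟩).2.2.2.1
      have e1 : HasDerivAt (fun z => Real.exp (C * z)) (Real.exp (C * z) * C) z := by
        simpa using ((hasDerivAt_id z).const_mul C).exp
      refine ⟨_, e1.mul (hN'.add_const C), ?_⟩
      have : 0 ≤ Real.exp (C * z) * (C * (freqN S b u z + C) + N') :=
        mul_nonneg (Real.exp_pos _).le (by linarith)
      linarith
    have h2 : Real.exp (C * y) ≤ Real.exp C * Real.exp (C * x) := by
      rw [← Real.exp_add]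
      refine Real.exp_le_exp.2 ?_
      have := hy.2.trans ht1
      have := hs.trans_le hx.1
      nlinarith
    have h3 := mul_le_mul_of_nonneg_right h2 (hnonneg y hy)
    refine le_of_mul_le_mul_left (h1.trans (h3.trans (le_of_eq ?_))) (Real.exp_pos (C * x))
    ring
  have hsm : s ∈ Set.Icc s t := Set.left_mem_Icc.2 hst
  have htm : t ∈ Set.Icc s t := Set.right_mem_Icc.2 hst
  have hts : C * t - C * s ≤ C := by nlinarith
  have dlog : ∀ (B c : ℝ), ∀ x ∈ Set.Icc s t,
      HasDerivAt (fun x => B * Real.log x + c * x) (B * x⁻¹ + c) x := fun B c x hx => by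
    have := ((Real.hasDerivAt_log (hs.trans_le hx.1).ne').const_mul B).add
      ((hasDerivAt_id x).const_mul c)
    rw [mul_one] at this
    exact this
  have up : ∀ B : ℝ, (∀ x ∈ Set.Icc s t, freqN S b u x ≤ B) →
      logHeight S u t - logHeight S u s ≤ 2 * B * (Real.log t - Real.log s) + C := by
    intro B hB
    have h1 := le_of_hasDerivAt_nonneg
      (f := fun x => (2 * B * Real.log x + C * x) - logHeight S u x) hst fun x hx => ?_
    · linarith
    · obtain ⟨g', hg', hle⟩ := (key' x hx).2.2.2.2
      have hx0 := hs.trans_le hx.1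
      refine ⟨_, (dlog (2 * B) C x hx).sub hg', ?_⟩
      have h2 := (abs_le.1 hle).2
      have h3 := hB x hx
      rw [← mul_nonneg_iff_of_pos_left hx0]
      have : x * (2 * B * x⁻¹ + C - g') = 2 * B + C * x - x * g' := by field_simp
      linarith
  have low : ∀ B c : ℝ, (∀ x ∈ Set.Icc s t, B - c * x ≤ freqN S b u x) →
      2 * B * (Real.log t - Real.log s) - (C + 2 * c) * (t - s) ≤
        logHeight S u t - logHeight S u s := by
    intro B c hB
    have h1 := le_of_hasDerivAt_nonneg
      (f := fun x => logHeight S u x - (2 * B * Real.log x + -(C + 2 * c) * x)) hst fun x hx => ?_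
    · linarith
    · obtain ⟨g', hg', hle⟩ := (key' x hx).2.2.2.2
      have hx0 := hs.trans_le hx.1
      refine ⟨_, hg'.sub (dlog (2 * B) (-(C + 2 * c)) x hx), ?_⟩
      have h2 := (abs_le.1 hle).1
      have h3 := hB x hx
      rw [← mul_nonneg_iff_of_pos_left hx0]
      have : x * (g' - (2 * B * x⁻¹ + -(C + 2 * c))) = x * g' - 2 * B + (C + 2 * c) * x := by
        field_simp; ring
      linarith
  refine ⟨hnonneg s hsm, (key' s hsm).2.1, (key' s hsm).2.2.1, mono s hsm t htm hst,
    up _ fun x hx => ?_, ?_, ?_⟩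
  · linarith [mono x hx t htm hx.2]
  · have := low (Real.exp (-C) * (freqN S b u s + C) - C) 0 fun x hx => ?_
    · nlinarith
    · have h1 := mul_le_mul_of_nonneg_left (mono s hsm x hx hx.1) (Real.exp_pos (-C)).le
      rw [← mul_assoc, ← Real.exp_add] at h1
      simp at h1
      linarith
  · have := low 0 C fun x hx => by linarith [(key' x hx).1]
    nlinarith

end Doubling

section Center

variable {n : ℕ} {lam M R : ℝ} {S : Fin n → Fin n → Eu n → ℝ} {b : Fin n → Eu n → ℝ}
  {u : Eu n → ℝ}

lemma Coef.height_le (h : Coef n lam M S b) (hn : 2 ≤ n) (hu : Continuous u) {r : ℝ} (hr : 0 < r) :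
    height S u r ≤ lam * r ^ n * sph (fun x => u x ^ 2) r := by
  obtain ⟨m, rfl⟩ : ∃ m, n = m + 2 := ⟨n - 2, by omega⟩
  have : sph (fun x => u x ^ 2 * quad S x) r ≤ sph (fun x => lam * r ^ 2 * u x ^ 2) r := by
    refine sph_mono hr ((hu.pow 2).mul h.contDiff_quad.continuous).continuousOn
      (continuous_const.mul (hu.pow 2)).continuousOn fun x hx => ?_
    have := h.quad_le x
    rw [hx] at this
    nlinarith [sq_nonneg (u x)]
  rw [sph_const_mul] at this
  calc height S u r ≤ r ^ m * (lam * r ^ 2 * sph (fun x => u x ^ 2) r) := by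
        rw [height, show m + 2 - 2 = m by omega]; gcongr
    _ = _ := by ring

lemma Coef.le_height (h : Coef n lam M S b) (hn : 2 ≤ n) (hu : Continuous u) {r : ℝ} (hr : 0 < r) :
    r ^ n * sph (fun x => u x ^ 2) r ≤ lam * height S u r := by
  obtain ⟨m, rfl⟩ : ∃ m, n = m + 2 := ⟨n - 2, by omega⟩
  have : sph (fun x => r ^ 2 * u x ^ 2) r ≤ sph (fun x => lam * (u x ^ 2 * quad S x)) r := by
    refine sph_mono hr (continuous_const.mul (hu.pow 2)).continuousOn
      (continuous_const.mul ((hu.pow 2).mul h.contDiff_quad.continuous)).continuousOn fun x hx => ?_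
    have := h.norm_sq_le_quad x
    rw [hx] at this
    nlinarith [sq_nonneg (u x)]
  rw [sph_const_mul, sph_const_mul] at this
  calc _ = r ^ m * (r ^ 2 * sph (fun x => u x ^ 2) r) := by ring
    _ ≤ r ^ m * (lam * sph (fun x => u x ^ 2 * quad S x) r) := by gcongr
    _ = _ := by rw [height, show m + 2 - 2 = m by omega]; ring

lemma Coef.exp_logHeight (hr : 0 < R) (hH : 0 < height S u R) :
    Real.exp (logHeight S u R) * R ^ n = height S u R := by
  rw [logHeight, Real.exp_sub, Real.exp_log hH, mul_comm (n : ℝ), Real.exp_mul, Real.exp_log hr,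
    Real.rpow_natCast]
  field_simp

/-- Mean value inequality at the centre of a ball. -/
lemma exists_center_le (n : ℕ) (hn : 2 ≤ n) (lam M : ℝ) : ∃ K : ℝ, 0 ≤ K ∧
    ∀ (S : Fin n → Fin n → Eu n → ℝ) (b : Fin n → Eu n → ℝ) (u : Eu n → ℝ) (R : ℝ),
      Coef n lam M S b → (∀ i j, S i j 0 = if i = j then 1 else 0) → Sol S b R u →
      ∀ r : ℝ, 0 < r → r ≤ 1 → r < R →
      r ^ n * u 0 ^ 2 ≤ K * ∫ x in closedBall (0 : Eu n) r, u x ^ 2 := by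
  obtain ⟨C, hC, key⟩ := exists_growth n hn lam M
  set V := volume.real (ball (0 : Eu n) 1) with hV
  have hV0 : 0 < V := by
    rw [hV, measureReal_def]
    exact ENNReal.toReal_pos (measure_ball_pos _ _ one_pos).ne' measure_ball_lt_top.ne
  set K := lam ^ 2 * Real.exp (3 * C) with hK
  refine ⟨K / V, by positivity, ?_⟩
  intro S b u R h h0 hu r hr hr1 hrR
  have hc := hu.smooth.continuous
  have hl := h.lam_pos
  have hsph : ∀ s, 0 < s → s ≤ r → sph (fun _ : Eu n => u 0 ^ 2) s ≤ sph (fun x => K * u x ^ 2) s := by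
    intro s hs hsr
    rw [sph_const_mul]
    have hnn : 0 ≤ sph (fun x => u x ^ 2) s := sph_nonneg hs.le fun _ _ => sq_nonneg _
    by_cases hu0 : u 0 = 0
    · rw [hu0]
      have : sph (fun _ : Eu n => (0 : ℝ) ^ 2) s = 0 := by simp [sph]
      rw [this]; positivity
    have hpos : ∀ x, 0 < x → x ≤ r → 0 < height S u x := fun x hx hxr =>
      hu.height_pos h hn hx (hxr.trans hr1) (hxr.trans_lt hrR) ⟨0, by simp [hx.le], hu0⟩
    have e0 : sph (fun _ : Eu n => u 0 ^ 2) s = sph (fun x => u x ^ 2) 0 := by simp [sph]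
    rw [e0]
    have ht : Filter.Tendsto (sph (fun x => u x ^ 2)) (nhdsWithin 0 (Set.Ioi 0))
        (nhds (sph (fun x => u x ^ 2) 0)) :=
      (continuous_sph (hc.pow 2)).continuousAt.tendsto.mono_left nhdsWithin_le_nhds
    refine le_of_tendsto ht ?_
    filter_upwards [Ioo_mem_nhdsGT hs] with t ht
    have h1 := (key S b u R h h0 hu t s ht.1 ht.2.le (hsr.trans hr1) (hsr.trans_lt hrR)
      fun x hx => hpos x (ht.1.trans_le hx.1) (hx.2.trans hsr)).2.2.2.2.2.2
    have h2 := Real.exp_le_exp.2 h1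
    rw [Real.exp_add] at h2
    have h3 := h.le_height hn hc ht.1
    have h4 := h.height_le hn hc hs
    rw [← Coef.exp_logHeight ht.1 (hpos t ht.1 (ht.2.le.trans hsr))] at h3
    rw [← Coef.exp_logHeight hs (hpos s hs hsr)] at h4
    have h5 : Real.exp (logHeight S u s) ≤ lam * sph (fun x => u x ^ 2) s := by
      refine le_of_mul_le_mul_right ?_ (pow_pos hs n)
      linarith
    have h6 : sph (fun x => u x ^ 2) t ≤ lam * Real.exp (logHeight S u t) := by
      refine le_of_mul_le_mul_left ?_ (pow_pos ht.1 n)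
      linarith
    calc _ ≤ _ := h6
      _ ≤ lam * (lam * sph (fun x => u x ^ 2) s * Real.exp (3 * C)) := by
        gcongr
        exact h2.trans (by gcongr)
      _ = _ := by rw [hK]; ring
  have int : ∀ {φ : Eu n → ℝ}, Continuous φ → IntegrableOn φ (closedBall (0 : Eu n) r) := fun hφ =>
    hφ.continuousOn.integrableOn_compact (isCompact_closedBall _ _)
  have c1 : Continuous fun _ : Eu n => u 0 ^ 2 := continuous_const
  have c2 : Continuous fun x : Eu n => K * u x ^ 2 := continuous_const.mul (hc.pow 2)
  have h1 : ∫ x in closedBall (0 : Eu n) r, u 0 ^ 2 ≤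
      ∫ x in closedBall (0 : Eu n) r, K * u x ^ 2 := by
    rw [setIntegral_closedBall_eq (by omega) (int c1) hr.le,
      setIntegral_closedBall_eq (by omega) (int c2) hr.le]
    refine intervalIntegral.integral_mono_on_of_le_Ioo hr.le
      (((continuous_pow _).mul (continuous_sph c1)).intervalIntegrable _ _)
      (((continuous_pow _).mul (continuous_sph c2)).intervalIntegrable _ _) fun s hs => ?_
    have := hsph s hs.1 hs.2.le
    have := hs.1
    gcongr
  rw [integral_const_mul, setIntegral_const, smul_eq_mul] at h1
  have : volume.real (closedBall (0 : Eu n) r) = r ^ n * V := by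
    rw [Measure.addHaar_real_closedBall _ _ hr.le, finrank_euclideanSpace_fin]
  rw [this] at h1
  rw [div_mul_eq_mul_div, le_div_iff₀ hV0]
  linarith

end Center

section Affine

variable {n : ℕ} {lam M R : ℝ} {S : Fin n → Fin n → Eu n → ℝ} {b : Fin n → Eu n → ℝ}
  {u : Eu n → ℝ} {L G : Matrix (Fin n) (Fin n) ℝ} {x₀ : Eu n}

open scoped MatrixOrder Matrix.Norms.L2Operator in
lemma Matrix.PosSemidef.exists_eq_transpose_mul {A : Matrix (Fin n) (Fin n) ℝ}
    (hA : A.PosSemidef) : ∃ B : Matrix (Fin n) (Fin n) ℝ, A = B.transpose * B := by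
  obtain ⟨B, hB⟩ := CStarAlgebra.nonneg_iff_eq_star_mul_self.mp hA.nonneg
  exact ⟨B, by rw [hB, Matrix.star_eq_conjTranspose, Matrix.conjTranspose_eq_transpose_of_trivial]⟩

/-- The affine map `y ↦ x₀ + L y`. -/
def affMap (x₀ : Eu n) (L : Matrix (Fin n) (Fin n) ℝ) (y : Eu n) : Eu n :=
  x₀ + Matrix.toEuclideanLin L y

lemma affMap_zero : affMap x₀ L 0 = x₀ := by simp [affMap]

lemma hasFDerivAt_affMap (y : Eu n) :
    HasFDerivAt (affMap x₀ L) (LinearMap.toContinuousLinearMap (Matrix.toEuclideanLin L)) y :=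
  (LinearMap.toContinuousLinearMap (Matrix.toEuclideanLin L)).hasFDerivAt.const_add x₀

lemma contDiff_affMap {m : WithTop ℕ∞} : ContDiff ℝ m (affMap x₀ L) :=
  contDiff_const.add (LinearMap.toContinuousLinearMap (Matrix.toEuclideanLin L)).contDiff

lemma pd_comp_affMap (j : Fin n) {f : Eu n → ℝ} {y : Eu n}
    (hf : DifferentiableAt ℝ f (affMap x₀ L y)) :
    pd j (fun z => f (affMap x₀ L z)) y = ∑ k, L k j * pd k f (affMap x₀ L y) := by
  have h := (hf.hasFDerivAt.comp y (hasFDerivAt_affMap (x₀ := x₀) (L := L) y)).fderiv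
  have h2 : pd j (fun z => f (affMap x₀ L z)) y =
      fderiv ℝ f (affMap x₀ L y) (Matrix.toEuclideanLin L (EuclideanSpace.single j 1)) := by
    change fderiv ℝ (f ∘ affMap x₀ L) y _ = _
    rw [h]; rfl
  rw [h2, fderiv_eq_sum_pd]
  refine Finset.sum_congr rfl fun k _ => ?_
  congr 1
  simp [Matrix.mulVec, dotProduct, Pi.single_apply]

lemma sum_pd_comp_affMap (hLG : L * G = 1) {V : Fin n → Eu n → ℝ}
    (hV : ∀ k, Differentiable ℝ (V k)) (y : Eu n) :
    ∑ i, pd i (fun z => ∑ k, G i k * V k (affMap x₀ L z)) y = ∑ k, pd k (V k) (affMap x₀ L y) := by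
  have dV : ∀ k, DifferentiableAt ℝ (fun z => V k (affMap x₀ L z)) y := fun k =>
    ((hV k).comp (contDiff_affMap.differentiable one_ne_zero)) y
  have e : ∀ i, pd i (fun z => ∑ k, G i k * V k (affMap x₀ L z)) y =
      ∑ k, ∑ l, L l i * G i k * pd l (V k) (affMap x₀ L y) := by
    intro i
    rw [pd_sum i Finset.univ (F := fun k z => G i k * V k (affMap x₀ L z))
      (fun k _ => (dV k).const_mul _)]
    refine Finset.sum_congr rfl fun k _ => ?_
    rw [pd_const_mul i _ (dV k), pd_comp_affMap i (hV k _), Finset.mul_sum]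
    exact Finset.sum_congr rfl fun l _ => by ring
  simp only [e]
  rw [Finset.sum_comm]
  refine Finset.sum_congr rfl fun k _ => ?_
  rw [Finset.sum_comm]
  simp only [← Finset.sum_mul]
  have : ∀ l, ∑ i, L l i * G i k = if l = k then 1 else 0 := fun l => by
    rw [← Matrix.mul_apply, hLG, Matrix.one_apply]
  simp [this]

/-- The coefficients `G S Gᵀ` in the new coordinates. -/
def affCoef (x₀ : Eu n) (L G : Matrix (Fin n) (Fin n) ℝ) (S : Fin n → Fin n → Eu n → ℝ)
    (i j : Fin n) (y : Eu n) : ℝ :=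
  ∑ k, G i k * ∑ l, S k l (affMap x₀ L y) * G j l

/-- The drift `G b` in the new coordinates. -/
def affDrift (x₀ : Eu n) (L G : Matrix (Fin n) (Fin n) ℝ) (b : Fin n → Eu n → ℝ)
    (i : Fin n) (y : Eu n) : ℝ :=
  ∑ k, G i k * b k (affMap x₀ L y)

lemma cograd_affCoef (hLG : L * G = 1) (hu : Differentiable ℝ u) (i : Fin n) (y : Eu n) :
    cograd (affCoef x₀ L G S) (fun z => u (affMap x₀ L z)) i y =
      ∑ k, G i k * cograd S u k (affMap x₀ L y) := by
  have e : ∀ l m, ∑ j, L m j * G j l = if m = l then 1 else 0 := fun l m => by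
    rw [← Matrix.mul_apply, hLG, Matrix.one_apply]
  simp only [cograd, affCoef, pd_comp_affMap _ (hu _)]
  calc _ = ∑ j, ∑ k, ∑ l, ∑ m, G i k * (S k l (affMap x₀ L y) * pd m u (affMap x₀ L y) *
        (L m j * G j l)) := by
        refine Finset.sum_congr rfl fun j _ => ?_
        rw [Finset.sum_mul]
        refine Finset.sum_congr rfl fun k _ => ?_
        simp only [Finset.mul_sum, Finset.sum_mul]
        refine Finset.sum_comm.trans ?_
        refine Finset.sum_congr rfl fun l _ => Finset.sum_congr rfl fun m _ => by ring
    _ = _ := by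
        rw [Finset.sum_comm]
        refine Finset.sum_congr rfl fun k _ => ?_
        rw [Finset.sum_comm, Finset.mul_sum]
        refine Finset.sum_congr rfl fun l _ => ?_
        rw [Finset.sum_comm]
        simp only [← Finset.mul_sum, e]
        simp

lemma drift_affDrift (hLG : L * G = 1) (hu : Differentiable ℝ u) (y : Eu n) :
    drift (affDrift x₀ L G b) (fun z => u (affMap x₀ L z)) y = drift b u (affMap x₀ L y) := by
  have e : ∀ l m, ∑ j, L m j * G j l = if m = l then 1 else 0 := fun l m => by
    rw [← Matrix.mul_apply, hLG, Matrix.one_apply]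
  simp only [drift, affDrift, pd_comp_affMap _ (hu _)]
  calc _ = ∑ j, ∑ k, ∑ m, b k (affMap x₀ L y) * pd m u (affMap x₀ L y) * (L m j * G j k) := by
        refine Finset.sum_congr rfl fun j _ => ?_
        rw [Finset.sum_mul]
        refine Finset.sum_congr rfl fun k _ => ?_
        rw [Finset.mul_sum]
        exact Finset.sum_congr rfl fun m _ => by ring
    _ = _ := by
        rw [Finset.sum_comm]
        refine Finset.sum_congr rfl fun k _ => ?_
        rw [Finset.sum_comm]
        simp only [← Finset.mul_sum, e]
        simp

lemma Sol.comp_affMap (h : Coef n lam M S b) (hu : Sol S b R u) (hLG : L * G = 1) {ρ : ℝ}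
    (hρ : ∀ y, ‖y‖ < ρ → ‖affMap x₀ L y‖ < R) :
    Sol (affCoef x₀ L G S) (affDrift x₀ L G b) ρ (fun z => u (affMap x₀ L z)) where
  smooth := hu.smooth.comp contDiff_affMap
  eqn y hy := by
    have hd : Differentiable ℝ u := hu.smooth.differentiable two_ne_zero
    have e : ∀ i, cograd (affCoef x₀ L G S) (fun z => u (affMap x₀ L z)) i =
        fun y => ∑ k, G i k * cograd S u k (affMap x₀ L y) := fun i =>
      funext fun y => cograd_affCoef hLG hd i y
    simp only [e]
    rw [sum_pd_comp_affMap hLG (fun k => (h.contDiff_cograd hu.smooth k).differentiable one_ne_zero),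
      drift_affDrift hLG hd]
    exact hu.eqn _ (hρ y hy)

/-- Transposed action `v ↦ Gᵀ v`. -/
def tmul (G : Matrix (Fin n) (Fin n) ℝ) (v : Fin n → ℝ) (k : Fin n) : ℝ := ∑ i, v i * G i k

lemma sum_mul_affCoef (y : Eu n) (v : Fin n → ℝ) :
    ∑ i, v i * ∑ j, affCoef x₀ L G S i j y * v j =
      ∑ k, tmul G v k * ∑ l, S k l (affMap x₀ L y) * tmul G v l := by
  simp only [affCoef, tmul]
  calc _ = ∑ i, ∑ j, ∑ k, ∑ l, v i * (G i k * (S k l (affMap x₀ L y) * G j l) * v j) := by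
        refine Finset.sum_congr rfl fun i _ => ?_
        rw [Finset.mul_sum]
        refine Finset.sum_congr rfl fun j _ => ?_
        rw [Finset.sum_mul, Finset.mul_sum]
        refine Finset.sum_congr rfl fun k _ => ?_
        rw [Finset.mul_sum, Finset.sum_mul, Finset.mul_sum]
    _ = ∑ k, ∑ i, ∑ l, ∑ j, v i * (G i k * (S k l (affMap x₀ L y) * G j l) * v j) := by
        rw [Finset.sum_comm (s := Finset.univ (α := Fin n)) (t := Finset.univ (α := Fin n))
          (f := fun k i => ∑ l, ∑ j, v i * (G i k * (S k l (affMap x₀ L y) * G j l) * v j))]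
        refine Finset.sum_congr rfl fun i _ => ?_
        rw [Finset.sum_comm]
        refine Finset.sum_congr rfl fun k _ => ?_
        rw [Finset.sum_comm]
    _ = _ := by
        refine Finset.sum_congr rfl fun k _ => ?_
        rw [Finset.sum_mul]
        refine Finset.sum_congr rfl fun i _ => ?_
        rw [Finset.mul_sum]
        refine Finset.sum_congr rfl fun l _ => ?_
        rw [Finset.mul_sum, Finset.mul_sum]
        exact Finset.sum_congr rfl fun j _ => by ring

end Affine

section Normalization

variable {n : ℕ} {lam M R : ℝ} {S : Fin n → Fin n → Eu n → ℝ} {b : Fin n → Eu n → ℝ}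
  {u : Eu n → ℝ} {L G : Matrix (Fin n) (Fin n) ℝ} {x₀ : Eu n}

lemma tmul_eq_vecMul (G : Matrix (Fin n) (Fin n) ℝ) (v : Fin n → ℝ) :
    tmul G v = Matrix.vecMul v G := rfl

lemma tmul_tmul (hGL : G * L = 1) (v : Fin n → ℝ) : tmul L (tmul G v) = v := by
  rw [tmul_eq_vecMul, tmul_eq_vecMul, Matrix.vecMul_vecMul, hGL, Matrix.vecMul_one]

/-- A linear change of coordinates which makes the coefficients equal to the identity at `x₀`. -/
structure Normalizes (lam : ℝ) (S : Fin n → Fin n → Eu n → ℝ) (x₀ : Eu n)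
    (L G : Matrix (Fin n) (Fin n) ℝ) : Prop where
  mul_inv : L * G = 1
  inv_mul : G * L = 1
  eq : ∀ i j, S i j x₀ = ∑ k, L i k * L j k

lemma Coef.exists_normalizes (h : Coef n lam M S b) (x₀ : Eu n) :
    ∃ L G, Normalizes lam S x₀ L G := by
  set S0 : Matrix (Fin n) (Fin n) ℝ := Matrix.of fun i j => S i j x₀ with hS0
  have hpos : S0.PosDef := by
    refine Matrix.PosDef.of_dotProduct_mulVec_pos ?_ ?_
    · ext i j
      simp [hS0, Matrix.conjTranspose_apply, h.symm j i]
    · intro v hv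
      have h1 := h.lower x₀ v
      have h2 : 0 < ∑ i, v i ^ 2 := by
        obtain ⟨i, hi⟩ := Function.ne_iff.mp hv
        exact Finset.sum_pos' (fun i _ => sq_nonneg _) ⟨i, Finset.mem_univ _, by
          have : v i ≠ 0 := hi
          positivity⟩
      have h3 : 0 < lam * ∑ i, v i * ∑ j, S i j x₀ * v j := h2.trans_le h1
      have := (mul_pos_iff_of_pos_left h.lam_pos).mp h3
      simpa [dotProduct, Matrix.mulVec, hS0] using this
  obtain ⟨B, hB⟩ := hpos.posSemidef.exists_eq_transpose_mul
  have hdet : B.transpose.det ≠ 0 := by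
    intro h0
    have := hpos.det_pos
    rw [hB, Matrix.det_mul, h0, zero_mul] at this
    exact lt_irrefl _ this
  have hu : IsUnit B.transpose.det := isUnit_iff_ne_zero.mpr hdet
  refine ⟨B.transpose, B.transpose⁻¹, Matrix.mul_nonsing_inv _ hu, Matrix.nonsing_inv_mul _ hu, ?_⟩
  intro i j
  have : S0 i j = (B.transpose * B) i j := by rw [hB]
  rw [Matrix.mul_apply] at this
  simpa [hS0] using this

lemma Normalizes.sum_sq (hN : Normalizes lam S x₀ L G) (v : Fin n → ℝ) :
    ∑ k, tmul L v k ^ 2 = ∑ i, v i * ∑ j, S i j x₀ * v j := by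
  simp only [hN.eq, tmul]
  calc _ = ∑ k, ∑ i, ∑ j, v i * (L i k * L j k * v j) := by
        refine Finset.sum_congr rfl fun k _ => ?_
        rw [sq, Finset.sum_mul_sum]
        exact Finset.sum_congr rfl fun i _ => Finset.sum_congr rfl fun j _ => by ring
    _ = _ := by
        rw [Finset.sum_comm]
        refine Finset.sum_congr rfl fun i _ => ?_
        rw [Finset.sum_comm, Finset.mul_sum]
        refine Finset.sum_congr rfl fun j _ => ?_
        rw [Finset.sum_mul, Finset.mul_sum]

lemma Normalizes.sum_sq_le (h : Coef n lam M S b) (hN : Normalizes lam S x₀ L G) (v : Fin n → ℝ) :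
    ∑ k, tmul L v k ^ 2 ≤ lam * ∑ k, v k ^ 2 := by
  rw [hN.sum_sq]; exact h.upper x₀ v

lemma Normalizes.inv_sum_sq_le (h : Coef n lam M S b) (hN : Normalizes lam S x₀ L G)
    (v : Fin n → ℝ) : ∑ k, tmul G v k ^ 2 ≤ lam * ∑ k, v k ^ 2 := by
  have h1 := h.lower x₀ (tmul G v)
  rw [← hN.sum_sq, tmul_tmul hN.inv_mul] at h1
  exact h1

lemma Normalizes.le_inv_sum_sq (h : Coef n lam M S b) (hN : Normalizes lam S x₀ L G)
    (v : Fin n → ℝ) : ∑ k, v k ^ 2 ≤ lam * ∑ k, tmul G v k ^ 2 := by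
  have h1 := hN.sum_sq_le h (tmul G v)
  rwa [tmul_tmul hN.inv_mul] at h1

lemma abs_entry_le_of_sum_sq_le (h1 : 1 ≤ lam)
    (hL : ∀ v : Fin n → ℝ, ∑ k, tmul L v k ^ 2 ≤ lam * ∑ k, v k ^ 2) (i k : Fin n) :
    |L i k| ≤ lam := by
  have h2 := hL (Pi.single i 1)
  have h3 : ∀ k, tmul L (Pi.single i 1) k = L i k := fun k => by
    simp [tmul_eq_vecMul]
  simp only [h3] at h2
  have h4 : ∑ k, (Pi.single i 1 : Fin n → ℝ) k ^ 2 = 1 := by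
    simp [Pi.single_apply]
  rw [h4] at h2
  have h5 : L i k ^ 2 ≤ ∑ k, L i k ^ 2 :=
    Finset.single_le_sum (f := fun k => L i k ^ 2) (fun _ _ => sq_nonneg _) (Finset.mem_univ k)
  refine abs_le_of_sq_le_sq (by nlinarith) (by linarith)

lemma Normalizes.abs_le (h : Coef n lam M S b) (hN : Normalizes lam S x₀ L G) (i k : Fin n) :
    |L i k| ≤ lam := abs_entry_le_of_sum_sq_le h.one_le (hN.sum_sq_le h) i k

lemma Normalizes.abs_inv_le (h : Coef n lam M S b) (hN : Normalizes lam S x₀ L G) (i k : Fin n) :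
    |G i k| ≤ lam := abs_entry_le_of_sum_sq_le h.one_le (hN.inv_sum_sq_le h) i k

lemma Normalizes.affCoef_zero (hN : Normalizes lam S x₀ L G) (i j : Fin n) :
    affCoef x₀ L G S i j 0 = if i = j then 1 else 0 := by
  have e : ∀ i m, ∑ k, G i k * L k m = if i = m then 1 else 0 := fun l m => by
    rw [← Matrix.mul_apply, hN.inv_mul, Matrix.one_apply]
  simp only [affCoef, affMap_zero, hN.eq]
  calc _ = ∑ k, ∑ l, ∑ m, G i k * L k m * (G j l * L l m) := by
        refine Finset.sum_congr rfl fun k _ => ?_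
        rw [Finset.mul_sum]
        refine Finset.sum_congr rfl fun l _ => ?_
        rw [Finset.sum_mul, Finset.mul_sum]
        exact Finset.sum_congr rfl fun m _ => by ring
    _ = ∑ m, (∑ k, G i k * L k m) * ∑ l, G j l * L l m := by
        simp only [Finset.sum_mul_sum]
        rw [Finset.sum_comm]
        refine (Finset.sum_congr rfl fun k _ => Finset.sum_comm).trans ?_
        rw [Finset.sum_comm]
        refine (Finset.sum_congr rfl fun k _ => Finset.sum_comm)
    _ = _ := by
        simp only [e]
        simp

lemma Normalizes.coef (h : Coef n lam M S b) (hn : 1 ≤ n) (hN : Normalizes lam S x₀ L G) :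
    Coef n (lam ^ 2) (n ^ 3 * lam ^ 3 * M) (affCoef x₀ L G S) (affDrift x₀ L G b) := by
  have hl := h.one_le
  have hM := h.M_nonneg hn
  have hn' : (1 : ℝ) ≤ n := by exact_mod_cast hn
  have hp : lam * (lam * M) ≤ lam ^ 3 * M := by
    have : 0 ≤ lam ^ 2 * M := by positivity
    nlinarith
  have hG := hN.abs_inv_le h
  have hL := hN.abs_le h
  have dS : ∀ k l, Differentiable ℝ (fun z => S k l (affMap x₀ L z)) := fun k l =>
    ((h.smooth k l).differentiable one_ne_zero).comp (contDiff_affMap.differentiable one_ne_zero)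
  have smul : ∀ {x y X Y : ℝ}, |x| ≤ X → |y| ≤ Y → |x * y| ≤ X * Y := fun hx hy => by
    rw [abs_mul]
    exact mul_le_mul hx hy (abs_nonneg _) ((abs_nonneg _).trans hx)
  refine ⟨one_le_pow₀ hl, ?_, ?_, ?_, ?_, ?_, ?_, ?_, ?_, ?_⟩
  · intro i j
    exact ContDiff.sum fun k _ => contDiff_const.mul (ContDiff.sum fun l _ =>
      ((h.smooth k l).comp contDiff_affMap).mul contDiff_const)
  · intro i
    exact ContDiff.sum fun k _ => contDiff_const.mul ((h.smooth_drift k).comp contDiff_affMap)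
  · intro i j
    funext y
    simp only [affCoef, Finset.mul_sum]
    rw [Finset.sum_comm]
    refine Finset.sum_congr rfl fun k _ => Finset.sum_congr rfl fun l _ => ?_
    rw [h.symm l k]; ring
  · intro y v
    rw [sum_mul_affCoef]
    have h1 := hN.le_inv_sum_sq h v
    have h2 := h.lower (affMap x₀ L y) (tmul G v)
    nlinarith [mul_le_mul_of_nonneg_left h2 h.lam_pos.le]
  · intro y v
    rw [sum_mul_affCoef]
    have h1 := hN.inv_sum_sq_le h v
    have h2 := h.upper (affMap x₀ L y) (tmul G v)
    nlinarith [mul_le_mul_of_nonneg_left h1 h.lam_pos.le]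
  · intro i j y
    have : |affCoef x₀ L G S i j y| ≤ n * (lam * (n * (M * lam))) :=
      abs_sum_le_card fun k => smul (hG i k) (abs_sum_le_card fun l =>
        smul (h.bound k l _) (hG j l))
    have h3 : (n : ℝ) ^ 2 ≤ n ^ 3 := pow_le_pow_right₀ hn' (by norm_num)
    calc _ ≤ _ := this
      _ = n ^ 2 * (lam * (lam * M)) := by ring
      _ ≤ n ^ 3 * (lam ^ 3 * M) := mul_le_mul h3 hp (by positivity) (by positivity)
      _ = _ := by ring
  · intro m i j y
    have dS' : ∀ k, Differentiable ℝ (fun y => ∑ l, S k l (affMap x₀ L y) * G j l) := fun k =>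
      Differentiable.fun_sum fun l _ => (dS k l).mul_const _
    have e : pd m (affCoef x₀ L G S i j) y =
        ∑ k, G i k * ∑ l, G j l * ∑ q, L q m * pd q (S k l) (affMap x₀ L y) := by
      unfold affCoef
      rw [pd_sum m Finset.univ (F := fun k y => G i k * ∑ l, S k l (affMap x₀ L y) * G j l)
        (fun k _ => (dS' k y).const_mul _)]
      refine Finset.sum_congr rfl fun k _ => ?_
      rw [pd_const_mul m (f := fun y => ∑ l, S k l (affMap x₀ L y) * G j l) _ (dS' k y),
        pd_sum m Finset.univ (F := fun l y => S k l (affMap x₀ L y) * G j l)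
        (fun l _ => (dS k l y).mul_const _)]
      congr 1
      refine Finset.sum_congr rfl fun l _ => ?_
      simp only [mul_comm _ (G j l)]
      rw [pd_const_mul m (f := fun y => S k l (affMap x₀ L y)) _ (dS k l y),
        pd_comp_affMap m ((h.smooth k l).differentiable one_ne_zero _)]
    rw [e]
    have : |∑ k, G i k * ∑ l, G j l * ∑ q, L q m * pd q (S k l) (affMap x₀ L y)| ≤
        n * (lam * (n * (lam * (n * (lam * M))))) :=
      abs_sum_le_card fun k => smul (hG i k) (abs_sum_le_card fun l =>
        smul (hG j l) (abs_sum_le_card fun q => smul (hL q m) (h.bound_pd q k l _)))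
    exact this.trans (le_of_eq (by ring))
  · intro i y
    have : |affDrift x₀ L G b i y| ≤ n * (lam * M) :=
      abs_sum_le_card fun k => smul (hG i k) (h.bound_drift k _)
    have h3 : (n : ℝ) ≤ n ^ 3 := by
      simpa using pow_le_pow_right₀ hn' (show 1 ≤ 3 by norm_num)
    have h4 : lam * M ≤ lam ^ 3 * M := by
      have : lam ≤ lam ^ 3 := by simpa using pow_le_pow_right₀ hl (show 1 ≤ 3 by norm_num)
      gcongr
    calc _ ≤ _ := this
      _ ≤ n ^ 3 * (lam ^ 3 * M) := mul_le_mul h3 h4 (by positivity [h.lam_pos]) (by positivity)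
      _ = _ := by ring
  · intro y
    have := sum_pd_comp_affMap (x₀ := x₀) hN.mul_inv
      (fun k => (h.smooth_drift k).differentiable one_ne_zero) y
    rw [← h.div_drift (affMap x₀ L y), ← this]
    rfl

lemma norm_toEuclideanLin_le (hL : ∀ i k, |L i k| ≤ lam) (y : Eu n) :
    ‖Matrix.toEuclideanLin L y‖ ≤ n ^ 2 * lam * ‖y‖ := by
  rcases Nat.eq_zero_or_pos n with rfl | hn
  · simp [Subsingleton.elim y 0]
  have hl : 0 ≤ lam := (abs_nonneg _).trans (hL ⟨0, hn⟩ ⟨0, hn⟩)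
  have hn' : (1 : ℝ) ≤ n := by exact_mod_cast hn
  have h1 : ∀ i, |Matrix.toEuclideanLin L y i| ≤ n * (lam * ‖y‖) := fun i => by
    have : Matrix.toEuclideanLin L y i = ∑ k, L i k * y k := by
      simp [Matrix.mulVec, dotProduct]
    rw [this]
    refine abs_sum_le_card fun k => ?_
    rw [abs_mul]
    exact mul_le_mul (hL i k) (abs_coord_le y k) (abs_nonneg _) hl
  refine abs_le_of_sq_le_sq' ?_ (by positivity) |>.2
  rw [norm_sq_eq_sum]
  calc _ ≤ ∑ i : Fin n, (n * (lam * ‖y‖)) ^ 2 := Finset.sum_le_sum fun i _ => by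
        rw [← sq_abs]
        exact pow_le_pow_left₀ (abs_nonneg _) (h1 i) 2
    _ = n ^ 3 * (lam * ‖y‖) ^ 2 := by simp; ring
    _ ≤ n ^ 4 * (lam * ‖y‖) ^ 2 := by
        have : (n : ℝ) ^ 3 ≤ n ^ 4 := pow_le_pow_right₀ hn' (by norm_num)
        gcongr
    _ = _ := by ring

end Normalization

section Pointwise

variable {n : ℕ} {lam M R : ℝ} {S : Fin n → Fin n → Eu n → ℝ} {b : Fin n → Eu n → ℝ}
  {u : Eu n → ℝ} {L G : Matrix (Fin n) (Fin n) ℝ} {x₀ : Eu n}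

lemma abs_det_le_of_abs_le (hG : ∀ i k, |G i k| ≤ lam) :
    |G.det| ≤ n.factorial * lam ^ n := by
  have := Matrix.det_le (A := G) (abv := AbsoluteValue.abs) (x := lam) hG
  simpa using this

lemma setIntegral_comp_affMap_le (hGL : G * L = 1) {f : Eu n → ℝ} {ρ s D : ℝ}
    (hD : |G.det| ≤ D) (hf : Continuous f) (h0 : ∀ x, 0 ≤ f x)
    (hs : ∀ y, ‖y‖ ≤ ρ → ‖affMap x₀ L y‖ ≤ s) :
    ∫ y in closedBall 0 ρ, f (affMap x₀ L y) ≤ D * ∫ x in closedBall 0 s, f x := by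
  have hinj : Set.InjOn (affMap x₀ L) (closedBall 0 ρ) := by
    intro y _ z _ hyz
    have h1 : Matrix.toEuclideanLin L y = Matrix.toEuclideanLin L z := add_left_cancel hyz
    have h2 : ∀ y, Matrix.toEuclideanLin G (Matrix.toEuclideanLin L y) = y := fun y => by
      simp [Matrix.toLpLin_apply, Matrix.mulVec_mulVec, hGL]
    rw [← h2 y, h1, h2]
  have key := integral_image_eq_integral_abs_det_fderiv_smul volume
    (measurableSet_closedBall (x := (0 : Eu n)) (ε := ρ))
    (fun y _ => (hasFDerivAt_affMap (x₀ := x₀) (L := L) y).hasFDerivWithinAt) hinj f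
  have hdet : (LinearMap.toContinuousLinearMap (Matrix.toEuclideanLin L)).det = L.det := by
    rw [ContinuousLinearMap.det]
    simp only [LinearMap.coe_toContinuousLinearMap]
    rw [Matrix.toEuclideanLin_eq_toLin_orthonormal]; simp
  rw [hdet, integral_smul, smul_eq_mul] at key
  have hd : |G.det| * |L.det| = 1 := by
    rw [← abs_mul, ← Matrix.det_mul, hGL]; simp
  have hsub : affMap x₀ L '' closedBall 0 ρ ⊆ closedBall 0 s := by
    rintro _ ⟨y, hy, rfl⟩
    simpa using hs y (by simpa using hy)
  have hle : ∫ x in affMap x₀ L '' closedBall 0 ρ, f x ≤ ∫ x in closedBall 0 s, f x :=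
    setIntegral_mono_set (hf.continuousOn.integrableOn_compact (isCompact_closedBall 0 s))
      (Filter.Eventually.of_forall h0) hsub.eventuallyLE
  have hpos : 0 ≤ ∫ x in closedBall 0 s, f x := setIntegral_nonneg measurableSet_closedBall
    fun x _ => h0 x
  calc _ = |G.det| * (|L.det| * ∫ y in closedBall 0 ρ, f (affMap x₀ L y)) := by
        rw [← mul_assoc, hd, one_mul]
    _ ≤ |G.det| * ∫ x in closedBall 0 s, f x := by
        rw [← key]; gcongr
    _ ≤ _ := by gcongr

lemma exists_pointwise_le (n : ℕ) (hn : 2 ≤ n) (lam M : ℝ) : ∃ K : ℝ, 0 ≤ K ∧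
    ∀ (S : Fin n → Fin n → Eu n → ℝ) (b : Fin n → Eu n → ℝ) (u : Eu n → ℝ) (R : ℝ),
      Coef n lam M S b → (∀ i j, S i j 0 = if i = j then 1 else 0) → Sol S b R u →
      ∀ s : ℝ, 0 < s → s ≤ 1 → s < R → ∀ x : Eu n, ‖x‖ ≤ 2 * s / 3 →
      s ^ n * u x ^ 2 ≤ K * height S u s := by
  obtain ⟨K₁, hK₁, H₁⟩ := exists_center_le n hn (lam ^ 2) (n ^ 3 * lam ^ 3 * M)
  obtain ⟨K₂, hK₂, H₂⟩ := exists_integral_sq_le n hn lam M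
  refine ⟨|(4 * (n ^ 2 * lam)) ^ n * (K₁ * (n.factorial * lam ^ n * K₂))|, abs_nonneg _, ?_⟩
  intro S b u R h h0 hu s hs hs1 hsR x hx
  have hl := h.one_le
  have hn' : (1 : ℝ) ≤ n := by exact_mod_cast (by omega : 1 ≤ n)
  set c : ℝ := n ^ 2 * lam with hc
  have hc1 : 1 ≤ c := one_le_mul_of_one_le_of_one_le (one_le_pow₀ hn') hl
  have hc0 : 0 < c := by linarith
  obtain ⟨L, G, hN⟩ := h.exists_normalizes x
  have hL : ∀ y, ‖affMap x L y‖ ≤ 2 * s / 3 + c * ‖y‖ := fun y =>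
    (norm_add_le _ _).trans (add_le_add hx (norm_toEuclideanLin_le (hN.abs_le h) y))
  have hsol : Sol (affCoef x L G S) (affDrift x L G b) (s / (3 * c)) (fun z => u (affMap x L z)) := by
    refine hu.comp_affMap h hN.mul_inv fun y hy => (hL y).trans_lt ?_
    have : c * ‖y‖ < c * (s / (3 * c)) := by gcongr
    have e : c * (s / (3 * c)) = s / 3 := by field_simp
    linarith
  have hρ : s / (4 * c) ≤ 1 := by
    rw [div_le_one (by positivity)]; linarith
  have hρ2 : s / (4 * c) < s / (3 * c) := by gcongr; norm_num
  have h1 := H₁ _ _ _ _ (hN.coef h (by omega)) hN.affCoef_zero hsol (s / (4 * c)) (by positivity)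
    hρ hρ2
  have h2 := setIntegral_comp_affMap_le (x₀ := x) hN.inv_mul (f := fun z => u z ^ 2)
    (ρ := s / (4 * c)) (s := s) (abs_det_le_of_abs_le (hN.abs_inv_le h))
    (hu.smooth.continuous.pow 2) (fun _ => sq_nonneg _) (fun y hy => (hL y).trans (by
      have : c * ‖y‖ ≤ c * (s / (4 * c)) := by gcongr
      have e : c * (s / (4 * c)) = s / 4 := by field_simp
      linarith))
  have h3 : _ ≤ K₂ * height S u s := H₂ S b u R h hu s hs hs1 hsR
  rw [affMap_zero] at h1
  have hH := h.height_nonneg u hs.le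
  refine le_trans ?_ (mul_le_mul_of_nonneg_right (le_abs_self _) hH)
  have hD : (0 : ℝ) ≤ n.factorial * lam ^ n := by positivity
  have h4 := h1.trans (mul_le_mul_of_nonneg_left (h2.trans (mul_le_mul_of_nonneg_left h3 hD)) hK₁)
  have e : s ^ n * u x ^ 2 = (4 * c) ^ n * ((s / (4 * c)) ^ n * u x ^ 2) := by
    rw [div_pow]; field_simp
  rw [e]
  calc _ ≤ (4 * c) ^ n * (K₁ * (n.factorial * lam ^ n * (K₂ * height S u s))) := by gcongr
    _ = _ := by ring

end Pointwise

section Doubling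

variable {n : ℕ} {lam M R : ℝ} {S : Fin n → Fin n → Eu n → ℝ} {b : Fin n → Eu n → ℝ}
  {u : Eu n → ℝ}

lemma abs_le_supBall (hu : Continuous u) {r : ℝ} {x : Eu n} (hx : x ∈ closedBall (0 : Eu n) r) :
    |u x| ≤ supBall u 0 r := by
  have hb : BddAbove (Set.range fun x : closedBall (0 : Eu n) r => |u x|) := by
    have := ((isCompact_closedBall (0 : Eu n) r).image hu.abs).bddAbove
    refine this.mono ?_
    rintro _ ⟨y, rfl⟩
    exact ⟨y, y.2, rfl⟩
  exact le_ciSup hb ⟨x, hx⟩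

lemma supBall_le {r K : ℝ} (hr : 0 ≤ r) (h : ∀ x ∈ closedBall (0 : Eu n) r, |u x| ≤ K) :
    supBall u 0 r ≤ K := by
  have : Nonempty (closedBall (0 : Eu n) r) := ⟨⟨0, by simpa using hr⟩⟩
  exact ciSup_le fun x => h x x.2

lemma supBall_nonneg (r : ℝ) : 0 ≤ supBall u 0 r := Real.iSup_nonneg fun _ => abs_nonneg _

lemma supBall_pos (hu : Continuous u) {r : ℝ} (hne : ∃ x ∈ closedBall (0 : Eu n) r, u x ≠ 0) :
    0 < supBall u 0 r := by
  obtain ⟨x, hx, h⟩ := hne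
  exact (abs_pos.mpr h).trans_le (abs_le_supBall hu hx)

lemma supBall_eq_zero {r : ℝ} (hr : 0 ≤ r) (hne : ¬ ∃ x ∈ closedBall (0 : Eu n) r, u x ≠ 0) :
    supBall u 0 r = 0 := by
  push Not at hne
  refine le_antisymm (supBall_le hr fun x hx => by simp [hne x hx]) (supBall_nonneg r)

lemma Coef.height_le_supBall (h : Coef n lam M S b) (hn : 2 ≤ n) (hu : Continuous u) {r : ℝ}
    (hr : 0 < r) :
    height S u r ≤ lam * (sphMeas n).real Set.univ * (r ^ n * supBall u 0 r ^ 2) := by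
  have h1 := h.height_le hn hu hr
  have h2 : sph (fun x => u x ^ 2) r ≤ (sphMeas n).real Set.univ * supBall u 0 r ^ 2 := by
    have : sph (fun _ : Eu n => supBall u 0 r ^ 2) r =
        (sphMeas n).real Set.univ * supBall u 0 r ^ 2 := by
      simp [sph]
    rw [← this]
    refine sph_mono hr (hu.pow 2).continuousOn continuousOn_const fun x hx => ?_
    rw [← sq_abs]
    exact pow_le_pow_left₀ (abs_nonneg _) (abs_le_supBall hu (by simp [hx])) 2
  have h3 : 0 ≤ lam * r ^ n := by have := h.lam_pos; positivity
  calc _ ≤ _ := h1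
    _ ≤ lam * r ^ n * ((sphMeas n).real Set.univ * supBall u 0 r ^ 2) := by gcongr
    _ = _ := by ring

/-- The logarithm of the supremum is comparable to the logarithm of the normalized height. -/
lemma exists_log_supBall (n : ℕ) (hn : 2 ≤ n) (lam M : ℝ) : ∃ C : ℝ, 0 ≤ C ∧
    ∀ (S : Fin n → Fin n → Eu n → ℝ) (b : Fin n → Eu n → ℝ) (u : Eu n → ℝ) (R : ℝ),
      Coef n lam M S b → (∀ i j, S i j 0 = if i = j then 1 else 0) → Sol S b R u →
      ∀ s : ℝ, 0 < s → s ≤ 1 → s < R → 0 < height S u s →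
      (0 < supBall u 0 (2 * s / 3) → 2 * Real.log (supBall u 0 (2 * s / 3)) ≤ logHeight S u s + C) ∧
      (0 < supBall u 0 s → logHeight S u s ≤ 2 * Real.log (supBall u 0 s) + C) := by
  obtain ⟨K, hK, H⟩ := exists_pointwise_le n hn lam M
  set K' := |lam * (sphMeas n).real Set.univ| with hK'
  have hK0 : 0 ≤ K' := abs_nonneg _
  refine ⟨Real.log (K + 1) + Real.log (K' + 1), add_nonneg (Real.log_nonneg (by linarith))
    (Real.log_nonneg (by linarith)), ?_⟩
  intro S b u R h h0 hu s hs hs1 hsR hH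
  have l1 : 0 ≤ Real.log (K + 1) := Real.log_nonneg (by linarith)
  have l2 : 0 ≤ Real.log (K' + 1) := Real.log_nonneg (by linarith)
  have hc := hu.smooth.continuous
  have e := Coef.exp_logHeight hs hH
  constructor
  · intro hm
    have h1 : supBall u 0 (2 * s / 3) ^ 2 ≤ (K + 1) * Real.exp (logHeight S u s) := by
      have hle : supBall u 0 (2 * s / 3) ≤ Real.sqrt ((K + 1) * Real.exp (logHeight S u s)) := by
        refine supBall_le (by positivity) fun x hx => ?_
        refine Real.abs_le_sqrt ?_
        have h2 := H S b u R h h0 hu s hs hs1 hsR x (by simpa using hx)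
        rw [← e] at h2
        have h3 : u x ^ 2 ≤ K * Real.exp (logHeight S u s) := by
          refine le_of_mul_le_mul_right ?_ (pow_pos hs n)
          linarith
        nlinarith [Real.exp_pos (logHeight S u s)]
      calc _ ≤ _ := pow_le_pow_left₀ hm.le hle 2
        _ = _ := Real.sq_sqrt (by positivity)
    have h4 := Real.log_le_log (by positivity) h1
    rw [Real.log_pow, Real.log_mul (by positivity) (by positivity), Real.log_exp] at h4
    push_cast at h4
    linarith
  · intro hm
    have h1 := h.height_le_supBall hn hc hs
    have h2 : Real.exp (logHeight S u s) ≤ (K' + 1) * supBall u 0 s ^ 2 := by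
      refine le_of_mul_le_mul_right ?_ (pow_pos hs n)
      rw [e]
      have h3 : lam * (sphMeas n).real Set.univ ≤ K' + 1 := (le_abs_self _).trans (by linarith)
      calc _ ≤ _ := h1
        _ ≤ (K' + 1) * (s ^ n * supBall u 0 s ^ 2) := by gcongr
        _ = _ := by ring
    have h4 := Real.log_le_log (by positivity) h2
    rw [Real.log_exp, Real.log_mul (by positivity) (by positivity), Real.log_pow] at h4
    push_cast at h4
    linarith

/-- Comparability of the doubling index with the (drift-free) frequency. -/
lemma exists_doubling (n : ℕ) (hn : 2 ≤ n) (lam M : ℝ) : ∃ c K : ℝ, 0 < c ∧ 0 ≤ K ∧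
    ∀ (S : Fin n → Fin n → Eu n → ℝ) (b : Fin n → Eu n → ℝ) (u : Eu n → ℝ) (R : ℝ),
      Coef n lam M S b → (∀ i j, S i j 0 = if i = j then 1 else 0) → Sol S b R u → 1 < R →
      ∀ r : ℝ, 0 < r → r ≤ 1 / 4 →
      c * (r ^ 2 * dirichlet S u r / height S u r) - K ≤ dIndex u 0 r ∧
      dIndex u 0 r ≤ K * ((4 * r) ^ 2 * dirichlet S u (4 * r) / height S u (4 * r)) + K := by
  obtain ⟨C, hC, H⟩ := exists_growth n hn lam M
  obtain ⟨C', hC', H'⟩ := exists_log_supBall n hn lam M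
  have hl43 : 0 < Real.log (4 / 3) := Real.log_pos (by norm_num)
  have hl2 : 0 < Real.log 2 := Real.log_pos (by norm_num)
  have hl2' : 1 ≤ 2 * Real.log 2 := by have := Real.log_two_gt_d9; linarith
  set E := Real.exp C with hE
  have hE1 : 1 ≤ E := Real.one_le_exp (by linarith)
  set e := Real.exp (-C) with he
  have he0 : 0 < e := Real.exp_pos _
  have hEe : E * e = 1 := by rw [hE, he, ← Real.exp_add]; simp
  set K₁ := 2 * Real.log (4 / 3) * C + C + 2 * C' with hK₁
  set K₂ := 4 * E + 4 * E * C + 4 * C + 2 * C' with hK₂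
  have hK₁0 : 0 ≤ K₁ := by positivity
  have hK₂0 : 0 ≤ K₂ := by positivity
  refine ⟨Real.log (4 / 3) * (e * e) / (2 * Real.log 2), K₁ + K₂, by positivity, by positivity, ?_⟩
  intro S b u R h h0 hu hR r hr hr4
  have hc := hu.smooth.continuous
  have hβ4 : 0 ≤ (4 * r) ^ 2 * dirichlet S u (4 * r) / height S u (4 * r) :=
    div_nonneg (mul_nonneg (sq_nonneg _) (h.dirichlet_nonneg u _)) (h.height_nonneg u (by positivity))
  by_cases hne : ∃ x ∈ closedBall (0 : Eu n) r, u x ≠ 0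
  swap
  · have hs := supBall_eq_zero hr.le hne
    have h1 : height S u r = 0 := by
      refine le_antisymm ?_ (h.height_nonneg u hr.le)
      have := h.height_le_supBall hn hc hr
      simpa [hs] using this
    have h2 : dIndex u 0 r = 0 := by simp [dIndex, hs]
    rw [h1, h2]
    constructor
    · simp; linarith
    · positivity
  have hneS : ∀ s, r ≤ s → ∃ x ∈ closedBall (0 : Eu n) s, u x ≠ 0 := fun s hs => by
    obtain ⟨x, hx, h⟩ := hne
    exact ⟨x, closedBall_subset_closedBall hs hx, h⟩
  have hpos : ∀ s, r ≤ s → s ≤ 1 → 0 < height S u s := fun s hs hs1 =>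
    hu.height_pos h hn (hr.trans_le hs) hs1 (hs1.trans_lt hR) (hneS s hs)
  have hsup : ∀ s, r ≤ s → 0 < supBall u 0 s := fun s hs => supBall_pos hc (hneS s hs)
  have G : ∀ s t, r ≤ s → s ≤ t → t ≤ 1 → _ := fun s t hs hst ht =>
    H S b u R h h0 hu s t (hr.trans_le hs) hst ht (ht.trans_lt hR)
      (fun x hx => hpos x (hs.trans hx.1) (hx.2.trans ht))
  have L : ∀ s, r ≤ s → s ≤ 1 → _ := fun s hs hs1 =>
    H' S b u R h h0 hu s (hr.trans_le hs) hs1 (hs1.trans_lt hR) (hpos s hs hs1)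
  have hN : 2 * Real.log 2 * dIndex u 0 r =
      2 * Real.log (supBall u 0 (2 * r)) - 2 * Real.log (supBall u 0 r) := by
    rw [dIndex, Real.logb, Real.log_div (hsup _ (by linarith)).ne' (hsup _ le_rfl).ne']
    field_simp
  constructor
  · obtain ⟨L1, -⟩ := L (3 * r / 2) (by linarith) (by linarith)
    have e1 : 2 * (3 * r / 2) / 3 = r := by ring
    rw [e1] at L1
    obtain ⟨-, L2⟩ := L (2 * r) (by linarith) (by linarith)
    replace L1 := L1 (hsup _ le_rfl)
    replace L2 := L2 (hsup _ (by linarith))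
    obtain ⟨-, -, -, -, -, G1, -⟩ := G (3 * r / 2) (2 * r) (by linarith) (by linarith) (by linarith)
    obtain ⟨a0, a1, -, a2, -, -, -⟩ := G r (3 * r / 2) le_rfl (by linarith) (by linarith)
    have e2 : Real.log (2 * r) - Real.log (3 * r / 2) = Real.log (4 / 3) := by
      rw [← Real.log_div (by positivity) (by positivity)]
      congr 1; field_simp; norm_num
    rw [e2] at G1
    set β := r ^ 2 * dirichlet S u r / height S u r
    set F := freqN S b u r
    set F' := freqN S b u (3 * r / 2)
    have h1 : e * (F + C) ≤ F' + C := by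
      calc _ ≤ e * (E * (F' + C)) := by gcongr
        _ = (E * e) * (F' + C) := by ring
        _ = _ := by rw [hEe, one_mul]
    have h2 : e * e * (β / 2) ≤ e * (F' + C) := by
      have : β / 2 ≤ F + C := by linarith
      calc _ ≤ e * e * (F + C) := by gcongr
        _ = e * (e * (F + C)) := by ring
        _ ≤ _ := by gcongr
    have h3 : Real.log (4 / 3) * (e * e * β) ≤ 2 * (e * (F' + C) - C) * Real.log (4 / 3) +
        2 * Real.log (4 / 3) * C := by nlinarith
    have h4 : Real.log (4 / 3) * (e * e) * β - K₁ ≤ 2 * Real.log 2 * dIndex u 0 r := by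
      rw [hN]; linarith
    have h5 : Real.log (4 / 3) * (e * e) / (2 * Real.log 2) * β - K₁ / (2 * Real.log 2) ≤
        dIndex u 0 r := by
      rw [div_mul_eq_mul_div, ← sub_div, div_le_iff₀ (by positivity)]
      linarith
    have h6 : K₁ / (2 * Real.log 2) ≤ K₁ := div_le_self hK₁0 hl2'
    linarith
  · obtain ⟨L1, -⟩ := L (3 * r) (by linarith) (by linarith)
    have e1 : 2 * (3 * r) / 3 = 2 * r := by ring
    rw [e1] at L1
    obtain ⟨-, L2⟩ := L r le_rfl (by linarith)
    replace L1 := L1 (hsup _ (by linarith))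
    replace L2 := L2 (hsup _ le_rfl)
    obtain ⟨-, -, -, -, -, -, G1⟩ := G (3 * r) (4 * r) (by linarith) (by linarith) (by linarith)
    obtain ⟨-, -, -, -, G2, -, -⟩ := G r (4 * r) le_rfl (by linarith) (by linarith)
    obtain ⟨-, -, G3, -⟩ := G (4 * r) (4 * r) (by linarith) le_rfl (by linarith)
    have e2 : Real.log (4 * r) - Real.log r = 2 * Real.log 2 := by
      rw [← Real.log_div (by positivity) (by positivity)]
      have : 4 * r / r = 2 ^ 2 := by field_simp; norm_num
      rw [this, Real.log_pow]; norm_num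
    rw [e2] at G2
    set β := (4 * r) ^ 2 * dirichlet S u (4 * r) / height S u (4 * r)
    set F := freqN S b u (4 * r)
    have h1 : 2 * Real.log 2 * dIndex u 0 r ≤ 2 * (E * (F + C)) * (2 * Real.log 2) +
        (4 * C + 2 * C') := by rw [hN]; linarith
    have h2 : E * (F + C) ≤ E * (2 * β + 2 * C) := mul_le_mul_of_nonneg_left (by linarith) (by linarith)
    have h3 : dIndex u 0 r ≤ 2 * (E * (F + C)) + (4 * C + 2 * C') := by
      refine le_of_mul_le_mul_left ?_ (by linarith : 0 < 2 * Real.log 2)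
      nlinarith [hC']
    nlinarith [mul_nonneg hK₁0 hβ4, mul_nonneg (by positivity : 0 ≤ 4 * E * C + 4 * C + 2 * C') hβ4]

end Doubling

section Extension

variable {n : ℕ} {lam M R : ℝ}

lemma exists_cutoff (n : ℕ) : ∃ χ : Eu n → ℝ, ContDiff ℝ (⊤ : ℕ∞) χ ∧ (∀ x, 0 ≤ χ x) ∧
    (∀ x, χ x ≤ 1) ∧ (∀ x, ‖x‖ ≤ 5 / 4 → χ x = 1) ∧ (∀ x, 3 / 2 ≤ ‖x‖ → χ x = 0) := by
  let f : ContDiffBump (0 : Eu n) := ⟨5 / 4, 3 / 2, by norm_num, by norm_num⟩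
  refine ⟨f, f.contDiff, fun x => f.nonneg, fun x => f.le_one, fun x hx => ?_, fun x hx => ?_⟩
  · exact f.one_of_mem_closedBall (by simpa using hx)
  · exact f.zero_of_le_dist (by simpa using hx)

lemma contDiff_cutoff_mul {χ f : Eu n → ℝ} (hχ : ContDiff ℝ (⊤ : ℕ∞) χ)
    (h0 : ∀ x, 3 / 2 ≤ ‖x‖ → χ x = 0)
    (hf : ContDiffOn ℝ (⊤ : ℕ∞) f (closedBall (0 : Eu n) 2)) :
    ContDiff ℝ (⊤ : ℕ∞) (fun x => χ x * f x) := by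
  rw [contDiff_iff_contDiffAt]
  intro x
  by_cases hx : ‖x‖ < 2
  · exact hχ.contDiffAt.mul (hf.contDiffAt (closedBall_mem_nhds_of_mem (by simpa using hx)))
  · have : (fun x => χ x * f x) =ᶠ[nhds x] fun _ => 0 := by
      have hopen : IsOpen {y : Eu n | 3 / 2 < ‖y‖} := isOpen_lt continuous_const continuous_norm
      filter_upwards [hopen.mem_nhds (show 3 / 2 < ‖x‖ by linarith)] with y hy
      rw [h0 y (le_of_lt hy), zero_mul]
    exact contDiffAt_const.congr_of_eventuallyEq this

lemma eventually_abs_le {f : Eu n → ℝ} (hf : Continuous f) (h0 : ∀ x, 3 / 2 ≤ ‖x‖ → f x = 0) :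
    ∀ᶠ M in Filter.atTop, ∀ x, |f x| ≤ M := by
  obtain ⟨K, hK⟩ := ((isCompact_closedBall (0 : Eu n) 2).image hf.abs).bddAbove
  filter_upwards [Filter.eventually_ge_atTop K, Filter.eventually_ge_atTop 0] with M hM hM0 x
  by_cases hx : ‖x‖ ≤ 2
  · exact (hK ⟨x, by simpa using hx, rfl⟩).trans hM
  · rw [h0 x (by linarith)]; simpa using hM0

lemma pd_eq_of_eventuallyEq {f g : Eu n → ℝ} {x : Eu n} (i : Fin n) (h : f =ᶠ[nhds x] g) :
    pd i f x = pd i g x := by rw [pd, h.fderiv_eq, pd]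

lemma pd_eq_zero_of_cutoff {f : Eu n → ℝ} (h0 : ∀ x, 3 / 2 ≤ ‖x‖ → f x = 0)
    (i : Fin n) (x : Eu n) (hx : 2 ≤ ‖x‖) : pd i f x = 0 := by
  have : f =ᶠ[nhds x] fun _ => 0 := by
    have hopen : IsOpen {y : Eu n | 3 / 2 < ‖y‖} := isOpen_lt continuous_const continuous_norm
    filter_upwards [hopen.mem_nhds (show 3 / 2 < ‖x‖ by linarith)] with y hy
    exact h0 y (le_of_lt hy)
  rw [pd_eq_of_eventuallyEq i this, pd_const]

lemma eventually_abs_pd_le {f : Eu n → ℝ} (hf : ContDiff ℝ 1 f)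
    (h0 : ∀ x, 3 / 2 ≤ ‖x‖ → f x = 0) :
    ∀ᶠ M in Filter.atTop, ∀ k x, |pd k f x| ≤ M := by
  rw [Filter.eventually_all]
  intro k
  have hc : Continuous (pd k f) := continuous_pd hf k
  obtain ⟨K, hK⟩ := ((isCompact_closedBall (0 : Eu n) 2).image hc.abs).bddAbove
  filter_upwards [Filter.eventually_ge_atTop K, Filter.eventually_ge_atTop 0] with M hM hM0 x
  by_cases hx : ‖x‖ ≤ 2
  · exact (hK ⟨x, by simpa using hx, rfl⟩).trans hM
  · rw [pd_eq_zero_of_cutoff h0 k x (by linarith)]; simpa using hM0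

/-- The symmetric part of `A`, glued to the identity outside a ball. -/
def symExt (χ : Eu n → ℝ) (A : Eu n → Matrix (Fin n) (Fin n) ℝ) (i j : Fin n) (x : Eu n) : ℝ :=
  χ x * ((A x i j + A x j i) / 2 - if i = j then 1 else 0) + if i = j then 1 else 0

/-- The antisymmetric part of `A`, cut off. -/
def skewExt (χ : Eu n → ℝ) (A : Eu n → Matrix (Fin n) (Fin n) ℝ) (i j : Fin n) (x : Eu n) : ℝ :=
  χ x * ((A x i j - A x j i) / 2)

/-- The drift produced by an antisymmetric matrix field. -/
def skewDrift (K : Fin n → Fin n → Eu n → ℝ) (j : Fin n) (x : Eu n) : ℝ := ∑ i, pd i (K i j) x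

lemma sum_pd_skewDrift {K : Fin n → Fin n → Eu n → ℝ} (hK : ∀ i j, ContDiff ℝ 2 (K i j))
    (hs : ∀ i j x, K i j x = -K j i x) (x : Eu n) : ∑ j, pd j (skewDrift K j) x = 0 := by
  have e : ∀ j, pd j (skewDrift K j) x = ∑ i, pd j (pd i (K i j)) x := fun j => by
    unfold skewDrift
    exact pd_sum j Finset.univ (F := fun i => pd i (K i j))
      fun i _ => (contDiff_pd_one (hK i j) i).differentiable one_ne_zero x
  have e2 : ∀ i j, pd j (pd i (K i j)) x = -pd i (pd j (K j i)) x := fun i j => by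
    have h1 : K i j = fun x => (-1) * K j i x := funext fun x => by rw [hs i j x]; ring
    have h2 : pd i (K i j) = fun x => (-1) * pd i (K j i) x := by
      funext y
      rw [h1, pd_const_mul i (f := K j i) _ ((hK j i).differentiable two_ne_zero y)]
    rw [h2, pd_const_mul j (f := pd i (K j i)) _
      ((contDiff_pd_one (hK j i) i).differentiable one_ne_zero x), pd_comm j i (hK j i)]
    ring
  have h1 : ∑ j, pd j (skewDrift K j) x = -∑ j, pd j (skewDrift K j) x := by
    simp only [e]
    conv_lhs => rw [Finset.sum_comm]
    rw [← Finset.sum_neg_distrib]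
    refine Finset.sum_congr rfl fun i _ => ?_
    rw [← Finset.sum_neg_distrib]
    exact Finset.sum_congr rfl fun j _ => e2 i j
  linarith

lemma sum_pd_cograd_skew {K : Fin n → Fin n → Eu n → ℝ} {u : Eu n → ℝ}
    (hK : ∀ i j, ContDiff ℝ 2 (K i j))
    (hs : ∀ i j x, K i j x = -K j i x) (hu : ContDiff ℝ 2 u) (x : Eu n) :
    ∑ i, pd i (cograd K u i) x = drift (skewDrift K) u x := by
  have dK : ∀ i j, DifferentiableAt ℝ (K i j) x := fun i j => (hK i j).differentiable two_ne_zero x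
  have du : ∀ j, DifferentiableAt ℝ (pd j u) x := fun j =>
    (contDiff_pd_one hu j).differentiable one_ne_zero x
  have e : ∀ i, pd i (cograd K u i) x =
      ∑ j, (pd i (K i j) x * pd j u x + K i j x * pd i (pd j u) x) := fun i => by
    unfold cograd
    rw [pd_sum i Finset.univ (F := fun j y => K i j y * pd j u y)
      (fun j _ => (dK i j).mul (du j))]
    exact Finset.sum_congr rfl fun j _ => pd_mul i (dK i j) (du j)
  have h0 : ∑ i, ∑ j, K i j x * pd i (pd j u) x = 0 := by
    have : ∑ i, ∑ j, K i j x * pd i (pd j u) x = -∑ i, ∑ j, K i j x * pd i (pd j u) x := by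
      conv_lhs => rw [Finset.sum_comm]
      rw [← Finset.sum_neg_distrib]
      refine Finset.sum_congr rfl fun i _ => ?_
      rw [← Finset.sum_neg_distrib]
      refine Finset.sum_congr rfl fun j _ => ?_
      rw [hs j i x, pd_comm j i hu]; ring
    linarith
  simp only [e, Finset.sum_add_distrib, h0, add_zero, drift, skewDrift, Finset.sum_mul]
  exact Finset.sum_comm

lemma symExt_comm (χ : Eu n → ℝ) (A : Eu n → Matrix (Fin n) (Fin n) ℝ) (i j : Fin n) :
    symExt χ A i j = symExt χ A j i := by
  funext x
  simp only [symExt, add_comm (A x i j), eq_comm (a := i)]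

lemma sum_symExt (χ : Eu n → ℝ) (A : Eu n → Matrix (Fin n) (Fin n) ℝ) (x : Eu n) (v : Fin n → ℝ) :
    ∑ i, v i * ∑ j, symExt χ A i j x * v j =
      χ x * (∑ i, ∑ j, A x i j * v i * v j) + (1 - χ x) * ∑ i, v i ^ 2 := by
  have e1 : ∑ i, ∑ j, A x j i * v i * v j = ∑ i, ∑ j, A x i j * v i * v j := by
    rw [Finset.sum_comm]
    exact Finset.sum_congr rfl fun i _ => Finset.sum_congr rfl fun j _ => by ring
  have e2 : ∑ i, v i ^ 2 = ∑ i, ∑ j, (if i = j then 1 else 0) * (v i * v j) := by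
    simp [sq]
  calc _ = ∑ i, ∑ j, (χ x / 2 * (A x i j * v i * v j) + χ x / 2 * (A x j i * v i * v j) +
        (1 - χ x) * ((if i = j then 1 else 0) * (v i * v j))) := by
        refine Finset.sum_congr rfl fun i _ => ?_
        rw [Finset.mul_sum]
        refine Finset.sum_congr rfl fun j _ => ?_
        rw [symExt]; ring
    _ = _ := by
        simp only [Finset.sum_add_distrib, ← Finset.mul_sum]
        rw [e1, e2]; ring

variable {A : Eu n → Matrix (Fin n) (Fin n) ℝ} {χ : Eu n → ℝ}

lemma exists_coef_ext (hlam : 1 ≤ lam)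
    (hA : ∀ i j, ContDiffOn ℝ (⊤ : ℕ∞) (fun x => A x i j) (closedBall (0 : Eu n) 2))
    (hell : UnifElliptic A lam (closedBall (0 : Eu n) 2))
    (hχ : ContDiff ℝ (⊤ : ℕ∞) χ) (hχ0 : ∀ x, 0 ≤ χ x) (hχ1 : ∀ x, χ x ≤ 1)
    (hχ2 : ∀ x, 3 / 2 ≤ ‖x‖ → χ x = 0) :
    ∃ M, Coef n lam M (symExt χ A) (skewDrift (skewExt χ A)) := by
  have hS' : ∀ i j, ContDiff ℝ (⊤ : ℕ∞)
      (fun x => χ x * ((A x i j + A x j i) / 2 - if i = j then 1 else 0)) := fun i j =>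
    contDiff_cutoff_mul hχ hχ2 ((((hA i j).add (hA j i)).div_const 2).sub contDiffOn_const)
  have hS : ∀ i j, ContDiff ℝ (⊤ : ℕ∞) (symExt χ A i j) := fun i j =>
    (hS' i j).add contDiff_const
  have hK : ∀ i j, ContDiff ℝ (⊤ : ℕ∞) (skewExt χ A i j) := fun i j =>
    contDiff_cutoff_mul hχ hχ2 (((hA i j).sub (hA j i)).div_const 2)
  have l1 : (1 : WithTop ℕ∞) ≤ ((⊤ : ℕ∞) : WithTop ℕ∞) := by exact_mod_cast le_top
  have l2 : (2 : WithTop ℕ∞) ≤ ((⊤ : ℕ∞) : WithTop ℕ∞) := WithTop.coe_le_coe.2 (le_top (a := (2 : ℕ∞)))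
  have hKp : ∀ i j, ContDiff ℝ 1 (pd i (skewExt χ A i j)) := fun i j =>
    contDiff_pd_one ((hK i j).of_le l2) i
  have hb : ∀ j, ContDiff ℝ 1 (skewDrift (skewExt χ A) j) := fun j =>
    ContDiff.sum fun i _ => hKp i j
  have E1 : ∀ᶠ M in Filter.atTop, ∀ i j x,
      |χ x * ((A x i j + A x j i) / 2 - if i = j then 1 else 0)| ≤ M := by
    simp only [Filter.eventually_all]
    exact fun i j => eventually_abs_le (hS' i j).continuous fun x hx => by rw [hχ2 x hx, zero_mul]
  have E2 : ∀ᶠ M in Filter.atTop, ∀ i j k x,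
      |pd k (fun x => χ x * ((A x i j + A x j i) / 2 - if i = j then 1 else 0)) x| ≤ M := by
    rw [Filter.eventually_all]
    intro i
    rw [Filter.eventually_all]
    exact fun j => eventually_abs_pd_le ((hS' i j).of_le l1) fun x hx => by
      rw [hχ2 x hx, zero_mul]
  have E3 : ∀ᶠ M in Filter.atTop, ∀ i j k x, |pd k (skewExt χ A i j) x| ≤ M := by
    rw [Filter.eventually_all]
    intro i
    rw [Filter.eventually_all]
    exact fun j => eventually_abs_pd_le ((hK i j).of_le l1) fun x hx => by
      rw [skewExt, hχ2 x hx, zero_mul]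
  obtain ⟨M, M1, M2, M3, M0⟩ := (E1.and (E2.and (E3.and (Filter.eventually_ge_atTop 0)))).exists
  have hpdS : ∀ i j k x, pd k (symExt χ A i j) x =
      pd k (fun x => χ x * ((A x i j + A x j i) / 2 - if i = j then 1 else 0)) x := fun i j k x => by
    unfold symExt
    rw [pd_add k (f := fun x => χ x * ((A x i j + A x j i) / 2 - if i = j then 1 else 0))
      (g := fun _ => if i = j then 1 else 0)
      (((hS' i j).of_le l1).differentiable one_ne_zero x) (by fun_prop), pd_const, add_zero]
  refine ⟨(n + 1) * (M + 1), hlam, fun i j => (hS i j).of_le l1, hb, symExt_comm χ A, ?_, ?_, ?_,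
    ?_, ?_, ?_⟩
  · intro x v
    rw [sum_symExt]
    have hv : 0 ≤ ∑ i, v i ^ 2 := Finset.sum_nonneg fun i _ => sq_nonneg _
    have hχx := hχ0 x
    have h1 : (∑ i, v i ^ 2) * (1 - χ x) ≤ lam * ((1 - χ x) * ∑ i, v i ^ 2) := by
      have : 0 ≤ (1 - χ x) * ∑ i, v i ^ 2 := mul_nonneg (by linarith [hχ1 x]) hv
      nlinarith
    by_cases hx : ‖x‖ ≤ 2
    · have h2 := (hell x (by simpa using hx) v).1
      rw [inv_mul_le_iff₀ (by linarith)] at h2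
      nlinarith [mul_le_mul_of_nonneg_left h2 hχx]
    · have := hχ2 x (by linarith)
      rw [this] at h1 ⊢
      linarith
  · intro x v
    rw [sum_symExt]
    have hv : 0 ≤ ∑ i, v i ^ 2 := Finset.sum_nonneg fun i _ => sq_nonneg _
    have hχx := hχ0 x
    have h1 : (1 - χ x) * ∑ i, v i ^ 2 ≤ (1 - χ x) * (lam * ∑ i, v i ^ 2) := by
      have : ∑ i, v i ^ 2 ≤ lam * ∑ i, v i ^ 2 := by nlinarith
      exact mul_le_mul_of_nonneg_left this (by linarith [hχ1 x])
    by_cases hx : ‖x‖ ≤ 2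
    · have h2 := (hell x (by simpa using hx) v).2
      nlinarith [mul_le_mul_of_nonneg_left h2 hχx]
    · have := hχ2 x (by linarith)
      rw [this] at h1 ⊢
      linarith
  · intro i j x
    have h1 := M1 i j x
    have h2 : |(if i = j then 1 else 0 : ℝ)| ≤ 1 := by split_ifs <;> simp
    have h3 := (abs_add_le (χ x * ((A x i j + A x j i) / 2 - if i = j then 1 else 0))
      (if i = j then 1 else 0)).trans (add_le_add h1 h2)
    refine h3.trans ?_
    have : (0 : ℝ) ≤ n := n.cast_nonneg
    nlinarith
  · intro k i j x
    rw [hpdS]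
    have : (0 : ℝ) ≤ n := n.cast_nonneg
    have := M2 i j k x
    nlinarith
  · intro j x
    have : |skewDrift (skewExt χ A) j x| ≤ n * M := abs_sum_le_card fun i => M3 i j i x
    have : (0 : ℝ) ≤ n := n.cast_nonneg
    nlinarith
  · exact sum_pd_skewDrift (fun i j => (hK i j).of_le l2) fun i j x => by simp only [skewExt]; ring

lemma symExt_of_eq_one {x : Eu n} (hx : χ x = 1) (i j : Fin n) :
    symExt χ A i j x = (A x i j + A x j i) / 2 := by rw [symExt, hx]; ring

lemma sol_ext
    (hA : ∀ i j, ContDiffOn ℝ (⊤ : ℕ∞) (fun x => A x i j) (closedBall (0 : Eu n) 2))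
    (hχ : ContDiff ℝ (⊤ : ℕ∞) χ) (hχ1 : ∀ x, ‖x‖ ≤ 5 / 4 → χ x = 1)
    (hχ2 : ∀ x, 3 / 2 ≤ ‖x‖ → χ x = 0) {u : Eu n → ℝ}
    (hu : ContDiffOn ℝ (⊤ : ℕ∞) u (closedBall (0 : Eu n) 2))
    (hsol : SolvesDiv A u (closedBall (0 : Eu n) 2)) :
    Sol (symExt χ A) (skewDrift (skewExt χ A)) (5 / 4) (fun x => χ x * u x) := by
  have l1 : (1 : WithTop ℕ∞) ≤ ((⊤ : ℕ∞) : WithTop ℕ∞) := by exact_mod_cast le_top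
  have l2 : (2 : WithTop ℕ∞) ≤ ((⊤ : ℕ∞) : WithTop ℕ∞) := WithTop.coe_le_coe.2 (le_top (a := (2 : ℕ∞)))
  have hS : ∀ i j, ContDiff ℝ 1 (symExt χ A i j) := fun i j =>
    ((contDiff_cutoff_mul hχ hχ2 ((((hA i j).add (hA j i)).div_const 2).sub
      contDiffOn_const)).add contDiff_const).of_le l1
  have hK : ∀ i j, ContDiff ℝ 2 (skewExt χ A i j) := fun i j =>
    (contDiff_cutoff_mul hχ hχ2 (((hA i j).sub (hA j i)).div_const 2)).of_le l2
  have hv : ContDiff ℝ 2 (fun x => χ x * u x) := (contDiff_cutoff_mul hχ hχ2 hu).of_le l2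
  set v := fun x => χ x * u x with hv_def
  refine ⟨hv, fun x hx => ?_⟩
  have hnear : ∀ᶠ y in nhds x, ‖y‖ < 5 / 4 :=
    (isOpen_lt continuous_norm continuous_const).mem_nhds hx
  have hvu : ∀ y, ‖y‖ < 5 / 4 → v =ᶠ[nhds y] u := fun y hy => by
    filter_upwards [(isOpen_lt continuous_norm continuous_const).mem_nhds hy] with z hz
    rw [hv_def]
    simp only
    rw [hχ1 z (le_of_lt hz), one_mul]
  have dv : ∀ j, Differentiable ℝ (pd j v) := fun j =>
    (contDiff_pd_one hv j).differentiable one_ne_zero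
  have dS : ∀ i, DifferentiableAt ℝ (cograd (symExt χ A) v i) x := fun i =>
    DifferentiableAt.fun_sum fun j _ => ((hS i j).differentiable one_ne_zero x).mul (dv j x)
  have dK : ∀ i, DifferentiableAt ℝ (cograd (skewExt χ A) v i) x := fun i =>
    DifferentiableAt.fun_sum fun j _ => ((hK i j).differentiable two_ne_zero x).mul (dv j x)
  rw [← sum_pd_cograd_skew hK (fun i j x => by simp only [skewExt]; ring) hv,
    ← Finset.sum_add_distrib, ← hsol x (by simp; linarith)]
  refine Finset.sum_congr rfl fun i _ => ?_
  have dA : ∀ j, DifferentiableAt ℝ (fun y => A y i j * pd j u y) x := fun j => by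
    have h1 : DifferentiableAt ℝ (fun y => A y i j) x :=
      ((hA i j).contDiffAt (closedBall_mem_nhds_of_mem (by simp; linarith))).differentiableAt
        (by simp)
    have h2 : DifferentiableAt ℝ (pd j u) x := by
      refine (dv j x).congr_of_eventuallyEq ?_
      filter_upwards [hnear] with y hy
      exact (pd_eq_of_eventuallyEq j (hvu y hy)).symm
    exact h1.mul h2
  rw [← pd_add i (f := cograd (symExt χ A) v i) (g := cograd (skewExt χ A) v i) (dS i) (dK i),
    ← pd_sum i Finset.univ (F := fun j y => A y i j * pd j u y) (fun j _ => dA j)]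
  refine pd_eq_of_eventuallyEq i ?_
  filter_upwards [hnear] with y hy
  simp only [cograd]
  rw [← Finset.sum_add_distrib]
  refine Finset.sum_congr rfl fun j _ => ?_
  rw [symExt_of_eq_one (hχ1 y hy.le), skewExt, hχ1 y hy.le, pd_eq_of_eventuallyEq j (hvu y hy)]
  ring

lemma quad_symExt {x : Eu n} (hx : χ x = 1) :
    quad (symExt χ A) x = ∑ i, ∑ j, A x i j * x j * x i := by
  have := sum_symExt χ A x (fun i => x i)
  rw [hx] at this
  simp only [one_mul, sub_self, zero_mul, add_zero] at this
  rw [quad]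
  simp only [rad]
  rw [this]
  exact Finset.sum_congr rfl fun i _ => Finset.sum_congr rfl fun j _ => by ring

lemma energy_symExt {x : Eu n} (hx : χ x = 1) (u : Eu n → ℝ) :
    energy (symExt χ A) u x = ∑ i, ∑ j, A x i j * pd j u x * pd i u x := by
  have := sum_symExt χ A x (fun i => pd i u x)
  rw [hx] at this
  simp only [one_mul, sub_self, zero_mul, add_zero] at this
  rw [energy]
  simp only [cograd]
  rw [this]
  exact Finset.sum_congr rfl fun i _ => Finset.sum_congr rfl fun j _ => by ring

end Extension

section Uniform

/-- Finite measures on a compact space whose balls have a measure depending only on the radius are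
proportional. -/
lemma mul_integral_eq_of_measure_closedBall_eq {X : Type*} [MetricSpace X] [CompactSpace X]
    [SecondCountableTopology X] [MeasurableSpace X] [BorelSpace X] {μ ν : Measure X}
    [IsFiniteMeasure μ] [IsFiniteMeasure ν] [μ.IsOpenPosMeasure]
    (hμ : ∀ x y ε, μ (closedBall x ε) = μ (closedBall y ε))
    (hν : ∀ x y ε, ν (closedBall x ε) = ν (closedBall y ε)) {f : X → ℝ} (hf : Continuous f) :
    μ.real Set.univ * ∫ x, f x ∂ν = ν.real Set.univ * ∫ x, f x ∂μ := by
  rcases isEmpty_or_nonempty X with hX | ⟨⟨x₀⟩⟩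
  · simp [Measure.eq_zero_of_isEmpty μ, Measure.eq_zero_of_isEmpty ν]
  have key : ∀ δ : ℝ, 0 < δ → |μ.real Set.univ * ∫ x, f x ∂ν - ν.real Set.univ * ∫ x, f x ∂μ| ≤
      μ.real Set.univ * ν.real Set.univ * δ := by
    intro δ hδ
    obtain ⟨ε', hε', hu⟩ := Metric.uniformContinuous_iff.mp
      (CompactSpace.uniformContinuous_of_continuous hf) δ hδ
    set ε := ε' / 2 with hε_def
    have hε : 0 < ε := by positivity
    set E : Set (X × X) := {p | dist p.1 p.2 ≤ ε} with hE
    have hEm : MeasurableSet E :=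
      (isClosed_le (continuous_fst.dist continuous_snd) continuous_const).measurableSet
    set s := μ.real (closedBall x₀ ε)
    set v := ν.real (closedBall x₀ ε)
    have hs : 0 < s := by
      refine ENNReal.toReal_pos ?_ (measure_ne_top _ _)
      exact (measure_closedBall_pos μ x₀ hε).ne'
    have h_int : ∀ g : X × X → ℝ, Continuous g → Integrable (E.indicator g) (ν.prod μ) :=
      fun g hg => (hg.integrable_of_hasCompactSupport (HasCompactSupport.of_compactSpace g)).indicator
        hEm
    have i1 : ∀ g : X → ℝ, Continuous g → ∫ p, E.indicator (fun p => g p.1) p ∂(ν.prod μ) =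
        s * ∫ x, g x ∂ν := fun g hg => by
      rw [integral_prod _ (h_int (fun p => g p.1) (hg.comp continuous_fst)), ← integral_const_mul]
      refine integral_congr_ae (Filter.Eventually.of_forall fun x => ?_)
      have : (fun y => E.indicator (fun p : X × X => g p.1) (x, y)) =
          (closedBall x ε).indicator fun _ => g x := by
        funext y
        simp only [Set.indicator, hE, Set.mem_ofPred_eq, mem_closedBall, dist_comm x y]
      simp only [this]
      rw [integral_indicator measurableSet_closedBall, setIntegral_const, smul_eq_mul]
      congr 1
      exact congrArg ENNReal.toReal (hμ x x₀ ε)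
    have i2 : ∀ g : X → ℝ, Continuous g → ∫ p, E.indicator (fun p => g p.2) p ∂(ν.prod μ) =
        v * ∫ x, g x ∂μ := fun g hg => by
      rw [integral_prod_symm _ (h_int (fun p => g p.2) (hg.comp continuous_snd)), ← integral_const_mul]
      refine integral_congr_ae (Filter.Eventually.of_forall fun y => ?_)
      have : (fun x => E.indicator (fun p : X × X => g p.2) (x, y)) =
          (closedBall y ε).indicator fun _ => g y := by
        funext x
        simp only [Set.indicator, hE, Set.mem_ofPred_eq, mem_closedBall]
      simp only [this]
      rw [integral_indicator measurableSet_closedBall, setIntegral_const, smul_eq_mul]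
      congr 1
      exact congrArg ENNReal.toReal (hν y x₀ ε)
    have i3 : s * ν.real Set.univ = v * μ.real Set.univ := by
      have h1 := i1 (fun _ => 1) continuous_const
      have h2 := i2 (fun _ => 1) continuous_const
      rw [h1] at h2
      simpa using h2
    have i4 : |s * ∫ x, f x ∂ν - v * ∫ x, f x ∂μ| ≤ δ * (s * ν.real Set.univ) := by
      have h1 := i1 (fun _ => 1) continuous_const
      rw [← i1 f hf, ← i2 f hf, ← integral_sub (h_int (fun p => f p.1) (hf.comp continuous_fst))
        (h_int (fun p => f p.2) (hf.comp continuous_snd)), ← Real.norm_eq_abs]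
      have h2 : s * ν.real Set.univ = ∫ p, E.indicator (fun _ => (1 : ℝ)) p ∂(ν.prod μ) := by
        rw [h1]; simp
      rw [h2, ← integral_const_mul]
      refine norm_integral_le_of_norm_le ((h_int _ continuous_const).const_mul δ)
        (Filter.Eventually.of_forall fun p => ?_)
      by_cases hp : p ∈ E
      · simp only [Set.indicator_of_mem hp, mul_one]
        have h3 : dist p.1 p.2 ≤ ε := hp
        have := hu (a := p.1) (b := p.2) (by linarith)
        rw [Real.dist_eq] at this
        exact this.le
      · simp [Set.indicator_of_notMem hp]
    refine le_of_mul_le_mul_left ?_ hs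
    have hm : 0 ≤ μ.real Set.univ := measureReal_nonneg
    calc s * |μ.real Set.univ * ∫ x, f x ∂ν - ν.real Set.univ * ∫ x, f x ∂μ|
        = μ.real Set.univ * |s * ∫ x, f x ∂ν - v * ∫ x, f x ∂μ| := by
          conv_lhs => rw [← abs_of_pos hs, ← abs_mul]
          conv_rhs => rw [← abs_of_nonneg hm, ← abs_mul]
          congr 1
          linear_combination (-∫ x, f x ∂μ) * i3
      _ ≤ μ.real Set.univ * (δ * (s * ν.real Set.univ)) := by gcongr
      _ = _ := by ring
  have h0 : |μ.real Set.univ * ∫ x, f x ∂ν - ν.real Set.univ * ∫ x, f x ∂μ| ≤ 0 := by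
    refine le_of_forall_pos_le_add fun η hη => ?_
    set P := μ.real Set.univ * ν.real Set.univ with hP
    have hP0 : 0 ≤ P := mul_nonneg measureReal_nonneg measureReal_nonneg
    refine (key (η / (P + 1)) (by positivity)).trans ?_
    rw [zero_add, mul_div_assoc', div_le_iff₀ (by positivity)]
    nlinarith
  exact sub_eq_zero.mp (abs_nonpos_iff.mp h0)

end Uniform

section Rotation

variable {n : ℕ}

open scoped Pointwise

lemma exists_isometry_image_closedBall (x y : sphere (0 : Eu n) 1) (ε : ℝ) :
    ∃ R : Eu n ≃ₗᵢ[ℝ] Eu n, ((↑) '' closedBall y ε : Set (Eu n)) = R '' ((↑) '' closedBall x ε) := by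
  have hxy : ‖(x : Eu n)‖ = ‖(y : Eu n)‖ := by simp
  refine ⟨(Submodule.span ℝ {(x : Eu n) - y})ᗮ.reflection, ?_⟩
  set R := (Submodule.span ℝ {(x : Eu n) - y})ᗮ.reflection with hR
  have hRx : R x = y := Submodule.reflection_sub hxy
  ext z
  simp only [Set.mem_image, Subtype.exists, mem_closedBall, Subtype.dist_eq, mem_sphere_zero_iff_norm]
  constructor
  · rintro ⟨w, hw, hd, rfl⟩
    refine ⟨R.symm w, ⟨R.symm w, by simpa using hw, ?_, rfl⟩, by simp⟩
    rw [← R.dist_map, R.apply_symm_apply, hRx]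
    exact hd
  · rintro ⟨_, ⟨w, hw, hd, rfl⟩, rfl⟩
    refine ⟨R w, by simpa using hw, ?_, rfl⟩
    rw [← hRx, R.dist_map]
    exact hd

lemma sphMeas_closedBall_eq (x y : sphere (0 : Eu n) 1) (ε : ℝ) :
    sphMeas n (closedBall x ε) = sphMeas n (closedBall y ε) := by
  obtain ⟨R, hR⟩ := exists_isometry_image_closedBall x y ε
  rw [Measure.toSphere_apply' _ measurableSet_closedBall,
    Measure.toSphere_apply' _ measurableSet_closedBall, hR]
  have : Set.Ioo (0 : ℝ) 1 • (R '' ((↑) '' closedBall x ε)) =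
      R '' (Set.Ioo (0 : ℝ) 1 • ((↑) '' closedBall x ε : Set (Eu n))) := by
    ext z
    simp only [Set.mem_smul, Set.mem_image]
    constructor
    · rintro ⟨t, ht, _, ⟨w, hw, rfl⟩, rfl⟩
      exact ⟨t • w, ⟨t, ht, w, hw, rfl⟩, by simp⟩
    · rintro ⟨_, ⟨t, ht, w, hw, rfl⟩, rfl⟩
      exact ⟨t, ht, R w, ⟨w, hw, rfl⟩, by simp⟩
  rw [this]
  congr 1
  have h2 : ∀ T : Set (Eu n), R '' T = R.symm ⁻¹' T := fun T =>
    R.toEquiv.image_eq_preimage_symm T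
  rw [h2, R.symm.measurePreserving.measure_preimage_emb
    R.symm.toHomeomorph.measurableEmbedding]

lemma hausdorffMeasure_closedBall_eq {d : ℝ} (hd : 0 ≤ d) (x y : sphere (0 : Eu n) 1) (ε : ℝ) :
    μH[d] (closedBall x ε) = μH[d] (closedBall y ε) := by
  obtain ⟨R, hR⟩ := exists_isometry_image_closedBall x y ε
  rw [← isometry_subtype_coe.hausdorffMeasure_image (Or.inl hd),
    ← isometry_subtype_coe.hausdorffMeasure_image (Or.inl hd) (closedBall y ε), hR]
  exact (R.toIsometryEquiv.hausdorffMeasure_image d _).symm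

end Rotation

section HausdorffSphere

variable {n : ℕ}

open scoped Pointwise

lemma finrank_orthogonal_sphere (hn : 2 ≤ n) {v : Eu n} (hv : ‖v‖ = 1) :
    ((Module.finrank ℝ (Submodule.span ℝ {v})ᗮ : ℕ) : ℝ) = (n : ℝ) - 1 := by
  obtain ⟨m, rfl⟩ : ∃ m, n = m + 1 := ⟨n - 1, by omega⟩
  have : Fact (Module.finrank ℝ (Eu (m + 1)) = m + 1) := ⟨by simp⟩
  rw [Submodule.finrank_orthogonal_span_singleton (n := m) (norm_ne_zero_iff.mp (by simp [hv]))]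
  simp

lemma hausdorffMeasure_sphere_lt_top (hn : 2 ≤ n) :
    μH[(n : ℝ) - 1] (sphere (0 : Eu n) 1) < ⊤ := by
  have hd : (0 : ℝ) ≤ (n : ℝ) - 1 := by
    have : (2 : ℝ) ≤ n := by exact_mod_cast hn
    linarith
  refine (isCompact_sphere (0 : Eu n) 1).measure_lt_top_of_nhdsWithin fun v hv => ?_
  have hv1 : ‖v‖ = 1 := by simpa using hv
  have hvv : inner ℝ v v = (1 : ℝ) := by rw [real_inner_self_eq_norm_sq, hv1]; norm_num
  refine ⟨{x | 1 / 2 < inner ℝ v x} ∩ sphere 0 1, ?_, ?_⟩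
  · refine Filter.inter_mem (mem_nhdsWithin_of_mem_nhds ?_) self_mem_nhdsWithin
    refine IsOpen.mem_nhds (isOpen_lt continuous_const (by fun_prop)) ?_
    simp only [Set.mem_ofPred_eq, hvv]
    norm_num
  set W := (Submodule.span ℝ {v})ᗮ with hW
  have hort : ∀ w : W, inner ℝ v (w : Eu n) = (0 : ℝ) := fun w =>
    Submodule.mem_orthogonal_singleton_iff_inner_right.mp w.2
  have hne : ∀ w : W, v + (w : Eu n) ≠ 0 := fun w h0 => by
    have := congrArg (inner ℝ v) h0
    rw [inner_add_right, hvv, hort, inner_zero_right] at this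
    norm_num at this
  let g : W → Eu n := fun w => ‖v + (w : Eu n)‖⁻¹ • (v + (w : Eu n))
  have hg : ContDiff ℝ 1 g := by
    have h1 : ContDiff ℝ 1 fun w : W => v + (w : Eu n) :=
      contDiff_const.add W.subtypeL.contDiff
    exact ((h1.norm ℝ hne).inv fun w => norm_ne_zero_iff.mpr (hne w)).smul h1
  obtain ⟨k, hk⟩ := hg.contDiffOn.exists_lipschitzOnWith one_ne_zero (convex_closedBall (0 : W) 3)
    (isCompact_closedBall (0 : W) 3)
  have hsub : {x : Eu n | 1 / 2 < inner ℝ v x} ∩ sphere 0 1 ⊆ g '' closedBall (0 : W) 3 := by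
    rintro x ⟨hx, hx1⟩
    have hx' : 1 / 2 < inner ℝ v x := hx
    have hx1' : ‖x‖ = 1 := by simpa using hx1
    set a : ℝ := inner ℝ v x with ha
    have ha0 : 0 < a := by linarith
    have hmem : a⁻¹ • x - v ∈ W := by
      rw [hW, Submodule.mem_orthogonal_singleton_iff_inner_right, inner_sub_right,
        inner_smul_right, hvv, ← ha, inv_mul_cancel₀ ha0.ne', sub_self]
    refine ⟨⟨a⁻¹ • x - v, hmem⟩, ?_, ?_⟩
    · rw [mem_closedBall_zero_iff, Submodule.coe_norm]
      refine (norm_sub_le _ _).trans ?_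
      rw [norm_smul, hx1', hv1, Real.norm_eq_abs, abs_of_pos (inv_pos.mpr ha0)]
      have : a⁻¹ ≤ (1 / 2)⁻¹ := inv_anti₀ (by norm_num) hx'.le
      norm_num at this ⊢
      linarith
    · change ‖v + (a⁻¹ • x - v)‖⁻¹ • (v + (a⁻¹ • x - v)) = x
      rw [add_sub_cancel, norm_smul, hx1', Real.norm_eq_abs, abs_of_pos (inv_pos.mpr ha0), mul_one,
        inv_inv, smul_smul, mul_inv_cancel₀ ha0.ne', one_smul]
  refine (measure_mono hsub).trans_lt ((hk.hausdorffMeasure_image_le hd).trans_lt ?_)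
  refine ENNReal.mul_lt_top (ENNReal.rpow_lt_top_of_nonneg hd ENNReal.coe_ne_top) ?_
  rw [← finrank_orthogonal_sphere hn hv1]
  exact (isCompact_closedBall (0 : W) 3).measure_lt_top

lemma hausdorffMeasure_sphere_pos (hn : 2 ≤ n) :
    0 < μH[(n : ℝ) - 1] (sphere (0 : Eu n) 1) := by
  have hd : (0 : ℝ) ≤ (n : ℝ) - 1 := by
    have : (2 : ℝ) ≤ n := by exact_mod_cast hn
    linarith
  set v : Eu n := EuclideanSpace.single ⟨0, by omega⟩ 1 with hv
  have hv1 : ‖v‖ = 1 := by simp [hv]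
  set W := (Submodule.span ℝ {v})ᗮ with hW
  refine lt_of_lt_of_le ?_ (hausdorffMeasure_orthogonalProjectionOnto_le W _ _ hd)
  have hsub : closedBall (0 : W) 1 ⊆ W.orthogonalProjectionOnto '' sphere (0 : Eu n) 1 := by
    intro w hw
    have hw1 : ‖w‖ ≤ 1 := by simpa using hw
    have hort : inner ℝ (w : Eu n) v = (0 : ℝ) :=
      Submodule.mem_orthogonal_singleton_iff_inner_left.mp w.2
    have h0 : (0 : ℝ) ≤ 1 - ‖w‖ ^ 2 := by nlinarith [norm_nonneg w]
    refine ⟨(w : Eu n) + Real.sqrt (1 - ‖w‖ ^ 2) • v, ?_, ?_⟩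
    · rw [mem_sphere_zero_iff_norm, ← sq_eq_sq₀ (norm_nonneg _) zero_le_one, norm_add_sq_real,
        inner_smul_right, hort, norm_smul, hv1, mul_one, Real.norm_eq_abs, sq_abs, Real.sq_sqrt h0,
        Submodule.coe_norm]
      ring
    · rw [map_add, map_smul, Submodule.orthogonalProjectionOnto_mem_subspace_eq_self]
      have : W.orthogonalProjectionOnto v = 0 :=
        Submodule.orthogonalProjectionOnto_orthogonalComplement_singleton_eq_zero v
      rw [this, smul_zero, add_zero]
  refine lt_of_lt_of_le ?_ (measure_mono hsub)
  rw [← finrank_orthogonal_sphere hn hv1]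
  exact measure_closedBall_pos _ _ one_pos

/-- Integrals over a round sphere against the Hausdorff measure are multiples of the spherical
integral. -/
lemma exists_hausdorff_sphere (n : ℕ) (hn : 2 ≤ n) : ∃ c : ℝ, 0 < c ∧ ∀ r : ℝ, 0 < r →
    ∀ f : Eu n → ℝ, Continuous f →
      ∫ x in sphere (0 : Eu n) r, f x ∂μH[(n : ℝ) - 1] = c * (r ^ (n - 1) * sph f r) := by
  have hd : (0 : ℝ) ≤ (n : ℝ) - 1 := by
    have : (2 : ℝ) ≤ n := by exact_mod_cast hn
    linarith
  set d : ℝ := (n : ℝ) - 1 with hdd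
  set ν : Measure (sphere (0 : Eu n) 1) := μH[d] with hν
  have hmap : Measure.map ((↑) : sphere (0 : Eu n) 1 → Eu n) ν = μH[d].restrict (sphere 0 1) := by
    rw [hν, isometry_subtype_coe.map_hausdorffMeasure (Or.inl hd), Subtype.range_coe]
  have huniv : ν Set.univ = μH[d] (sphere (0 : Eu n) 1) := by
    rw [hν, ← isometry_subtype_coe.hausdorffMeasure_image (Or.inl hd), Set.image_univ,
      Subtype.range_coe]
  have : IsFiniteMeasure ν := ⟨by rw [huniv]; exact hausdorffMeasure_sphere_lt_top hn⟩
  have : Nontrivial (Eu n) := by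
    have : Nonempty (Fin n) := ⟨⟨0, by omega⟩⟩
    infer_instance
  have hνpos : 0 < ν.real Set.univ := by
    refine ENNReal.toReal_pos ?_ (measure_ne_top _ _)
    rw [huniv]
    exact (hausdorffMeasure_sphere_pos hn).ne'
  have hμpos : 0 < (sphMeas n).real Set.univ := by
    have : Nonempty (sphere (0 : Eu n) 1) :=
      (NormedSpace.sphere_nonempty.mpr zero_le_one).to_subtype
    refine ENNReal.toReal_pos ?_ (measure_ne_top _ _)
    exact (isOpen_univ.measure_pos (sphMeas n) Set.univ_nonempty).ne'
  refine ⟨ν.real Set.univ / (sphMeas n).real Set.univ, by positivity, fun r hr f hf => ?_⟩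
  have hscale : μH[d].restrict (sphere (0 : Eu n) r) =
      ENNReal.ofReal (r ^ (n - 1)) • Measure.map (fun x => r • x) (μH[d].restrict (sphere 0 1)) := by
    ext s hs
    have hm : Measurable fun x : Eu n => r • x := measurable_const_smul r
    rw [Measure.restrict_apply hs, Measure.smul_apply, Measure.map_apply hm hs,
      Measure.restrict_apply (hm hs)]
    have h1 : s ∩ sphere (0 : Eu n) r = r • ((fun x => r • x) ⁻¹' s ∩ sphere (0 : Eu n) 1) := by
      ext x
      rw [Set.mem_smul_set_iff_inv_smul_mem₀ hr.ne']
      simp only [Set.mem_inter_iff, mem_sphere_zero_iff_norm, Set.mem_preimage,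
        smul_inv_smul₀ hr.ne', norm_smul, norm_inv, Real.norm_eq_abs, abs_of_pos hr]
      rw [inv_mul_eq_one₀ hr.ne', eq_comm (a := ‖x‖)]
    rw [h1, Measure.hausdorffMeasure_smul₀ hd hr.ne', smul_eq_mul, ENNReal.smul_def, smul_eq_mul]
    congr 1
    rw [ENNReal.ofReal, ENNReal.coe_inj]
    ext
    rw [NNReal.coe_rpow, coe_nnnorm, Real.norm_eq_abs, abs_of_pos hr,
      Real.coe_toNNReal _ (by positivity), ← Real.rpow_natCast, hdd, Nat.cast_sub (by omega)]
    simp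
  have hf2 : Continuous fun θ : sphere (0 : Eu n) 1 => f (r • (θ : Eu n)) := by fun_prop
  have key := mul_integral_eq_of_measure_closedBall_eq (μ := sphMeas n) (ν := ν)
    sphMeas_closedBall_eq (hausdorffMeasure_closedBall_eq hd) hf2
  rw [hscale, integral_smul_measure, integral_map (by fun_prop) hf.aestronglyMeasurable, ← hmap,
    integral_map (by fun_prop) (Continuous.aestronglyMeasurable (by fun_prop)),
    ENNReal.toReal_ofReal (by positivity), smul_eq_mul, div_mul_eq_mul_div, eq_div_iff hμpos.ne',
    sph]
  linear_combination r ^ (n - 1) * key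

end HausdorffSphere

section Assembly

variable {n : ℕ} {lam : ℝ} {A : Eu n → Matrix (Fin n) (Fin n) ℝ} {χ u : Eu n → ℝ}

lemma cutoff_mul_eventuallyEq (hχ1 : ∀ x, ‖x‖ ≤ 5 / 4 → χ x = 1) {x : Eu n} (hx : ‖x‖ ≤ 1) :
    (fun y => χ y * u y) =ᶠ[nhds x] u := by
  have hopen : IsOpen {y : Eu n | ‖y‖ < 5 / 4} := isOpen_lt continuous_norm continuous_const
  filter_upwards [hopen.mem_nhds (show ‖x‖ < 5 / 4 by linarith)] with y hy
  rw [hχ1 y (le_of_lt hy), one_mul]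

lemma supBall_cutoff_mul (hχ1 : ∀ x, ‖x‖ ≤ 5 / 4 → χ x = 1) {r : ℝ} (hr : r ≤ 1) :
    supBall (fun y => χ y * u y) 0 r = supBall u 0 r := by
  refine congrArg iSup (funext fun x => ?_)
  have hx : ‖(x : Eu n)‖ ≤ r := mem_closedBall_zero_iff.mp x.2
  exact congrArg abs (cutoff_mul_eventuallyEq (u := u) hχ1 (hx.trans hr)).eq_of_nhds

lemma dIndex_cutoff_mul (hχ1 : ∀ x, ‖x‖ ≤ 5 / 4 → χ x = 1) {r : ℝ} (hr0 : 0 < r)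
    (hr : r ≤ 1 / 4) : dIndex (fun y => χ y * u y) 0 r = dIndex u 0 r := by
  rw [dIndex, dIndex, supBall_cutoff_mul hχ1 (by linarith), supBall_cutoff_mul hχ1 (by linarith)]

lemma freq_eq_of_cutoff (hn : 2 ≤ n) {c : ℝ}
    (hH : ∀ r : ℝ, 0 < r → ∀ f : Eu n → ℝ, Continuous f →
      ∫ x in sphere (0 : Eu n) r, f x ∂μH[(n : ℝ) - 1] = c * (r ^ (n - 1) * sph f r))
    (hχ1 : ∀ x, ‖x‖ ≤ 5 / 4 → χ x = 1) (hu : Continuous fun x => χ x * u x)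
    (hq : Continuous (quad (symExt χ A))) {r : ℝ} (hr0 : 0 < r) (hr : r ≤ 1) :
    freq A u r = c⁻¹ * (r ^ 2 * dirichlet (symExt χ A) (fun x => χ x * u x) r /
      height (symExt χ A) (fun x => χ x * u x) r) := by
  have hD : ∫ x in closedBall (0 : Eu n) r, ∑ i, ∑ j, A x i j * pd j u x * pd i u x =
      dirichlet (symExt χ A) (fun x => χ x * u x) r := by
    refine setIntegral_congr_fun measurableSet_closedBall fun x hx => ?_
    have hx1 : ‖x‖ ≤ 1 := (mem_closedBall_zero_iff.mp hx).trans hr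
    refine Eq.trans ?_ (energy_symExt (hχ1 x (by linarith)) _).symm
    simp only [pd_eq_of_eventuallyEq _ (cutoff_mul_eventuallyEq (u := u) hχ1 hx1)]
  have hS : ∫ x in sphere (0 : Eu n) r,
      ((∑ i, ∑ j, A x i j * x j * x i) / ‖x‖ ^ 2) * u x ^ 2 ∂μH[(n : ℝ) - 1] =
      c * (r⁻¹ * height (symExt χ A) (fun x => χ x * u x) r) := by
    have e : ∫ x in sphere (0 : Eu n) r,
        ((∑ i, ∑ j, A x i j * x j * x i) / ‖x‖ ^ 2) * u x ^ 2 ∂μH[(n : ℝ) - 1] =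
        ∫ x in sphere (0 : Eu n) r,
          (r ^ 2)⁻¹ * ((χ x * u x) ^ 2 * quad (symExt χ A) x) ∂μH[(n : ℝ) - 1] := by
      refine setIntegral_congr_fun isClosed_sphere.measurableSet fun x hx => ?_
      have hxr : ‖x‖ = r := mem_sphere_zero_iff_norm.mp hx
      have hx1 : χ x = 1 := hχ1 x (by linarith)
      simp only
      rw [quad_symExt hx1, hx1, hxr]
      ring
    rw [e, hH r hr0 (fun x => (r ^ 2)⁻¹ * ((χ x * u x) ^ 2 * quad (symExt χ A) x))
      (continuous_const.mul ((hu.pow 2).mul hq)), sph_const_mul, height]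
    obtain ⟨m, rfl⟩ : ∃ m, n = m + 2 := ⟨n - 2, by omega⟩
    simp only [Nat.add_sub_cancel, show m + 2 - 1 = m + 1 by omega]
    field_simp
    ring
  have hρ : r ^ (1 - (n : ℝ)) ≠ 0 := (Real.rpow_pos_of_pos hr0 _).ne'
  rw [freq, hD, hS, mul_left_comm r, mul_div_mul_left _ _ hρ]
  simp only [div_eq_mul_inv, mul_inv, inv_inv]
  ring

end Assembly

/-- Lemma 2.6 of the paper: comparability of doubling index and frequency,
`C₁⁻¹ β_u(0,r) − C₂ ≤ N_u(0,r) ≤ C₁ β_u(0,4r) + C₂` for `0 < r ≤ 1/4`. -/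
theorem stmt_15 (n : ℕ) (hn : 2 ≤ n) (lam : ℝ) (hlam : 1 ≤ lam)
    (A : EuclideanSpace ℝ (Fin n) → Matrix (Fin n) (Fin n) ℝ)
    (hA : ∀ i j, ContDiffOn ℝ (⊤ : ℕ∞) (fun x => A x i j)
      (closedBall (0 : EuclideanSpace ℝ (Fin n)) 2))
    (hell : UnifElliptic A lam (closedBall (0 : EuclideanSpace ℝ (Fin n)) 2))
    (hA0 : A 0 = 1) :
    ∃ C₁ C₂ : ℝ, 1 ≤ C₁ ∧ 0 ≤ C₂ ∧
      ∀ u : EuclideanSpace ℝ (Fin n) → ℝ,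
        ContDiffOn ℝ (⊤ : ℕ∞) u (closedBall (0 : EuclideanSpace ℝ (Fin n)) 2) →
        SolvesDiv A u (closedBall (0 : EuclideanSpace ℝ (Fin n)) 2) →
        (∃ x ∈ closedBall (0 : EuclideanSpace ℝ (Fin n)) 2, u x ≠ 0) →
        ∀ r : ℝ, 0 < r → r ≤ 1 / 4 →
          C₁⁻¹ * freq A u r - C₂ ≤ dIndex u 0 r ∧
          dIndex u 0 r ≤ C₁ * freq A u (4 * r) + C₂ := by
  obtain ⟨χ, hχ, hχ0, hχle, hχ1, hχ2⟩ := exists_cutoff n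
  obtain ⟨M, hcoef⟩ := exists_coef_ext hlam hA hell hχ hχ0 hχle hχ2
  obtain ⟨c, K, hc, hK, hmain⟩ := exists_doubling n hn lam M
  obtain ⟨cH, hcH, hH⟩ := exists_hausdorff_sphere n hn
  have hS0 : ∀ i j, symExt χ A i j 0 = if i = j then 1 else 0 := fun i j => by
    rw [symExt_of_eq_one (hχ1 0 (by norm_num)), hA0, Matrix.one_apply, Matrix.one_apply]
    by_cases h : i = j
    · simp [h]
    · simp [h, Ne.symm h]
  set C : ℝ := 1 + (c * cH)⁻¹ + K * cH with hC
  have hcc : 0 < (c * cH)⁻¹ := by positivity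
  have hKc : 0 ≤ K * cH := by positivity
  refine ⟨C, K, by linarith, hK, fun u hu hsol _ r hr0 hr => ?_⟩
  have hsol' := sol_ext hA hχ hχ1 hχ2 hu hsol
  obtain ⟨h1, h2⟩ := hmain _ _ _ _ hcoef hS0 hsol' (by norm_num) r hr0 hr
  rw [dIndex_cutoff_mul hχ1 hr0 hr] at h1 h2
  have hfreq : ∀ s : ℝ, 0 < s → s ≤ 1 → freq A u s = cH⁻¹ *
      (s ^ 2 * dirichlet (symExt χ A) (fun x => χ x * u x) s /
        height (symExt χ A) (fun x => χ x * u x) s) := fun s hs0 hs =>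
    freq_eq_of_cutoff hn hH hχ1 hsol'.smooth.continuous hcoef.contDiff_quad.continuous hs0 hs
  have hnn : ∀ s : ℝ, 0 < s → 0 ≤ s ^ 2 * dirichlet (symExt χ A) (fun x => χ x * u x) s /
      height (symExt χ A) (fun x => χ x * u x) s := fun s hs0 =>
    div_nonneg (mul_nonneg (sq_nonneg _) (hcoef.dirichlet_nonneg _ _))
      (hcoef.height_nonneg _ hs0.le)
  rw [hfreq r hr0 (by linarith), hfreq (4 * r) (by linarith) (by linarith)]
  constructor
  · refine (sub_le_sub_right ?_ K).trans h1
    rw [← mul_assoc]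
    refine mul_le_mul_of_nonneg_right ?_ (hnn r hr0)
    have h3 : c⁻¹ = (c * cH)⁻¹ * cH := by field_simp
    rw [← mul_inv, inv_le_comm₀ (by positivity) hc, h3]
    exact mul_le_mul_of_nonneg_right (by linarith) hcH.le
  · refine h2.trans (add_le_add_left ?_ K)
    rw [← mul_assoc]
    refine mul_le_mul_of_nonneg_right ?_ (hnn (4 * r) (by linarith))
    rw [← div_eq_mul_inv, le_div_iff₀ hcH]
    linarith
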